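/- arXiv:2305.13422 — 5 statements merged into one kernel-verified Lean document; each statement's English description precedes it below -/
import Mathlib

section
/- For all positive integers l and k and every integer r ≥ 1, it holds that g(l,k,r) ≤ g(l,k,r-1) + 1 + 2(k-1) · r · l · t(l,r). -/
/-- `r` is a tournament relation on `Fin n`: an orientation of the complete graph,
i.e. irreflexive and, for distinct vertices, exactly one direction is present. -/
def IsTournament {n : ℕ} (r : Fin n → Fin n → Prop) : Prop :=
  (∀ v, ¬ r v v) ∧ ∀ u v : Fin n, u ≠ v → (r u v ↔ ¬ r v u)

/-- `x` is a directed walk (of length `m`) in the digraph `r`;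
vertices and edges may repeat. -/
def IsWalk {n m : ℕ} (r : Fin n → Fin n → Prop) (x : Fin (m + 1) → Fin n) : Prop :=
  ∀ i : Fin m, r (x i.castSucc) (x i.succ)

/-- The sequence of colours along a sequence of `m + 1` vertices. -/
def walkColours {n m : ℕ} {α : Type} (c : Fin n → Fin n → α) (x : Fin (m + 1) → Fin n) :
    Fin m → α :=
  fun i => c (x i.castSucc) (x i.succ)

/-- The edge-coloured digraph `(r, c)` contains an `l`-flash: a directed walk of
length `l` all of whose edges have the same colour. -/
def HasFlash {n : ℕ} {α : Type} (l : ℕ) (r : Fin n → Fin n → Prop)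
    (c : Fin n → Fin n → α) : Prop :=
  ∃ x : Fin (l + 1) → Fin n, IsWalk r x ∧
    ∀ i j : Fin l, walkColours c x i = walkColours c x j

/-- The edge-coloured digraph `(r, c)` contains a `k`-rainbow: a directed walk of
length `k` whose edge colours are pairwise distinct. -/
def HasRainbow {n : ℕ} {α : Type} (k : ℕ) (r : Fin n → Fin n → Prop)
    (c : Fin n → Fin n → α) : Prop :=
  ∃ y : Fin (k + 1) → Fin n, IsWalk r y ∧ Function.Injective (walkColours c y)

/-- The set of `m` such that every edge colouring of any tournament with more than `m`
vertices contains an `l`-flash or a `k`-rainbow. -/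
def tSet (l k : ℕ) : Set ℕ :=
  {m | ∀ n : ℕ, n > m → ∀ r : Fin n → Fin n → Prop, IsTournament r →
    ∀ (α : Type) (c : Fin n → Fin n → α), HasFlash l r c ∨ HasRainbow k r c}

/-- `t l k` is the smallest integer such that every edge colouring of any tournament
with more than `t l k` vertices contains an `l`-flash or a `k`-rainbow. -/
noncomputable def t (l k : ℕ) : ℕ := sInf (tSet l k)
/-- The edge colouring `c` of the complete graph on `Fin n` contains a monotone
`l`-flash: vertices `x 0 < x 1 < ⋯ < x l` whose consecutive edges all get the
same colour. -/
def HasMonoFlash {n : ℕ} {α : Type} (l : ℕ) (c : Fin n → Fin n → α) : Prop :=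
  ∃ x : Fin (l + 1) → Fin n, StrictMono x ∧
    ∀ i j : Fin l, walkColours c x i = walkColours c x j

/-- The edge colouring `c` of the complete graph on `Fin n` contains a monotone
`k`-rainbow: vertices `y 0 < y 1 < ⋯ < y k` whose consecutive edges get pairwise
distinct colours. -/
def HasMonoRainbow {n : ℕ} {α : Type} (k : ℕ) (c : Fin n → Fin n → α) : Prop :=
  ∃ y : Fin (k + 1) → Fin n, StrictMono y ∧ Function.Injective (walkColours c y)

/-- The set of `m` such that for every `n > m`, every colouring of the edges of the
complete graph on `n` vertices (with an arbitrary set of colours) contains a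
monotone `l`-flash or a monotone `k`-rainbow. -/
def fSet (l k : ℕ) : Set ℕ :=
  {m | ∀ n : ℕ, n > m → ∀ (α : Type) (c : Fin n → Fin n → α),
    HasMonoFlash l c ∨ HasMonoRainbow k c}

/-- `f l k` is the smallest integer such that for every `n > f l k`, every colouring
of the edges of the complete graph on `n` vertices contains a monotone `l`-flash or
a monotone `k`-rainbow. -/
noncomputable def f (l k : ℕ) : ℕ := sInf (fSet l k)
/-- The set of colours on edges directed out of `v`. -/
def outColours {n : ℕ} {α : Type} (r : Fin n → Fin n → Prop) (c : Fin n → Fin n → α)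
    (v : Fin n) : Set α :=
  {a | ∃ u, r v u ∧ c v u = a}

/-- A vertex `v` is `rb`-in-robust if for every colour `a` there is an `rb`-rainbow
avoiding colour `a` that ends at `v`. -/
def IsInRobust {n : ℕ} {α : Type} (rb : ℕ) (r : Fin n → Fin n → Prop)
    (c : Fin n → Fin n → α) (v : Fin n) : Prop :=
  ∀ a : α, ∃ y : Fin (rb + 1) → Fin n, IsWalk r y ∧
    Function.Injective (walkColours c y) ∧ (∀ i, walkColours c y i ≠ a) ∧
    y (Fin.last rb) = v

/-- The set of `m` such that every tournament with more than `m` vertices, coloured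
with at most `k - 1` outgoing colours at each vertex, contains an `l`-flash, a
`k`-rainbow, or an `rb`-in-robust vertex. -/
def gSet (l k rb : ℕ) : Set ℕ :=
  {m | ∀ n : ℕ, n > m → ∀ r : Fin n → Fin n → Prop, IsTournament r →
    ∀ (α : Type) (c : Fin n → Fin n → α),
      (∀ v, (outColours r c v).ncard ≤ k - 1) →
      HasFlash l r c ∨ HasRainbow k r c ∨ ∃ v, IsInRobust rb r c v}

/-- `g l k rb` is the smallest integer such that every tournament with more than
`g l k rb` vertices, coloured with at most `k - 1` outgoing colours at each vertex,
contains an `l`-flash, a `k`-rainbow, or an `rb`-in-robust vertex. -/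
noncomputable def g (l k rb : ℕ) : ℕ := sInf (gSet l k rb)
/-- A vertex `v` is strongly `(k-2)`-robust if there is a set `C` of `k - 1` colours
containing every colour incident to `v` such that for every `a ∈ C` there is a
`(k-2)`-rainbow with colour set exactly `C \ {a}` ending at `v`, and also one
starting at `v`. -/
def IsStronglyRobust {n : ℕ} {α : Type} (k : ℕ) (r : Fin n → Fin n → Prop)
    (c : Fin n → Fin n → α) (v : Fin n) : Prop :=
  ∃ C : Finset α, C.card = k - 1 ∧
    (∀ u : Fin n, (r u v → c u v ∈ C) ∧ (r v u → c v u ∈ C)) ∧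
    ∀ a ∈ C,
      (∃ y : Fin (k - 2 + 1) → Fin n, IsWalk r y ∧
        Function.Injective (walkColours c y) ∧
        Set.range (walkColours c y) = ↑C \ {a} ∧ y (Fin.last (k - 2)) = v) ∧
      (∃ y : Fin (k - 2 + 1) → Fin n, IsWalk r y ∧
        Function.Injective (walkColours c y) ∧
        Set.range (walkColours c y) = ↑C \ {a} ∧ y 0 = v)


open Finset in
theorem aux_tsub {n : ℕ} {α : Type} {r : Fin n → Fin n → Prop} (hT : IsTournament r)
    (c : Fin n → Fin n → α) {l k m : ℕ} (hm : m ∈ tSet l k) (S : Finset (Fin n))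
    (hS : m < S.card) :
    HasFlash l r c ∨ ∃ y : Fin (k + 1) → Fin n, (∀ i, y i ∈ S) ∧ IsWalk r y ∧
      Function.Injective (walkColours c y) := by
  set e := S.orderEmbOfFin rfl with he
  have hT' : IsTournament (fun i j => r (e i) (e j)) :=
    ⟨fun v => hT.1 _, fun u v huv => hT.2 _ _ (fun h => huv (e.injective h))⟩
  rcases hm S.card hS _ hT' α (fun i j => c (e i) (e j)) with ⟨x, hx, hc⟩ | ⟨y, hy, hc⟩
  · exact Or.inl ⟨fun i => e (x i), hx, hc⟩
  · exact Or.inr ⟨fun i => e (y i), fun i => S.orderEmbOfFin_mem rfl _, hy, hc⟩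

open Finset in
theorem aux_gsub {n : ℕ} {α : Type} {r : Fin n → Fin n → Prop} (hT : IsTournament r)
    (c : Fin n → Fin n → α) {l k rb m : ℕ} (hm : m ∈ gSet l k rb)
    (ho : ∀ v, (outColours r c v).ncard ≤ k - 1) (S : Finset (Fin n))
    (hS : m < S.card) :
    HasFlash l r c ∨ HasRainbow k r c ∨ ∃ v ∈ S, IsInRobust rb r c v := by
  set e := S.orderEmbOfFin rfl with he
  have hT' : IsTournament (fun i j => r (e i) (e j)) :=
    ⟨fun v => hT.1 _, fun u v huv => hT.2 _ _ (fun h => huv (e.injective h))⟩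
  have ho' : ∀ v, (outColours (fun i j => r (e i) (e j)) (fun i j => c (e i) (e j)) v).ncard
      ≤ k - 1 := by
    intro v
    refine le_trans (Set.ncard_le_ncard ?_ ?_) (ho (e v))
    · rintro a ⟨u, hu, rfl⟩
      exact ⟨e u, hu, rfl⟩
    · refine (Set.finite_range (fun u => c (e v) u)).subset ?_
      rintro a ⟨u, hu, rfl⟩
      exact ⟨u, rfl⟩
  rcases hm S.card hS _ hT' α (fun i j => c (e i) (e j)) ho' with
    ⟨x, hx, hc⟩ | ⟨y, hy, hc⟩ | ⟨v, hv⟩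
  · exact Or.inl ⟨fun i => e (x i), hx, hc⟩
  · exact Or.inr (Or.inl ⟨fun i => e (y i), hy, hc⟩)
  · refine Or.inr (Or.inr ⟨e v, S.orderEmbOfFin_mem rfl _, fun a => ?_⟩)
    obtain ⟨y, h1, h2, h3, h4⟩ := hv a
    exact ⟨fun i => e (y i), h1, h2, h3, by simp [h4]⟩

theorem aux_snoc {n m : ℕ} {α : Type} {r : Fin n → Fin n → Prop}
    (c : Fin n → Fin n → α) {y : Fin (m + 1) → Fin n} (hy : IsWalk r y)
    (hc : Function.Injective (walkColours c y)) {v : Fin n} (hv : r (y (Fin.last m)) v)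
    (hn : ∀ i, walkColours c y i ≠ c (y (Fin.last m)) v) :
    ∃ z : Fin (m + 1 + 1) → Fin n, IsWalk r z ∧ Function.Injective (walkColours c z) ∧
      z (Fin.last (m + 1)) = v ∧
      ∀ i, (∃ j, walkColours c z i = walkColours c y j) ∨
        walkColours c z i = c (y (Fin.last m)) v := by
  have h1 : ∀ i : Fin m, walkColours c (Fin.snoc (α := fun _ => Fin n) y v) i.castSucc =
      walkColours c y i := by
    intro i
    simp only [walkColours, Fin.succ_castSucc, Fin.snoc_castSucc]
  have h2 : walkColours c (Fin.snoc (α := fun _ => Fin n) y v) (Fin.last m) =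
      c (y (Fin.last m)) v := by
    simp only [walkColours, Fin.succ_last, Fin.snoc_castSucc, Fin.snoc_last]
  refine ⟨Fin.snoc (α := fun _ => Fin n) y v, ?_, ?_, by simp, ?_⟩
  · intro i
    induction i using Fin.lastCases with
    | last => simpa only [Fin.succ_last, Fin.snoc_castSucc, Fin.snoc_last] using hv
    | cast i => simpa only [Fin.succ_castSucc, Fin.snoc_castSucc] using hy i
  · intro i j
    induction i using Fin.lastCases with
    | last =>
      induction j using Fin.lastCases with
      | last => simp
      | cast j => rw [h1, h2]; intro h; exact absurd h.symm (hn j)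
    | cast i =>
      induction j using Fin.lastCases with
      | last => rw [h1, h2]; intro h; exact absurd h (hn i)
      | cast j => rw [h1, h1]; intro h; rw [hc h]
  · intro i
    induction i using Fin.lastCases with
    | last => exact Or.inr h2
    | cast i => exact Or.inl ⟨i, h1 i⟩

open Finset Classical in
theorem aux_outdeg {n : ℕ} {r : Fin n → Fin n → Prop} (hT : IsTournament r)
    (S : Finset (Fin n)) (hS : S.Nonempty) :
    ∃ u ∈ S, S.card ≤ 2 * (S.filter (fun v => r u v)).card + 1 := by
  by_contra! hcon
  have e1 : ∑ u ∈ S, (S.filter (fun v => r u v)).card =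
      ∑ v ∈ S, (S.filter (fun u => r u v)).card :=
    Finset.sum_card_bipartiteAbove_eq_sum_card_bipartiteBelow (s := S) (t := S) r
  have e2 : ∀ u ∈ S, (S.filter (fun v => r u v)).card + (S.filter (fun v => r v u)).card + 1
      = S.card := by
    intro u hu
    rw [← Finset.card_erase_add_one hu, ← Finset.card_union_of_disjoint]
    · congr 2
      ext v
      simp only [mem_union, mem_filter, mem_erase]
      constructor
      · rintro (⟨h, h'⟩ | ⟨h, h'⟩)
        · exact ⟨fun hh => hT.1 u (hh ▸ h'), h⟩
        · exact ⟨fun hh => hT.1 u (by rw [hh] at h'; exact h'), h⟩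
      · rintro ⟨h, h'⟩
        by_cases hr : r u v
        · exact Or.inl ⟨h', hr⟩
        · exact Or.inr ⟨h', (hT.2 v u h).2 hr⟩
    · rw [Finset.disjoint_filter]
      intro v _ h h'
      by_cases huv : u = v
      · subst huv; exact hT.1 _ h
      · exact (hT.2 u v huv).1 h h'
  have e3 := Finset.sum_congr rfl e2
  have e4 : ∑ u ∈ S, (2 * (S.filter (fun v => r u v)).card + 1) < ∑ u ∈ S, S.card :=
    Finset.sum_lt_sum_of_nonempty hS hcon
  rw [← e3] at e4
  simp only [Finset.sum_add_distrib, ← Finset.mul_sum] at e4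
  omega

open Finset Classical in
theorem aux_indep {V : Type} (E : V → V → Prop) (p : ℕ) (j : ℕ) :
    ∀ W : Finset V, j * p < W.card →
    (∃ A ⊆ W, p < A.card ∧ ∀ u ∈ A, ∀ v ∈ A, ¬ E u v) ∨
    ∃ x : Fin (j + 1) → V, (∀ i, x i ∈ W) ∧ ∀ i : Fin j, E (x i.castSucc) (x i.succ) := by
  induction j with
  | zero =>
    intro W hW
    obtain ⟨w, hw⟩ := Finset.card_pos.1 (by omega : 0 < W.card)
    exact Or.inr ⟨fun _ => w, fun _ => hw, fun i => i.elim0⟩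
  | succ j ih =>
    intro W hW
    by_cases hA : p < (W.filter (fun u => ∀ v ∈ W, ¬ E u v)).card
    · refine Or.inl ⟨_, filter_subset _ _, hA, fun u hu v hv => ?_⟩
      exact (mem_filter.1 hu).2 v (mem_filter.1 hv).1
    have hs := Finset.card_filter_add_card_filter_not (s := W) (fun u => ∀ v ∈ W, ¬ E u v)
    have h2 : j * p < (W.filter (fun u => ¬ ∀ v ∈ W, ¬ E u v)).card := by
      have : (j + 1) * p = j * p + p := by ring
      omega
    rcases ih _ h2 with ⟨A, hAW, h3, h4⟩ | ⟨x, hx, hE⟩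
    · exact Or.inl ⟨A, hAW.trans (filter_subset _ _), h3, h4⟩
    · have h5 := (mem_filter.1 (hx (Fin.last j))).2
      push Not at h5
      obtain ⟨v, hv, hEv⟩ := h5
      refine Or.inr ⟨Fin.snoc (α := fun _ => V) x v, ?_, ?_⟩
      · intro i
        induction i using Fin.lastCases with
        | last => simpa using hv
        | cast i => simpa using (mem_filter.1 (hx i)).1
      · intro i
        induction i using Fin.lastCases with
        | last => simpa only [Fin.succ_last, Fin.snoc_castSucc, Fin.snoc_last] using hEv
        | cast i => simpa only [Fin.succ_castSucc, Fin.snoc_castSucc] using hE i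

/-- Bound for the Ramsey-type lemma. -/
def auxN (k : ℕ) : ℕ → ℕ
  | 0 => 0
  | m + 1 => 2 * (k * auxN k m) + 1

open Finset Classical in
theorem aux_seq {n : ℕ} {α : Type} {r : Fin n → Fin n → Prop} (hT : IsTournament r)
    (c : Fin n → Fin n → α) (k m : ℕ) :
    ∀ S : Finset (Fin n), (∀ v ∈ S, (outColours r c v).ncard ≤ k) → auxN k m < S.card →
    ∃ (x : ℕ → Fin n) (d : ℕ → α), (∀ i ≤ m, x i ∈ S) ∧
      ∀ i j, i < j → j ≤ m → r (x i) (x j) ∧ c (x i) (x j) = d i := by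
  induction m with
  | zero =>
    intro S _ hS
    obtain ⟨w, hw⟩ := Finset.card_pos.1 (by omega : 0 < S.card)
    exact ⟨fun _ => w, fun _ => c w w, fun _ _ => hw, fun i j h h' => by omega⟩
  | succ m ih =>
    intro S ho hS
    obtain ⟨u, hu, hd⟩ := aux_outdeg hT S (Finset.card_pos.1 (by omega))
    have hfin : (outColours r c u).Finite := by
      refine (Set.finite_range (fun v => c u v)).subset ?_
      rintro a ⟨v, hv, rfl⟩
      exact ⟨v, rfl⟩
    have hcard : hfin.toFinset.card ≤ k := by
      rw [← Set.ncard_eq_toFinset_card _ hfin]; exact ho u hu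
    have hlt : hfin.toFinset.card * auxN k m < (S.filter (fun v => r u v)).card := by
      have := Nat.mul_le_mul_right (auxN k m) hcard
      simp only [auxN] at hS
      omega
    obtain ⟨b, hb, hbc⟩ := Finset.exists_lt_card_fiber_of_mul_lt_card_of_maps_to
      (f := fun v => c u v) (fun v hv => by
        simp only [Set.Finite.mem_toFinset]
        exact ⟨v, (mem_filter.1 hv).2, rfl⟩) hlt
    obtain ⟨x, d, hx, hxd⟩ := ih _ (fun v hv => ho v
      (mem_filter.1 (mem_filter.1 hv).1).1) hbc
    refine ⟨fun i => Nat.casesOn i u x, fun i => Nat.casesOn i b d, ?_, ?_⟩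
    · rintro (_ | i) hi
      · exact hu
      · exact (mem_filter.1 (mem_filter.1 (hx i (by omega))).1).1
    · rintro (_ | i) (_ | j) hij hj
      · omega
      · have := hx j (by omega)
        exact ⟨(mem_filter.1 (mem_filter.1 this).1).2, (mem_filter.1 this).2⟩
      · omega
      · exact hxd i j (by omega) (by omega)

open Finset Classical in
theorem aux_idx {n : ℕ} {α : Type} {r : Fin n → Fin n → Prop}
    (c : Fin n → Fin n → α) {m p : ℕ} {x : ℕ → Fin n} {d : ℕ → α}
    (h : ∀ i j, i < j → j ≤ m → r (x i) (x j) ∧ c (x i) (x j) = d i)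
    (I : Finset ℕ) (hI : I ⊆ range m) (hp : I.card = p) :
    ∃ (y : Fin (p + 1) → Fin n) (e : Fin p → ℕ), IsWalk r y ∧ Function.Injective e ∧
      ∀ i, e i ∈ I ∧ walkColours c y i = d (e i) := by
  have hmI : m ∉ I := fun hh => by simpa using hI hh
  have hc : (insert m I).card = p + 1 := by rw [card_insert_of_notMem hmI, hp]
  set e := (insert m I).orderEmbOfFin hc with he
  have hle : ∀ i, e i ≤ m := by
    intro i
    have := (insert m I).orderEmbOfFin_mem hc i
    rcases mem_insert.1 this with h' | h'
    · exact h'.le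
    · exact (mem_range.1 (hI h')).le
  have hlt : ∀ i : Fin p, e i.castSucc < e i.succ := fun i =>
    e.strictMono (Fin.castSucc_lt_succ)
  refine ⟨fun i => x (e i), fun i => e i.castSucc, ?_, ?_, ?_⟩
  · intro i; exact (h _ _ (hlt i) (hle _)).1
  · intro i j hij
    exact Fin.castSucc_injective _ (e.injective hij)
  · intro i
    refine ⟨?_, (h _ _ (hlt i) (hle _)).2⟩
    have := (insert m I).orderEmbOfFin_mem hc i.castSucc
    rcases mem_insert.1 this with h' | h'
    · have h1 := hlt i
      have h2 := hle i.succ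
      rw [← he] at h'
      omega
    · exact h'

open Finset Classical in
theorem aux_ramsey {n : ℕ} {α : Type} {r : Fin n → Fin n → Prop} (hT : IsTournament r)
    (c : Fin n → Fin n → α) (l K k : ℕ) (S : Finset (Fin n))
    (ho : ∀ v ∈ S, (outColours r c v).ncard ≤ k) (hS : auxN k (K * l + 1) < S.card) :
    HasFlash l r c ∨ HasRainbow K r c := by
  obtain ⟨x, d, -, hxd⟩ := aux_seq hT c k (K * l + 1) S ho hS
  by_cases hK : K ≤ ((range (K * l + 1)).image d).card
  · right
    obtain ⟨D, hD, hDc⟩ := Finset.exists_subset_card_eq hK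
    obtain ⟨I', hI', hinj2, hinj1⟩ := Finset.exists_subset_injOn_image_eq_of_surjOn
      (f := d) (range (K * l + 1) : Set ℕ) D (by
        intro b hb
        simpa using hD hb)
    have hinj : I'.image d = D ∧ Set.InjOn d I' := ⟨hinj1, hinj2⟩
    replace hI' : I' ⊆ range (K * l + 1) := by exact_mod_cast hI'
    obtain ⟨y, e, hy, he, hye⟩ := aux_idx c hxd I' hI' (p := K)
      (by rw [← hDc, ← hinj.1, Finset.card_image_of_injOn hinj.2])
    refine ⟨y, hy, fun i j hij => ?_⟩
    rw [(hye i).2, (hye j).2] at hij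
    exact he (hinj.2 (hye i).1 (hye j).1 hij)
  · left
    have hlt : ((range (K * l + 1)).image d).card * l < (range (K * l + 1)).card := by
      have := Nat.mul_le_mul_right l (not_le.1 hK).le
      rw [card_range]; omega
    obtain ⟨b, hb, hbc⟩ := Finset.exists_lt_card_fiber_of_mul_lt_card_of_maps_to
      (f := d) (fun v hv => mem_image_of_mem d hv) hlt
    obtain ⟨I, hI, hIc⟩ := Finset.exists_subset_card_eq hbc.le
    obtain ⟨y, e, hy, he, hye⟩ := aux_idx c hxd I (hI.trans (filter_subset _ _)) hIc
    refine ⟨y, hy, fun i j => ?_⟩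
    rw [(hye i).2, (hye j).2, (mem_filter.1 (hI (hye i).1)).2, (mem_filter.1 (hI (hye j).1)).2]

open Finset Classical in
theorem aux_tne (l k : ℕ) : (tSet l k).Nonempty := by
  induction k with
  | zero =>
    refine ⟨0, fun n hn r hT α c => Or.inr ⟨fun _ => ⟨0, hn⟩, fun i => i.elim0, fun i => i.elim0⟩⟩
  | succ k ih =>
    obtain ⟨m, hm⟩ := ih
    refine ⟨m + auxN k ((k + 1) * l + 1), fun n hn r hT α c => ?_⟩
    by_contra! hcon
    obtain ⟨hf, hR⟩ := hcon
    let P : Fin n → Prop := fun v => ∃ y : Fin (k + 1) → Fin n, IsWalk r y ∧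
      Function.Injective (walkColours c y) ∧ y (Fin.last k) = v
    have h1 : ((univ : Finset (Fin n)).filter (fun v => ¬ P v)).card ≤ m := by
      by_contra! hlt
      rcases aux_tsub hT c hm _ hlt with h | ⟨y, hy, hw, hi⟩
      · exact hf h
      · exact (mem_filter.1 (hy (Fin.last k))).2 ⟨y, hw, hi, rfl⟩
    have h2 := Finset.card_filter_add_card_filter_not (s := (univ : Finset (Fin n))) P
    rw [card_univ, Fintype.card_fin] at h2
    have hout : ∀ v ∈ univ.filter P, (outColours r c v).ncard ≤ k := by
      intro v hv
      obtain ⟨y, hw, hi, rfl⟩ := (mem_filter.1 hv).2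
      have hsub : outColours r c (y (Fin.last k)) ⊆ Set.range (walkColours c y) := by
        rintro a ⟨u, hu, rfl⟩
        by_contra hna
        obtain ⟨z, hz1, hz2, -⟩ := aux_snoc c hw hi hu (fun i h => hna ⟨i, h⟩)
        exact hR ⟨z, hz1, hz2⟩
      refine (Set.ncard_le_ncard hsub (Set.finite_range _)).trans ?_
      rw [← Set.image_univ]
      refine (Set.ncard_image_le Set.finite_univ).trans ?_
      simp
    rcases aux_ramsey hT c l (k + 1) k (univ.filter P) hout (by omega) with h | h
    · exact hf h
    · exact hR h

open Finset Classical in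
theorem aux_step (l k s m p : ℕ) (hm : m ∈ gSet l k s) (hp : p ∈ tSet l (s + 1)) :
    m + 1 + 2 * (k - 1) * (s + 1) * l * p ∈ gSet l k (s + 1) := by
  intro n hn r hT α c ho
  by_contra! hcon
  obtain ⟨hf, hR, hrob⟩ := hcon
  let P : Fin n → Prop := fun v => IsInRobust s r c v
  have h1 : ((univ : Finset (Fin n)).filter (fun v => ¬ P v)).card ≤ m := by
    by_contra! hlt
    rcases aux_gsub hT c hm ho _ hlt with h | h | ⟨v, hv, h⟩
    · exact hf h
    · exact hR h
    · exact (mem_filter.1 hv).2 h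
  have h2 := Finset.card_filter_add_card_filter_not (s := (univ : Finset (Fin n))) P
  rw [card_univ, Fintype.card_fin] at h2
  obtain ⟨u, hu, hd⟩ := aux_outdeg hT (univ.filter P) (Finset.card_pos.1 (by omega))
  set O := (univ.filter P).filter (fun v => r u v) with hO
  have hOc : (k - 1) * (s + 1) * (l * p) < O.card := by
    have : 2 * (k - 1) * (s + 1) * l * p = 2 * ((k - 1) * (s + 1) * (l * p)) := by ring
    omega
  have hbad : ∀ v, ∃ a : α, ∀ y : Fin (s + 1 + 1) → Fin n, IsWalk r y →
      Function.Injective (walkColours c y) → (∀ i, walkColours c y i ≠ a) →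
      y (Fin.last (s + 1)) ≠ v := by
    intro v
    have := hrob v
    simp only [IsInRobust] at this
    push Not at this
    exact this
  choose a ha using hbad
  have hub : IsInRobust s r c u := (mem_filter.1 hu).2
  choose R hR1 hR2 hR3 hR4 using hub
  have hfin : (outColours r c u).Finite := by
    refine (Set.finite_range (fun v => c u v)).subset ?_
    rintro b ⟨v, hv, rfl⟩
    exact ⟨v, rfl⟩
  have hcard : hfin.toFinset.card ≤ k - 1 := by
    rw [← Set.ncard_eq_toFinset_card _ hfin]; exact ho u
  let opt : Finset α := hfin.toFinset.biUnion
    (fun b => insert b (univ.image (walkColours c (R b))))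
  have hopt : opt.card ≤ (k - 1) * (s + 1) := by
    refine (Finset.card_biUnion_le_card_mul _ _ (s + 1) ?_).trans
      (Nat.mul_le_mul_right _ hcard)
    intro b _
    refine (card_insert_le _ _).trans ?_
    have := card_image_le (s := (univ : Finset (Fin s))) (f := walkColours c (R b))
    simp only [card_univ, Fintype.card_fin] at this
    omega
  have hmaps : ∀ v ∈ O, a v ∈ opt := by
    intro v hv
    have hruv : r u v := (mem_filter.1 hv).2
    refine mem_biUnion.2 ⟨c u v, ?_, ?_⟩
    · simp only [Set.Finite.mem_toFinset]; exact ⟨v, hruv, rfl⟩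
    · by_contra hna
      simp only [mem_insert, mem_image, mem_univ, true_and, not_or, not_exists] at hna
      have hlast := hR4 (c u v)
      obtain ⟨z, hz1, hz2, hz3, hz4⟩ := aux_snoc c (hR1 (c u v)) (hR2 (c u v))
        (v := v) (by rw [hlast]; exact hruv) (by rw [hlast]; exact hR3 (c u v))
      refine ha v z hz1 hz2 (fun i hi => ?_) hz3
      rcases hz4 i with ⟨j, hj⟩ | hj
      · exact hna.2 j (hj.symm.trans hi)
      · rw [hlast] at hj
        exact hna.1 (hi.symm.trans hj)
  obtain ⟨b, hb, hbc⟩ := Finset.exists_lt_card_fiber_of_mul_lt_card_of_maps_to hmaps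
    (lt_of_le_of_lt (Nat.mul_le_mul_right (l * p) hopt) hOc)
  rcases aux_indep (fun v w => r v w ∧ c v w = b) p l _ hbc with
    ⟨A, hAW, hAc, hA⟩ | ⟨x, hx, hE⟩
  · rcases aux_tsub hT c hp A hAc with h | ⟨y, hy, hw, hi⟩
    · exact hf h
    · have hmem := (mem_filter.1 (hAW (hy (Fin.last (s + 1))))).2
      refine ha (y (Fin.last (s + 1))) y hw hi (fun i hib => ?_) rfl
      rw [hmem] at hib
      exact hA _ (hy i.castSucc) _ (hy i.succ) ⟨hw i, hib⟩
  · exact hf ⟨x, fun i => (hE i).1, fun i j => (hE i).2.trans (hE j).2.symm⟩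

theorem aux_gne (l k s : ℕ) : (gSet l k s).Nonempty := by
  obtain ⟨m, hm⟩ := aux_tne l k
  refine ⟨m, fun n hn r hT α c _ => ?_⟩
  rcases hm n hn r hT α c with h | h
  · exact Or.inl h
  · exact Or.inr (Or.inl h)

/-- For all positive integers l and k and every r ≥ 1,
g(l,k,r) ≤ g(l,k,r-1) + 1 + 2(k-1) · r · l · t(l,r). -/
theorem g_recursive_upper_bound (l k rb : ℕ) (hl : 0 < l) (hk : 0 < k)
    (hr : 1 ≤ rb) :
    g l k rb ≤ g l k (rb - 1) + 1 + 2 * (k - 1) * rb * l * t l rb := by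
  obtain ⟨s, rfl⟩ : ∃ s, rb = s + 1 := ⟨rb - 1, by omega⟩
  rw [Nat.add_sub_cancel]
  exact Nat.sInf_le (aux_step l k s _ _ (Nat.sInf_mem (aux_gne l k s))
    (Nat.sInf_mem (aux_tne l (s + 1))))
end

section
/- For every ε > 0 there exists a constant D_ε > 0 such that for all positive integers l and k and every integer r with 0 ≤ r < k, g(l,k,r) ≤ 4 · D_ε · k^3 · (log k)^{1+ε} · l^r. -/
namespace FR
open Classical

/-- `Wk H n v`: there is an `H`-walk of length `n` ending at `v`. -/
inductive Wk {V : Type} (H : V → V → Prop) : ℕ → V → Prop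
  | zero (v : V) : Wk H 0 v
  | succ {n : ℕ} {u v : V} : Wk H n u → H u v → Wk H (n + 1) v

lemma level {V : Type} (H : V → V → Prop) (m : ℕ) (hm : ∀ v, ¬ Wk H m v) :
    ∃ φ : V → ℕ, (∀ v, φ v < m) ∧ ∀ u v, H u v → φ u < φ v := by
  have h1 : ∀ v, Wk H (Nat.findGreatest (fun n => Wk H n v) m) v := fun v =>
    Nat.findGreatest_spec (P := fun n => Wk H n v) (Nat.zero_le m) (Wk.zero v)
  have h2 : ∀ v, Nat.findGreatest (fun n => Wk H n v) m < m := by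
    intro v
    refine lt_of_le_of_ne (Nat.findGreatest_le m) ?_
    intro h
    have := h1 v
    rw [h] at this
    exact hm v this
  refine ⟨fun v => Nat.findGreatest (fun n => Wk H n v) m, h2, ?_⟩
  intro u v huv
  have h3 := Wk.succ (h1 u) huv
  exact Nat.le_findGreatest (P := fun n => Wk H n v) (h2 u) h3

/-- rainbow walk inside `S`, with list of colours `L` (last colour first), ending at `v`. -/
inductive RW {V α : Type} (r : V → V → Prop) (c : V → V → α) (S : Finset V) : List α → V → Prop
  | nil {v : V} : v ∈ S → RW r c S [] v
  | snoc {L : List α} {u v : V} : RW r c S L u → r u v → v ∈ S → c u v ∉ L →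
      RW r c S (c u v :: L) v

section
variable {V α : Type} {r : V → V → Prop} {c : V → V → α}

lemma RW.mem {S : Finset V} {L : List α} {v : V} (h : RW r c S L v) : v ∈ S := by
  cases h <;> assumption

lemma RW.nodup {S : Finset V} {L : List α} {v : V} (h : RW r c S L v) : L.Nodup := by
  induction h with
  | nil h => exact List.nodup_nil
  | snoc h hr hv hc ih => exact List.nodup_cons.2 ⟨hc, ih⟩

lemma RW.mono {S S' : Finset V} (hS : S ⊆ S') {L : List α} {v : V} (h : RW r c S L v) :
    RW r c S' L v := by
  induction h with
  | nil h => exact RW.nil (hS h)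
  | snoc h hr hv hc ih => exact RW.snoc ih hr (hS hv) hc

/-- colours of a rainbow inside `S` satisfy every property shared by edges in `S`. -/
lemma RW.colours {S : Finset V} {L : List α} {v : V} (h : RW r c S L v) (P : α → Prop)
    (hP : ∀ u ∈ S, ∀ v ∈ S, r u v → P (c u v)) : ∀ a ∈ L, P a := by
  induction h with
  | nil h => simp
  | snoc h hr hv hc ih =>
    intro a ha
    rcases List.mem_cons.1 ha with rfl | ha
    · exact hP _ h.mem _ hv hr
    · exact ih a ha

lemma RW.append {S S' : Finset V} (hS : S' ⊆ S) {L0 : List α}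
    (h0 : ∀ w ∈ S', RW r c S L0 w) {L : List α} {v : V} (h : RW r c S' L v)
    (hd : ∀ a ∈ L, a ∉ L0) : RW r c S (L ++ L0) v := by
  induction h with
  | nil h => exact h0 _ h
  | snoc h hr hv hc ih =>
    have := ih (fun a ha => hd a (List.mem_cons_of_mem _ ha))
    refine RW.snoc this hr (hS hv) ?_
    intro hm
    rcases List.mem_append.1 hm with h1 | h1
    · exact hc h1
    · exact hd _ (List.mem_cons_self) h1

lemma exists_fiber {ι : Type} (W : Finset ι) (φ : ι → ℕ) (m : ℕ) (hm : ∀ w ∈ W, φ w < m) :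
    ∃ W' ⊆ W, W.card ≤ m * W'.card ∧ ∀ w ∈ W', ∀ w' ∈ W', φ w = φ w' := by
  rcases W.eq_empty_or_nonempty with rfl | ⟨w0, hw0⟩
  · exact ⟨∅, by simp⟩
  have hne : (Finset.range m).Nonempty := ⟨φ w0, Finset.mem_range.2 (hm _ hw0)⟩
  obtain ⟨y, hy, hmax⟩ := Finset.exists_max_image (Finset.range m)
    (fun y => (W.filter (fun w => φ w = y)).card) hne
  refine ⟨W.filter (fun w => φ w = y), Finset.filter_subset _ _, ?_, ?_⟩
  · have := Finset.card_le_mul_card_image_of_maps_to (s := W) (t := Finset.range m) (f := φ)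
      (fun w hw => Finset.mem_range.2 (hm w hw))
      ((W.filter (fun w => φ w = y)).card) hmax
    simpa [mul_comm] using this
  · intro w hw w' hw'
    rw [(Finset.mem_filter.1 hw).2, (Finset.mem_filter.1 hw').2]

lemma exists_fiber_list {ι : Type} (φ : α → ι → ℕ) (m : ℕ) (hm : ∀ a w, φ a w < m) (L : List α)
    (W : Finset ι) :
    ∃ W' ⊆ W, W.card ≤ m ^ L.length * W'.card ∧
      ∀ a ∈ L, ∀ w ∈ W', ∀ w' ∈ W', φ a w = φ a w' := by
  induction L with
  | nil => exact ⟨W, subset_rfl, by simp, by simp⟩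
  | cons b L ih =>
    obtain ⟨W1, h1, h2, h3⟩ := ih
    obtain ⟨W2, h4, h5, h6⟩ := exists_fiber W1 (φ b) m (fun w _ => hm b w)
    refine ⟨W2, h4.trans h1, ?_, ?_⟩
    · calc W.card ≤ m ^ L.length * W1.card := h2
        _ ≤ m ^ L.length * (m * W2.card) := Nat.mul_le_mul_left _ h5
        _ = _ := by rw [List.length_cons]; ring
    · intro a ha w hw w' hw'
      rcases List.mem_cons.1 ha with rfl | ha
      · exact h6 w hw w' hw'
      · exact h3 a ha w (h4 hw) w' (h4 hw')

/-- some vertex has out-degree at least half. -/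
lemma exists_outdeg (h0 : ∀ v, ¬ r v v) (hT : ∀ u v : V, u ≠ v → (r u v ↔ ¬ r v u))
    (X : Finset V) (hX : X.Nonempty) :
    ∃ u ∈ X, X.card ≤ 2 * (X.filter (fun v => r u v)).card + 1 := by
  by_contra hcon
  push Not at hcon
  have hsum : ∑ u ∈ X, (X.filter (fun v => r u v)).card
      = ∑ u ∈ X, (X.filter (fun v => r v u)).card := by
    exact Finset.sum_card_bipartiteAbove_eq_sum_card_bipartiteBelow (s := X) (t := X) r
  have hadd : ∀ u ∈ X, (X.filter (fun v => r u v)).card + (X.filter (fun v => r v u)).card + 1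
      = X.card := by
    intro u hu
    have h1 : (X.filter (fun v => r v u)) = (X.filter (fun v => ¬ r u v)).erase u := by
      ext v
      simp only [Finset.mem_filter, Finset.mem_erase]
      constructor
      · rintro ⟨hv, hr⟩
        have hne : v ≠ u := by rintro rfl; exact h0 _ hr
        exact ⟨hne, hv, (hT v u hne).1 hr⟩
      · rintro ⟨hne, hv, hr⟩
        exact ⟨hv, (hT v u hne).2 hr⟩
    have h2 : u ∈ X.filter (fun v => ¬ r u v) := by simp [hu, h0]
    rw [h1, add_assoc, Finset.card_erase_add_one h2]
    exact Finset.card_filter_add_card_filter_not _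
  have hlt : ∑ u ∈ X, (2 * (X.filter (fun v => r u v)).card + 1) < ∑ u ∈ X, X.card :=
    Finset.sum_lt_sum_of_nonempty hX hcon
  have heq : ∑ u ∈ X, X.card = ∑ u ∈ X, (2 * (X.filter (fun v => r u v)).card + 1) := by
    rw [← Finset.sum_congr rfl hadd]
    simp only [Finset.sum_add_distrib, ← Finset.mul_sum, ← hsum]
    ring
  omega

end

end FR
namespace FR
open Classical
lemma exists_select_fin {ι α : Type} [Fintype α] (S : Finset ι) (b : ι → α) (O : ι → Finset α) (s : ℕ)
    (hs : 0 < s) (hO : ∀ z ∈ S, (O z).card ≤ s) :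
    ∃ S' ⊆ S, S.card ≤ 4 * s * S'.card ∧ ∀ z ∈ S', ∀ z' ∈ S', b z' ∈ O z → b z' = b z := by
  obtain ⟨m, hm⟩ : ∃ m, m + 1 = 2 * s := ⟨2 * s - 1, by omega⟩
  let T : ι → α → Finset (Fin (m+1)) := fun z a =>
    if a = b z then {0} else if a ∈ O z then Finset.univ.erase 0 else Finset.univ
  let G : ι → Finset (α → Fin (m+1)) := fun z => Fintype.piFinset (T z)
  have hmpos : (0:ℝ) < (m:ℝ) + 1 := by positivity
  have hmr : (m:ℝ) + 1 = 2 * s := by exact_mod_cast hm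
  have hG : ∀ z ∈ S, (m+1)^(Fintype.card α) ≤ 4 * s * (G z).card := by
    intro z hz
    have h1 : ((G z).card : ℝ) = ∏ a, (((m:ℝ)+1) * ((if a = b z then 1/((m:ℝ)+1) else 1) *
        (if a ∈ (O z).erase (b z) then (1 - 1/((m:ℝ)+1)) else 1))) := by
      simp only [G, Fintype.card_piFinset]
      push_cast
      refine Finset.prod_congr rfl fun a _ => ?_
      simp only [T]
      by_cases h : a = b z
      · rw [if_pos h, if_pos h, if_neg (by rw [h]; simp)]; simp; field_simp
      · by_cases h' : a ∈ O z
        · simp [h, h']; field_simp; ring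
        · simp [h, h']
    have h2 : ((G z).card : ℝ) = ((m:ℝ)+1)^(Fintype.card α) * (1/((m:ℝ)+1) *
        (1 - 1/((m:ℝ)+1))^((O z).erase (b z)).card) := by
      rw [h1, Finset.prod_mul_distrib, Finset.prod_mul_distrib, Finset.prod_ite_eq',
        Finset.prod_ite_mem]
      simp
    have h3 : ((O z).erase (b z)).card ≤ s := (Finset.card_erase_le).trans (hO z hz)
    have hle1 : 1/((m:ℝ)+1) ≤ 1 := by
      rw [div_le_one hmpos]; linarith [(Nat.cast_nonneg m : (0:ℝ) ≤ m)]
    have h4 : (1/2:ℝ) ≤ (1 - 1/((m:ℝ)+1))^((O z).erase (b z)).card := by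
      have hb := one_add_mul_le_pow (a := -(1/((m:ℝ)+1))) (by linarith) ((O z).erase (b z)).card
      have h5 : ((((O z).erase (b z)).card : ℕ) : ℝ) ≤ s := by exact_mod_cast h3
      have h6 : ((((O z).erase (b z)).card : ℕ) : ℝ) * (1/((m:ℝ)+1)) ≤ 1/2 := by
        rw [mul_one_div, div_le_iff₀ hmpos]; linarith
      rw [sub_eq_add_neg]
      linarith
    have h7 : ((m:ℝ)+1)^(Fintype.card α) ≤ 4 * s * (G z).card := by
      rw [h2]
      have : 4 * (s:ℝ) * (((m:ℝ)+1)^(Fintype.card α) * (1/((m:ℝ)+1) *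
        (1 - 1/((m:ℝ)+1))^((O z).erase (b z)).card)) = ((m:ℝ)+1)^(Fintype.card α) *
         (2 * (1 - 1/((m:ℝ)+1))^((O z).erase (b z)).card) := by
        have : (s:ℝ) = (m+1)/2 := by linarith
        rw [this]
        generalize (1 - 1/((m:ℝ)+1))^((O z).erase (b z)).card = x
        generalize ((m:ℝ)+1)^(Fintype.card α) = y
        field_simp; ring
      rw [this]
      exact le_mul_of_one_le_right (by positivity) (by linarith)
    exact_mod_cast h7
  have hdc : ∑ z ∈ S, (G z).card = ∑ χ : α → Fin (m+1), (S.filter (fun z => χ ∈ G z)).card := by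
    have := Finset.sum_card_bipartiteAbove_eq_sum_card_bipartiteBelow (s := S)
      (t := (Finset.univ : Finset (α → Fin (m+1)))) (fun z χ => χ ∈ G z)
    simp only [Finset.bipartiteAbove, Finset.bipartiteBelow] at this
    rw [← this]
    refine Finset.sum_congr rfl fun z _ => ?_
    congr 1; ext; simp
  have : ∃ χ : α → Fin (m+1), S.card ≤ 4 * s * (S.filter (fun z => χ ∈ G z)).card := by
    by_contra hcon
    push Not at hcon
    have h1 : ∑ χ : α → Fin (m+1), 4 * s * (S.filter (fun z => χ ∈ G z)).card <
        ∑ χ : α → Fin (m+1), S.card :=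
      Finset.sum_lt_sum_of_nonempty ⟨fun _ => 0, Finset.mem_univ _⟩ (fun χ _ => hcon χ)
    rw [← Finset.mul_sum, ← hdc, Finset.mul_sum] at h1
    have h2 := Finset.sum_le_sum hG
    simp at h1 h2
    rw [mul_comm] at h2
    omega
  obtain ⟨χ, hχ⟩ := this
  refine ⟨_, Finset.filter_subset _ _, hχ, ?_⟩
  intro z hz z' hz' hO
  by_contra hne
  have h1 := Fintype.mem_piFinset.1 (Finset.mem_filter.1 hz).2 (b z')
  have h2 := Fintype.mem_piFinset.1 (Finset.mem_filter.1 hz').2 (b z')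
  simp [T, hne, hO] at h1 h2
  exact h1 h2

/-- random selection of colours -/
lemma exists_select {ι α : Type} (S : Finset ι) (b : ι → α) (O : ι → Finset α) (s : ℕ)
    (hs : 0 < s) (hO : ∀ z ∈ S, (O z).card ≤ s) :
    ∃ S' ⊆ S, S.card ≤ 4 * s * S'.card ∧ ∀ z ∈ S', ∀ z' ∈ S', b z' ∈ O z → b z' = b z := by
  let p : α → Option {a // a ∈ S.image b} := fun a => if h : a ∈ S.image b then some ⟨a, h⟩ else none
  obtain ⟨S', h1, h2, h3⟩ := exists_select_fin S (fun z => p (b z)) (fun z => (O z).image p) s hs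
    (fun z hz => Finset.card_image_le.trans (hO z hz))
  refine ⟨S', h1, h2, fun z hz z' hz' h => ?_⟩
  have := h3 z hz z' hz' (Finset.mem_image_of_mem _ h)
  have e1 := Finset.mem_image_of_mem b (h1 hz)
  have e2 := Finset.mem_image_of_mem b (h1 hz')
  simp only [p, dif_pos e1, dif_pos e2, Option.some.injEq, Subtype.mk.injEq] at this
  exact this
end FR
namespace FR
open Classical

/-- exponent of the recursion -/
def hh (k : ℕ) : ℕ := min (k + 1) (5 + 3 * Nat.clog 2 (k + 2))

/-- the recursive constant -/
def AA : ℕ → ℕ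
  | 0 => 8
  | 1 => 8
  | (k + 2) => max (AA (k + 1)) (8 * (k + 2) * AA (hh k))
  decreasing_by
    · omega
    · have : hh k ≤ k + 1 := min_le_left _ _
      omega

lemma AA_succ (k : ℕ) : AA (k + 2) = max (AA (k + 1)) (8 * (k + 2) * AA (hh k)) := by
  rw [AA]

lemma AA_mono : Monotone AA := by
  refine monotone_nat_of_le_succ fun n => ?_
  cases n with
  | zero => simp [AA]
  | succ n => rw [AA_succ]; exact le_max_left _ _

lemma AA_ge (k : ℕ) : 8 ≤ AA k := by
  have := AA_mono (Nat.zero_le k)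
  simpa [AA] using this

lemma AA_rec (k : ℕ) : 8 * (k + 2) * AA (hh k) ≤ AA (k + 2) := by
  rw [AA_succ]; exact le_max_right _ _

lemma two_pow_hh (k : ℕ) : 32 * (k + 2) ^ 3 ≤ 2 ^ (5 + 3 * Nat.clog 2 (k + 2)) := by
  have h := Nat.le_pow_clog (b := 2) (by norm_num) (k + 2)
  have h2 := Nat.pow_le_pow_left h 3
  rw [pow_add, pow_mul, pow_right_comm]
  norm_num
  exact h2

section
variable {V α : Type} {r : V → V → Prop} {c : V → V → α}

lemma exists_class {ι : Type} (W : Finset ι) (q : ι → α) (T : Finset α) (m : ℕ)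
    (hT : ∀ w ∈ W, q w ∈ T) (hm : T.card ≤ m) (hW : W.Nonempty) :
    ∃ y, W.card ≤ m * (W.filter (fun w => q w = y)).card := by
  obtain ⟨w0, hw0⟩ := hW
  obtain ⟨y, hy, hmax⟩ := Finset.exists_max_image T
    (fun y => (W.filter (fun w => q w = y)).card) ⟨_, hT w0 hw0⟩
  refine ⟨y, ?_⟩
  have := Finset.card_le_mul_card_image_of_maps_to (s := W) (t := T) (f := q) hT
      ((W.filter (fun w => q w = y)).card) hmax
  calc W.card ≤ _ := this
    _ ≤ _ := by rw [mul_comm]; exact Nat.mul_le_mul_right _ hm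

lemma chain_level (lt : α → α → Prop) (hirr : ∀ a, ¬ lt a a)
    (htr : ∀ a b c, lt a b → lt b c → lt a c) {S Z : Finset V} (hZ : Z ⊆ S) (b : V → α) (k : ℕ)
    (hk : ∀ L v, RW r c S L v → L.length ≠ k + 1) :
    ∃ q : V → ℕ, (∀ v, q v < k + 1) ∧ ∀ u ∈ Z, ∀ v ∈ Z, r u v → c u v = b u → lt (b u) (b v) →
      q u < q v := by
  have key : ∀ n v, Wk (fun u v => u ∈ Z ∧ v ∈ Z ∧ r u v ∧ c u v = b u ∧ lt (b u) (b v)) n v →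
      v ∈ Z → ∃ L : List α, L.length = n ∧ RW r c S L v ∧ ∀ a ∈ L, lt a (b v) := by
    intro n v h
    induction h with
    | zero v => intro hv; exact ⟨[], rfl, RW.nil (hZ hv), by simp⟩
    | succ h1 h2 ih =>
      rename_i n u v
      intro hv
      obtain ⟨hu, -, hr, hc, hlt⟩ := h2
      obtain ⟨L, hL, hRW, hall⟩ := ih hu
      refine ⟨c u v :: L, by simp [hL], RW.snoc hRW hr (hZ hv) ?_, ?_⟩
      · intro hmem
        have := hall _ hmem
        rw [hc] at this
        exact hirr _ this
      · intro a ha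
        rcases List.mem_cons.1 ha with rfl | ha
        · rw [hc]; exact hlt
        · exact htr _ _ _ (hall a ha) hlt
  obtain ⟨q, h1, h2⟩ := level (fun u v => u ∈ Z ∧ v ∈ Z ∧ r u v ∧ c u v = b u ∧ lt (b u) (b v))
    (k + 1) (by
      intro v h
      have hv : v ∈ Z := by
        cases h with
        | succ h1 h2 => exact h2.2.1
      obtain ⟨L, hL, hRW, -⟩ := key _ _ h hv
      exact hk L v hRW hL)
  exact ⟨q, h1, fun u hu v hv hr hc hlt => h2 u v ⟨hu, hv, hr, hc, hlt⟩⟩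

lemma purify (φ : α → V → ℕ) (l : ℕ) (hφl : ∀ a v, φ a v < l)
    (hφ : ∀ u v, r u v → φ (c u v) u < φ (c u v) v) {S Z : Finset V} (hZ : Z ⊆ S) (b : V → α)
    (k s : ℕ) (hs : 0 < s) (hk : ∀ L v, RW r c S L v → L.length ≠ k + 1)
    (hO : ∀ z ∈ Z, ((S.filter (fun v => r z v)).image (c z)).card ≤ s) :
    ∃ S' ⊆ Z, Z.card ≤ l * (k + 1) * (k + 1) * (4 * s) * S'.card ∧
      ∀ y ∈ S', ∀ z ∈ S', ∀ z' ∈ S', r z z' → c z z' ≠ b y := by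
  obtain ⟨q1, hq1, hq1'⟩ := chain_level (r := r) (c := c) (WellOrderingRel (α := α))
    (fun a => irrefl_of _ a) (fun _ _ _ => trans_of _) hZ b k hk
  obtain ⟨q2, hq2, hq2'⟩ := chain_level (r := r) (c := c) (fun x y => WellOrderingRel (α := α) y x)
    (fun a => irrefl_of WellOrderingRel a) (fun _ _ _ h1 h2 => trans_of WellOrderingRel h2 h1)
    hZ b k hk
  obtain ⟨Z1, hZ1, hc1, he1⟩ := exists_fiber Z (fun z => φ (b z) z) l (fun z _ => hφl _ _)
  obtain ⟨Z2, hZ2, hc2, he2⟩ := exists_fiber Z1 q1 (k + 1) (fun z _ => hq1 _)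
  obtain ⟨Z3, hZ3, hc3, he3⟩ := exists_fiber Z2 q2 (k + 1) (fun z _ => hq2 _)
  have hne : ∀ z ∈ Z3, ∀ z' ∈ Z3, r z z' → c z z' ≠ b z := by
    intro z hz z' hz' hr hc
    have m2 := hZ3 hz
    have m2' := hZ3 hz'
    have m1 := hZ2 m2
    have m1' := hZ2 m2'
    rcases trichotomous_of WellOrderingRel (b z) (b z') with h | h | h
    · have := hq1' z (hZ1 m1) z' (hZ1 m1') hr hc h
      rw [he2 z m2 z' m2'] at this
      omega
    · have h1 := hφ z z' hr
      rw [hc] at h1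
      have h2 := he1 z m1 z' m1'
      rw [h2, h] at h1
      omega
    · have := hq2' z (hZ1 m1) z' (hZ1 m1') hr hc h
      rw [he3 z hz z' hz'] at this
      omega
  obtain ⟨S', hS', hc4, he4⟩ := exists_select Z3 b
    (fun z => (S.filter (fun v => r z v)).image (c z)) s hs
    (fun z hz => hO z (hZ1 (hZ2 (hZ3 hz))))
  have hsub : Z3 ⊆ Z := hZ3.trans (hZ2.trans hZ1)
  refine ⟨S', hS'.trans hsub, ?_, ?_⟩
  · calc Z.card ≤ l * Z1.card := hc1
      _ ≤ l * ((k + 1) * Z2.card) := Nat.mul_le_mul_left _ hc2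
      _ ≤ l * ((k + 1) * ((k + 1) * Z3.card)) :=
        Nat.mul_le_mul_left _ (Nat.mul_le_mul_left _ hc3)
      _ ≤ l * ((k + 1) * ((k + 1) * (4 * s * S'.card))) :=
        Nat.mul_le_mul_left _ (Nat.mul_le_mul_left _ (Nat.mul_le_mul_left _ hc4))
      _ = _ := by ring
  · intro y hy z hz z' hz' hr hc
    have h1 := he4 z hz y hy (by
      rw [← hc]
      refine Finset.mem_image_of_mem _ (Finset.mem_filter.2 ⟨?_, hr⟩)
      exact hZ (hsub (hS' hz')))
    exact hne z (hS' hz) z' (hS' hz') hr (hc.trans h1)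

end
end FR
namespace FR
open Classical
section
variable {V α : Type} {r : V → V → Prop} {c : V → V → α}

lemma tbound (h0 : ∀ v, ¬ r v v) (hT : ∀ u v : V, u ≠ v → (r u v ↔ ¬ r v u))
    (φ : α → V → ℕ) (l : ℕ) (hl : 2 ≤ l) (hφl : ∀ a v, φ a v < l)
    (hφ : ∀ u v, r u v → φ (c u v) u < φ (c u v) v) :
    ∀ (j : ℕ) (S : Finset V), (∀ L v, RW r c S L v → L.length ≠ j + 1) →
      S.card ≤ AA (j + 1) * l ^ j := by
  intro j
  induction j using Nat.strong_induction_on with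
  | _ j IH =>
  intro S hS
  rcases j with _ | j
  · have h1 : S.card ≤ 1 := by
      rw [Finset.card_le_one]
      intro u hu v hv
      by_contra hne
      have : ∀ u ∈ S, ∀ v ∈ S, ¬ r u v := by
        intro u hu v hv hr
        exact hS _ v (RW.snoc (RW.nil hu) hr hv (by simp)) (by simp)
      exact this u hu v hv ((hT u v hne).2 (this v hv u hu))
    have := AA_ge 1
    simp
    omega
  by_contra hN
  push Not at hN
  have hlpos : 0 < l := by omega
  set N := S.card with hNdef
  set S0 := S.filter (fun v => ¬ ∃ L, L.length = j + 1 ∧ RW r c S L v) with hS0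
  have hS0c : S0.card ≤ AA (j + 1) * l ^ j := by
    refine IH j (by omega) S0 ?_
    intro L v h hlen
    exact (Finset.mem_filter.1 h.mem).2 ⟨L, hlen, h.mono (Finset.filter_subset _ _)⟩
  have hN0 : 2 * S0.card < N := by
    have h1 : AA (j + 1) * l ^ j * 2 ≤ AA (j + 2) * l ^ (j + 1) := by
      rw [pow_succ, ← mul_assoc]
      exact Nat.mul_le_mul (Nat.mul_le_mul_right _ (AA_mono (by omega))) hl
    have : AA (j + 2) * l ^ (j + 1) < N := hN
    omega
  have hN8 : 8 ≤ N := by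
    have h1 := AA_ge (j + 2)
    have h2 : 1 ≤ l ^ (j + 1) := Nat.one_le_pow _ _ hlpos
    have h3 : 8 * 1 ≤ AA (j + 2) * l ^ (j + 1) := Nat.mul_le_mul h1 h2
    have : AA (j + 2) * l ^ (j + 1) < N := hN
    omega
  set U := S.filter (fun v => ∃ L, L.length = j + 1 ∧ RW r c S L v) with hU
  have hUS0 : U.card + S0.card = N := Finset.card_filter_add_card_filter_not _
  have hUS : U ⊆ S := Finset.filter_subset _ _
  have hOU : ∀ u ∈ U, ((S.filter (fun v => r u v)).image (c u)).card ≤ j + 1 := by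
    intro u hu
    obtain ⟨L, hL, hRW⟩ := (Finset.mem_filter.1 hu).2
    have : (S.filter (fun v => r u v)).image (c u) ⊆ L.toFinset := by
      intro a ha
      obtain ⟨v, hv, rfl⟩ := Finset.mem_image.1 ha
      obtain ⟨hvS, hr⟩ := Finset.mem_filter.1 hv
      by_contra hnot
      refine hS _ v (RW.snoc hRW hr hvS (by simpa using hnot)) (by simp [hL])
    calc _ ≤ L.toFinset.card := Finset.card_le_card this
      _ ≤ L.length := L.toFinset_card_le
      _ = _ := hL
  set X := U.filter (fun u => 8 * (S.filter (fun v => r u v)).card < N) with hX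
  set Z := U.filter (fun u => ¬ 8 * (S.filter (fun v => r u v)).card < N) with hZ
  have hXZ : X.card + Z.card = U.card := Finset.card_filter_add_card_filter_not _
  have hXc : 4 * X.card < N + 4 := by
    rcases X.eq_empty_or_nonempty with h | h
    · rw [h]; simp
    · obtain ⟨u, hu, hd⟩ := exists_outdeg h0 hT X h
      have h1 : (X.filter (fun v => r u v)).card ≤ (S.filter (fun v => r u v)).card :=
        Finset.card_le_card (Finset.filter_subset_filter _ ((Finset.filter_subset _ _).trans hUS))
      have h2 := (Finset.mem_filter.1 hu).2
      omega
  have hZc : N ≤ 8 * Z.card := by omega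
  have hZU : Z ⊆ U := Finset.filter_subset _ _
  have hZS : Z ⊆ S := hZU.trans hUS
  have hb : ∀ z ∈ Z, ∃ a, N ≤ 8 * ((j + 1) * (S.filter (fun v => r z v ∧ c z v = a)).card) := by
    intro z hz
    have h1 := (Finset.mem_filter.1 hz).2
    obtain ⟨y, hy⟩ := exists_class (S.filter (fun v => r z v)) (c z) _ (j + 1)
      (fun w hw => Finset.mem_image_of_mem _ hw) (hOU z (hZU hz))
      (by rw [← Finset.card_pos]; omega)
    refine ⟨y, ?_⟩
    rw [Finset.filter_filter] at hy
    omega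
  obtain ⟨z0, hz0⟩ : Z.Nonempty := by rw [← Finset.card_pos]; omega
  obtain ⟨a0, -⟩ := hb z0 hz0
  have hb' : ∀ z, ∃ a, z ∈ Z →
      N ≤ 8 * ((j + 1) * (S.filter (fun v => r z v ∧ c z v = a)).card) := by
    intro z
    by_cases hz : z ∈ Z
    · obtain ⟨a, ha⟩ := hb z hz
      exact ⟨a, fun _ => ha⟩
    · exact ⟨a0, fun h => absurd h hz⟩
  choose b hbb using hb'
  obtain ⟨S', hS'Z, hS'c, hS'⟩ := purify φ l hφl hφ hZS b (j + 1) (j + 1) (by omega) hS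
    (fun z hz => hOU z (hZU hz))
  have hNS' : N ≤ 32 * (j + 2) ^ 3 * l * S'.card := by
    calc N ≤ 8 * (l * (j + 1 + 1) * (j + 1 + 1) * (4 * (j + 1)) * S'.card) := by omega
      _ ≤ 8 * (l * (j + 1 + 1) * (j + 1 + 1) * (4 * (j + 2)) * S'.card) := by gcongr; omega
      _ = _ := by ring
  have hh1 : hh j ≤ j + 1 := min_le_left _ _
  have hh2 : 1 ≤ hh j := by unfold hh; omega
  obtain ⟨i, hi⟩ : ∃ i, i + hh j = j + 1 := ⟨j + 1 - hh j, by omega⟩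
  have hrain : ∃ L y, RW r c S' L y ∧ L.length = i := by
    rcases i with _ | i
    · have : S'.Nonempty := by
        rw [← Finset.card_pos]
        by_contra hc
        have : S'.card = 0 := by omega
        rw [this] at hNS'
        omega
      obtain ⟨y, hy⟩ := this
      exact ⟨[], y, RW.nil hy, rfl⟩
    · by_contra hcon
      push Not at hcon
      have h1 := IH i (by omega) S' hcon
      have h2 : hh j = 5 + 3 * Nat.clog 2 (j + 2) := by
        unfold hh at hi ⊢; omega
      have h3 : 32 * (j + 2) ^ 3 ≤ l ^ (hh j) := by
        rw [h2]
        exact (two_pow_hh j).trans (Nat.pow_le_pow_left hl _)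
      have h4 : N ≤ AA (j + 2) * l ^ (j + 1) := by
        calc N ≤ 32 * (j + 2) ^ 3 * l * S'.card := hNS'
          _ ≤ l ^ (hh j) * l * (AA (i + 1) * l ^ i) := by gcongr
          _ = AA (i + 1) * l ^ (i + 1 + hh j) := by ring
          _ = AA (i + 1) * l ^ (j + 1) := by rw [hi]
          _ ≤ _ := Nat.mul_le_mul_right _ (AA_mono (by omega))
      have : AA (j + 2) * l ^ (j + 1) < N := hN
      omega
  obtain ⟨L, y, hRW, hLi⟩ := hrain
  have hyS' := hRW.mem
  have hbL : b y ∉ L := by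
    intro hmem
    exact hRW.colours (fun a => a ≠ b y) (fun u hu v hv hr => hS' y hyS' u hu v hv hr) _ hmem rfl
  set W := S.filter (fun v => r y v ∧ c y v = b y) with hW
  have hWc : N ≤ 8 * ((j + 1) * W.card) := hbb y (hS'Z hyS')
  have hWR : ∀ w ∈ W, RW r c S (b y :: L) w := by
    intro w hw
    obtain ⟨hwS, hr, hc⟩ := Finset.mem_filter.1 hw
    rw [← hc]
    exact RW.snoc (hRW.mono (hS'Z.trans hZS)) hr hwS (by rw [hc]; exact hbL)
  obtain ⟨W', hW'W, hW'c, hW'⟩ := exists_fiber_list φ l hφl (b y :: L) W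
  obtain ⟨h', hh'⟩ : ∃ h', hh j = h' + 1 := ⟨hh j - 1, by omega⟩
  have hW'b : W'.card ≤ AA (h' + 1) * l ^ h' := by
    refine IH h' (by omega) W' ?_
    intro L' v h hlen
    refine hS (L' ++ (b y :: L)) v (RW.append (hW'W.trans (Finset.filter_subset _ _))
      (fun w hw => hWR w (hW'W hw)) h ?_) ?_
    · refine h.colours (fun a => a ∉ b y :: L) ?_
      intro u hu v hv hr hmem
      have := hφ u v hr
      rw [hW' _ hmem u hu v hv] at this
      omega
    · simp [hlen, hLi]; omega
  have : N ≤ AA (j + 2) * l ^ (j + 1) := by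
    calc N ≤ 8 * ((j + 1) * W.card) := hWc
      _ ≤ 8 * ((j + 2) * (l ^ (i + 1) * (AA (h' + 1) * l ^ h'))) := by
        have : W.card ≤ l ^ (i + 1) * (AA (h' + 1) * l ^ h') := by
          simp only [List.length_cons, hLi] at hW'c
          exact hW'c.trans (Nat.mul_le_mul_left _ hW'b)
        gcongr
        omega
      _ = 8 * (j + 2) * AA (hh j) * l ^ (i + (h' + 1)) := by rw [hh']; ring
      _ = 8 * (j + 2) * AA (hh j) * l ^ (j + 1) := by rw [← hh', hi]
      _ ≤ _ := Nat.mul_le_mul_right _ (AA_rec j)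
  have : AA (j + 2) * l ^ (j + 1) < N := hN
  omega

end
end FR
namespace FR
open Classical
section
variable {V α : Type} {r : V → V → Prop} {c : V → V → α}

/-- every colour can be avoided by some rainbow of length `s` ending at `v` -/
def Rob [Fintype V] (r : V → V → Prop) (c : V → V → α) (s : ℕ) (v : V) : Prop :=
  ∀ a : α, ∃ L : List α, L.length = s ∧ RW r c Finset.univ L v ∧ a ∉ L

lemma stepbound [Fintype V] (h0 : ∀ v, ¬ r v v) (hT : ∀ u v : V, u ≠ v → (r u v ↔ ¬ r v u))
    (φ : α → V → ℕ) (l : ℕ) (hl : 2 ≤ l) (hφl : ∀ a v, φ a v < l)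
    (hφ : ∀ u v, r u v → φ (c u v) u < φ (c u v) v) (k : ℕ)
    (hk : ∀ v, ((Finset.univ.filter (fun w => r v w)).image (c v)).card ≤ k) (s : ℕ) :
    (Finset.univ.filter (fun v => Rob r c s v ∧ ¬ Rob r c (s + 1) v)).card ≤
      1 + 2 * (k * (s + 1) * (AA (s + 1) * l ^ (s + 1))) := by
  set X := Finset.univ.filter (fun v => Rob r c s v ∧ ¬ Rob r c (s + 1) v) with hX
  rcases X.eq_empty_or_nonempty with h | hne
  · rw [h]; simp
  have ha : ∀ v ∈ X, ∃ a, ∀ L : List α, L.length = s + 1 → RW r c Finset.univ L v → a ∈ L := by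
    intro v hv
    have := (Finset.mem_filter.1 hv).2.2
    unfold Rob at this
    push Not at this
    exact this
  obtain ⟨v0, hv0⟩ := id hne
  obtain ⟨a0, -⟩ := ha v0 hv0
  have ha' : ∀ v, ∃ a, v ∈ X → ∀ L : List α, L.length = s + 1 → RW r c Finset.univ L v → a ∈ L := by
    intro v
    by_cases hv : v ∈ X
    · obtain ⟨a, h⟩ := ha v hv
      exact ⟨a, fun _ => h⟩
    · exact ⟨a0, fun h => absurd h hv⟩
  choose a haa using ha'
  obtain ⟨u, hu, hd⟩ := exists_outdeg h0 hT X hne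
  have hRu : Rob r c s u := (Finset.mem_filter.1 hu).2.1
  choose R hR1 hR2 hR3 using hRu
  set Y := X.filter (fun v => r u v) with hY
  suffices hYc : Y.card ≤ k * (s + 1) * (AA (s + 1) * l ^ (s + 1)) by omega
  rcases Y.eq_empty_or_nonempty with h | hYne
  · rw [h]; simp
  obtain ⟨y, hy⟩ := exists_class Y a (((Finset.univ.filter (fun w => r u w)).image (c u)).biUnion
    (fun b => insert b (R b).toFinset)) (k * (s + 1)) (by
      intro v hv
      obtain ⟨hvX, hr⟩ := Finset.mem_filter.1 hv
      refine Finset.mem_biUnion.2 ⟨c u v, Finset.mem_image_of_mem _ (by simp [hr]), ?_⟩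
      have := haa v hvX (c u v :: R (c u v)) (by simp [hR1])
        (RW.snoc (hR2 _) hr (Finset.mem_univ _) (hR3 _))
      simpa using this) (by
      refine (Finset.card_biUnion_le_card_mul _ _ (s + 1) ?_).trans (Nat.mul_le_mul_right _ (hk u))
      intro b _
      refine (Finset.card_insert_le _ _).trans ?_
      have := (R b).toFinset_card_le
      rw [hR1] at this
      omega) hYne
  obtain ⟨W, hW, hWc, hWe⟩ := exists_fiber (Y.filter (fun w => a w = y)) (φ y) l (fun w _ => hφl _ _)
  have hWb : W.card ≤ AA (s + 1) * l ^ s := by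
    refine tbound h0 hT φ l hl hφl hφ s W ?_
    intro L v h hlen
    have hv := hW h.mem
    obtain ⟨hvY, hay⟩ := Finset.mem_filter.1 hv
    have hvX := (Finset.mem_filter.1 hvY).1
    have hmem := haa v hvX L hlen (h.mono (Finset.subset_univ _))
    rw [hay] at hmem
    refine h.colours (fun x => x ≠ y) ?_ y hmem rfl
    intro u hu v hv hr hc
    have h1 := hφ u v hr
    rw [hc, hWe u hu v hv] at h1
    omega
  calc Y.card ≤ k * (s + 1) * (Y.filter (fun w => a w = y)).card := hy
    _ ≤ k * (s + 1) * (l * (AA (s + 1) * l ^ s)) :=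
      Nat.mul_le_mul_left _ (hWc.trans (Nat.mul_le_mul_left _ hWb))
    _ = _ := by ring

lemma gcount [Fintype V] (h0 : ∀ v, ¬ r v v) (hT : ∀ u v : V, u ≠ v → (r u v ↔ ¬ r v u))
    (φ : α → V → ℕ) (l : ℕ) (hl : 2 ≤ l) (hφl : ∀ a v, φ a v < l)
    (hφ : ∀ u v, r u v → φ (c u v) u < φ (c u v) v) (k : ℕ) (hk0 : 0 < k)
    (hk : ∀ v, ((Finset.univ.filter (fun w => r v w)).image (c v)).card ≤ k) (s : ℕ) :
    (Finset.univ.filter (fun v => ¬ Rob r c s v)).card ≤ 6 * k * s * AA s * l ^ s := by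
  induction s with
  | zero =>
    have : (Finset.univ.filter (fun v => ¬ Rob r c 0 v)) = ∅ := by
      refine Finset.filter_eq_empty_iff.2 ?_
      intro v _ h
      exact h (fun a => ⟨[], rfl, RW.nil (Finset.mem_univ _), by simp⟩)
    rw [this]; simp
  | succ s ih =>
    have h1 := stepbound h0 hT φ l hl hφl hφ k hk s
    have h2 : (Finset.univ.filter (fun v => ¬ Rob r c (s + 1) v)) ⊆
        (Finset.univ.filter (fun v => ¬ Rob r c s v)) ∪
        (Finset.univ.filter (fun v => Rob r c s v ∧ ¬ Rob r c (s + 1) v)) := by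
      intro v hv
      have hv := (Finset.mem_filter.1 hv).2
      by_cases h : Rob r c s v <;> simp [h, hv]
    have h3 := (Finset.card_le_card h2).trans (Finset.card_union_le _ _)
    set x := k * (AA (s + 1) * l ^ (s + 1)) with hx
    have hx1 : 1 ≤ x := by
      have := AA_ge (s + 1)
      have : 0 < l ^ (s + 1) := pow_pos (by omega) _
      rw [hx]
      have : 0 < AA (s + 1) := by omega
      exact Nat.succ_le_of_lt (by positivity)
    have h4 : 2 * (6 * k * s * AA s * l ^ s) ≤ 6 * (s * x) := by
      calc 2 * (6 * k * s * AA s * l ^ s) ≤ l * (6 * k * s * AA (s + 1) * l ^ s) := by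
            have := AA_mono (Nat.le_succ s)
            gcongr
        _ = _ := by rw [hx]; ring
    have h5 : k * (s + 1) * (AA (s + 1) * l ^ (s + 1)) = s * x + x := by rw [hx]; ring
    have h6 : 6 * k * (s + 1) * AA (s + 1) * l ^ (s + 1) = 6 * (s * x) + 6 * x := by rw [hx]; ring
    rw [h5] at h1
    rw [h6]
    omega
end

section
variable {n : ℕ} {α : Type} {r : Fin n → Fin n → Prop} {c : Fin n → Fin n → α}

lemma flash_conv (a : α) (m : ℕ) (v : Fin n) (h : Wk (fun u v => r u v ∧ c u v = a) m v) :
    ∃ x : Fin (m + 1) → Fin n, IsWalk r x ∧ (∀ i, walkColours c x i = a) ∧ x (Fin.last m) = v := by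
  induction h with
  | zero v => exact ⟨fun _ => v, fun i => i.elim0, fun i => i.elim0, rfl⟩
  | succ h1 h2 ih =>
    rename_i m u v
    obtain ⟨x, hx1, hx2, hx3⟩ := ih
    refine ⟨Fin.snoc (α := fun _ => Fin n) x v, ?_, ?_, by simp⟩
    · intro i
      refine Fin.lastCases ?_ (fun i => ?_) i
      · rw [Fin.succ_last, Fin.snoc_last, Fin.snoc_castSucc, hx3]; exact h2.1
      · rw [← Fin.castSucc_succ, Fin.snoc_castSucc, Fin.snoc_castSucc]; exact hx1 i
    · intro i
      unfold walkColours
      refine Fin.lastCases ?_ (fun i => ?_) i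
      · rw [Fin.succ_last, Fin.snoc_last, Fin.snoc_castSucc, hx3]; exact h2.2
      · rw [← Fin.castSucc_succ, Fin.snoc_castSucc, Fin.snoc_castSucc]; exact hx2 i

lemma rain_conv (L : List α) (v : Fin n) (h : RW r c Finset.univ L v) :
    ∃ x : Fin (L.length + 1) → Fin n, IsWalk r x ∧ Function.Injective (walkColours c x) ∧
      (∀ i, walkColours c x i ∈ L) ∧ x (Fin.last _) = v := by
  induction h with
  | nil h =>
    rename_i v
    exact ⟨fun _ => v, fun i => i.elim0, fun i => i.elim0, fun i => i.elim0, rfl⟩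
  | snoc h1 hr hv hc ih =>
    rename_i L u v
    obtain ⟨x, hx1, hx2, hx3, hx4⟩ := ih
    have e0 : IsWalk r (Fin.snoc (α := fun _ => Fin n) x v) := by
      intro i
      refine Fin.lastCases ?_ (fun i => ?_) i
      · rw [Fin.succ_last, Fin.snoc_last, Fin.snoc_castSucc, hx4]; exact hr
      · rw [← Fin.castSucc_succ, Fin.snoc_castSucc, Fin.snoc_castSucc]; exact hx1 i
    have e1 : walkColours c (Fin.snoc (α := fun _ => Fin n) x v) (Fin.last _) = c u v := by
      unfold walkColours
      rw [Fin.succ_last, Fin.snoc_last, Fin.snoc_castSucc, hx4]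
    have e2 : ∀ i : Fin L.length, walkColours c (Fin.snoc (α := fun _ => Fin n) x v) i.castSucc
        = walkColours c x i := by
      intro i
      unfold walkColours
      rw [← Fin.castSucc_succ, Fin.snoc_castSucc, Fin.snoc_castSucc]
    refine ⟨Fin.snoc (α := fun _ => Fin n) x v, ?_, ?_, ?_, by simp⟩
    · exact e0
    · intro i j
      refine Fin.lastCases ?_ (fun i => ?_) i <;> refine Fin.lastCases ?_ (fun j => ?_) j
      · intro _; rfl
      · intro h
        exfalso
        have h' := e1.symm.trans (h.trans (e2 j))
        exact hc (h' ▸ hx3 j)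
      · intro h
        exfalso
        have h' := e1.symm.trans (h.symm.trans (e2 i))
        exact hc (h' ▸ hx3 i)
      · intro h
        have h' := (e2 i).symm.trans (h.trans (e2 j))
        rw [hx2 h']
    · intro i
      refine Fin.lastCases ?_ (fun i => ?_) i
      · have := e1
        exact List.mem_cons.2 (Or.inl this)
      · have := e2 i
        exact List.mem_cons.2 (Or.inr (this ▸ hx3 i))

lemma rob_conv (s : ℕ) (v : Fin n) (h : Rob r c s v) : IsInRobust s r c v := by
  intro a
  obtain ⟨L, rfl, hRW, ha⟩ := h a
  obtain ⟨x, h1, h2, h3, h4⟩ := rain_conv L v hRW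
  exact ⟨x, h1, h2, fun i hi => ha (hi ▸ h3 i), h4⟩

end

lemma mem_gSet (l k rb : ℕ) (hl : 0 < l) (hk : rb < k) :
    6 * k * rb * AA rb * l ^ rb ∈ gSet l k rb := by
  intro n hn r hT α c hout
  rcases Nat.eq_zero_or_pos rb with rfl | hrb
  · right; right
    exact ⟨⟨0, by omega⟩, rob_conv 0 _ (fun a => ⟨[], rfl, RW.nil (Finset.mem_univ _), by simp⟩)⟩
  have hbig : 2 ≤ n := by
    have := AA_ge rb
    have h1 : 0 < AA rb := by omega
    have h2 : 0 < k := by omega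
    have : 0 < 6 * k * rb * AA rb * l ^ rb := by positivity
    omega
  by_cases hfl : HasFlash l r c
  · exact Or.inl hfl
  right; right
  have hl2 : 2 ≤ l := by
    by_contra h
    have : l = 1 := by omega
    subst this
    have hne : (⟨0, by omega⟩ : Fin n) ≠ ⟨1, by omega⟩ := by simp
    have key : ∀ u v, r u v → HasFlash 1 r c := by
      intro u v huv
      obtain ⟨x, h1, h2, -⟩ := flash_conv (c u v) 1 v (Wk.succ (Wk.zero u) ⟨huv, rfl⟩)
      exact ⟨x, h1, fun i j => (h2 i).trans (h2 j).symm⟩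
    by_cases hr : r ⟨0, by omega⟩ ⟨1, by omega⟩
    · exact hfl (key _ _ hr)
    · refine hr ((hT.2 _ _ hne).2 fun hr' => hfl (key _ _ hr'))
  have hlev : ∀ a : α, ∃ q : Fin n → ℕ, (∀ v, q v < l) ∧
      ∀ u v, (r u v ∧ c u v = a) → q u < q v := by
    intro a
    refine level _ l ?_
    intro v h
    obtain ⟨x, h1, h2, -⟩ := flash_conv a l v h
    exact hfl ⟨x, h1, fun i j => (h2 i).trans (h2 j).symm⟩
  choose φ hφ1 hφ2 using hlev
  by_contra hrob
  have hcount := gcount hT.1 hT.2 φ l hl2 hφ1 (fun u v h => hφ2 _ u v ⟨h, rfl⟩) k (by omega)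
    (fun v => by
      have h1 := hout v
      have h2 : outColours r c v =
          (((Finset.univ.filter (fun w => r v w)).image (c v) : Finset α) : Set α) := by
        ext a; simp [outColours]
      rw [h2, Set.ncard_coe_finset] at h1
      omega) rb
  have hall : (Finset.univ.filter (fun v => ¬ Rob r c rb v)) = Finset.univ := by
    refine Finset.filter_true_of_mem fun v _ h => hrob ⟨v, rob_conv rb v h⟩
  rw [hall] at hcount
  simp at hcount
  omega

lemma g_le (l k rb : ℕ) (hl : 0 < l) (hk : rb < k) : g l k rb ≤ 6 * k * rb * AA rb * l ^ rb :=
  Nat.sInf_le (mem_gSet l k rb hl hk)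
end FR
namespace FR
open Filter Asymptotics

lemma hh_le (k : ℕ) : (hh k : ℝ) ≤ 8 + 6 * Real.log ((k : ℝ) + 4) := by
  have h1 : hh k ≤ 5 + 3 * Nat.clog 2 (k + 2) := min_le_right _ _
  have h2 : (Nat.clog 2 (k + 2) : ℝ) ≤ Real.logb 2 ((k : ℝ) + 2) + 1 := by
    have e := Real.natCeil_logb_natCast 2 (k + 2)
    rw [← e]
    have := Nat.ceil_lt_add_one (a := Real.logb (2 : ℕ) ((k + 2 : ℕ) : ℝ))
      (Real.logb_nonneg (by norm_num) (by push_cast; linarith [(Nat.cast_nonneg k : (0:ℝ) ≤ k)]))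
    push_cast at this ⊢
    exact this.le
  have h3 : Real.logb 2 ((k : ℝ) + 2) ≤ 2 * Real.log ((k : ℝ) + 4) := by
    have hk : (0:ℝ) ≤ k := Nat.cast_nonneg k
    have hlog : Real.log ((k : ℝ) + 2) ≤ Real.log ((k : ℝ) + 4) :=
      Real.log_le_log (by linarith) (by linarith)
    have hpos : 0 ≤ Real.log ((k : ℝ) + 2) := Real.log_nonneg (by linarith)
    have := Real.log_two_gt_d9
    rw [Real.logb, div_le_iff₀ (by linarith)]
    nlinarith
  have h4 : (hh k : ℝ) ≤ 5 + 3 * (Nat.clog 2 (k + 2) : ℝ) := by exact_mod_cast h1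
  linarith

lemma key_eventually (ε : ℝ) (hε : 0 < ε) : ∃ K : ℕ, ∀ k : ℕ, K ≤ k →
    8 * (hh k : ℝ) * Real.log ((hh k : ℝ) + 2) ^ (1 + ε) ≤ Real.log ((k : ℝ) + 4) ^ (1 + ε) := by
  have hlo := isLittleO_log_rpow_rpow_atTop (1 + ε) hε
  have hev := hlo.bound (c := 1 / (8 * 12 ^ (1 + ε))) (by positivity)
  have htend : Tendsto (fun k : ℕ => 10 + 6 * Real.log ((k : ℝ) + 4)) atTop atTop := by
    refine tendsto_atTop_add_const_left _ _ (Tendsto.const_mul_atTop (by norm_num) ?_)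
    exact Real.tendsto_log_atTop.comp
      (tendsto_atTop_add_const_right _ _ tendsto_natCast_atTop_atTop)
  have hev2 := htend.eventually (hev.and (eventually_ge_atTop (20:ℝ)))
  obtain ⟨K, hK⟩ := eventually_atTop.1 hev2
  refine ⟨K, fun k hk => ?_⟩
  obtain ⟨hb, h20⟩ := hK k hk
  have hhl := hh_le k
  set x := Real.log ((k : ℝ) + 4) with hx
  set y := 10 + 6 * x with hy
  have hly : 0 ≤ Real.log y := Real.log_nonneg (by linarith)
  have hy0 : 0 < y := by linarith
  rw [Real.norm_of_nonneg (Real.rpow_nonneg hly _),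
    Real.norm_of_nonneg (Real.rpow_nonneg hy0.le _)] at hb
  have hh0 : (0:ℝ) ≤ hh k := Nat.cast_nonneg _
  have h1 : Real.log ((hh k : ℝ) + 2) ^ (1 + ε) ≤ Real.log y ^ (1 + ε) := by
    refine Real.rpow_le_rpow (Real.log_nonneg (by linarith)) ?_ (by linarith)
    exact Real.log_le_log (by linarith) (by linarith)
  have h2 : (y / 12) ^ (1 + ε) ≤ x ^ (1 + ε) :=
    Real.rpow_le_rpow (by positivity) (by linarith) (by linarith)
  have h3 : (y / 12) ^ (1 + ε) = y * y ^ ε / 12 ^ (1 + ε) := by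
    rw [Real.div_rpow hy0.le (by norm_num), Real.rpow_add hy0, Real.rpow_one]
  have h12 : (0:ℝ) < 12 ^ (1 + ε) := by positivity
  calc 8 * (hh k : ℝ) * Real.log ((hh k : ℝ) + 2) ^ (1 + ε)
      ≤ 8 * y * Real.log y ^ (1 + ε) := by
        refine mul_le_mul (by linarith) h1 (Real.rpow_nonneg (Real.log_nonneg (by linarith)) _)
          (by linarith)
    _ ≤ 8 * y * (1 / (8 * 12 ^ (1 + ε)) * y ^ ε) :=
        mul_le_mul_of_nonneg_left hb (by linarith)
    _ = y * y ^ ε / 12 ^ (1 + ε) := by field_simp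
    _ ≤ _ := by rw [← h3]; exact h2

lemma AA_bound (ε : ℝ) (hε : 0 < ε) : ∃ D : ℝ, 0 < D ∧ ∀ k : ℕ, 1 ≤ k →
    (AA k : ℝ) ≤ D * k * Real.log ((k : ℝ) + 2) ^ (1 + ε) := by
  obtain ⟨K, hK⟩ := key_eventually ε hε
  have hD : (0:ℝ) < AA (K + 2) := by
    have := AA_ge (K + 2)
    exact_mod_cast (by omega : 0 < AA (K + 2))
  refine ⟨AA (K + 2), hD, ?_⟩
  intro k
  induction k using Nat.strong_induction_on with
  | _ k IH =>
  intro hk1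
  have hk1' : (1:ℝ) ≤ k := by exact_mod_cast hk1
  have hlog1 : 1 ≤ Real.log ((k : ℝ) + 2) := by
    rw [Real.le_log_iff_exp_le (by linarith)]
    linarith [Real.exp_one_lt_d9]
  have hpow1 : 1 ≤ Real.log ((k : ℝ) + 2) ^ (1 + ε) := Real.one_le_rpow hlog1 (by linarith)
  by_cases hkK : k ≤ K + 2
  · have h1 : (AA k : ℝ) ≤ AA (K + 2) := by exact_mod_cast AA_mono hkK
    calc (AA k : ℝ) ≤ AA (K + 2) * 1 * 1 := by linarith
      _ ≤ _ := by gcongr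
  · obtain ⟨j, rfl⟩ : ∃ j, k = j + 2 := ⟨k - 2, by omega⟩
    rw [AA_succ]
    push_cast
    refine max_le ?_ ?_
    · have := IH (j + 1) (by omega) (by omega)
      push_cast at this
      refine this.trans ?_
      have hj : (0:ℝ) ≤ j := Nat.cast_nonneg j
      have hl : Real.log ((j : ℝ) + 1 + 2) ≤ Real.log ((j : ℝ) + 2 + 2) :=
        Real.log_le_log (by linarith) (by linarith)
      have hl0 : 0 ≤ Real.log ((j : ℝ) + 1 + 2) := Real.log_nonneg (by linarith)
      gcongr
      norm_num
    · have hh1 : 1 ≤ hh j := by unfold hh; omega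
      have hh2 : hh j ≤ j + 1 := min_le_left _ _
      have h1 := IH (hh j) (by omega) hh1
      have h2 := hK j (by omega)
      have e : (j : ℝ) + 2 + 2 = j + 4 := by ring
      rw [e]
      calc 8 * ((j : ℝ) + 2) * (AA (hh j) : ℝ)
          ≤ 8 * ((j : ℝ) + 2) * (AA (K + 2) * (hh j) * Real.log ((hh j : ℝ) + 2) ^ (1 + ε)) := by
            gcongr
        _ = AA (K + 2) * ((j : ℝ) + 2) * (8 * (hh j : ℝ) * Real.log ((hh j : ℝ) + 2) ^ (1 + ε)) := by
            ring
        _ ≤ _ := by gcongr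

lemma final_bound (ε : ℝ) (hε : 0 < ε) :
    ∃ D : ℝ, 0 < D ∧ ∀ l k rb : ℕ, 0 < l → 0 < k → rb < k →
      (g l k rb : ℝ) ≤ 4 * D * (k : ℝ) ^ 3 * Real.log k ^ ((1 : ℝ) + ε) * (l : ℝ) ^ rb := by
  obtain ⟨D, hD, hA⟩ := AA_bound ε hε
  refine ⟨6 * D * 2 ^ (1 + ε) / 4, by positivity, ?_⟩
  intro l k rb hl hk hrb
  have hg : (g l k rb : ℝ) ≤ 6 * k * rb * AA rb * (l : ℝ) ^ rb := by
    exact_mod_cast g_le l k rb hl hrb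
  have hk1 : (1:ℝ) ≤ k := by exact_mod_cast hk
  have hlogk : 0 ≤ Real.log k := Real.log_nonneg hk1
  rcases Nat.eq_zero_or_pos rb with rfl | hpos
  · refine hg.trans ?_
    simp only [Nat.cast_zero, mul_zero, zero_mul]
    positivity
  have hk2 : (2:ℝ) ≤ k := by exact_mod_cast (by omega : 2 ≤ k)
  have hrk : (rb : ℝ) + 1 ≤ k := by exact_mod_cast hrb
  have hlog : Real.log ((rb : ℝ) + 2) ≤ 2 * Real.log k := by
    have : 2 * Real.log (k:ℝ) = Real.log ((k:ℝ) ^ 2) := by rw [Real.log_pow]; norm_num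
    rw [this]
    exact Real.log_le_log (by positivity) (by nlinarith)
  have hl0 : 0 ≤ Real.log ((rb : ℝ) + 2) :=
    Real.log_nonneg (by linarith [(Nat.cast_nonneg rb : (0:ℝ) ≤ rb)])
  have hrk' : (rb : ℝ) ≤ k := by linarith
  have h1 : (AA rb : ℝ) ≤ D * k * (2 ^ (1 + ε) * Real.log k ^ (1 + ε)) := by
    rw [← Real.mul_rpow (by norm_num) hlogk]
    exact (hA rb hpos).trans (by gcongr)
  calc (g l k rb : ℝ) ≤ 6 * k * rb * AA rb * (l : ℝ) ^ rb := hg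
    _ ≤ 6 * k * k * (D * k * (2 ^ (1 + ε) * Real.log k ^ (1 + ε))) * (l : ℝ) ^ rb := by gcongr
    _ = _ := by ring

end FR
/-- For every ε > 0 there is a constant D_ε > 0 such that for all positive integers
l and k and every r with 0 ≤ r < k, g(l,k,r) ≤ 4 · D_ε · k³ · (log k)^{1+ε} · l^r. -/
theorem g_upper_bound (ε : ℝ) (hε : 0 < ε) :
    ∃ D : ℝ, 0 < D ∧ ∀ l k rb : ℕ, 0 < l → 0 < k → rb < k →
      (g l k rb : ℝ) ≤ 4 * D * (k : ℝ) ^ 3 * Real.log k ^ ((1 : ℝ) + ε) * (l : ℝ) ^ rb := by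
  exact FR.final_bound ε hε
end

section
/- Let l, k, m be positive integers with 1 ≤ m ≤ l, let c be a non-negative integer, and let T = (V, E) be an edge-coloured tournament containing no l-flash and no k-rainbow such that for every vertex v, the number of colours a for which some m-flash of colour a contains v is at most c. Then |V| ≤ t(m,k) · (l/m)^c. -/
/-! ### Helper lemmas -/

lemma colours_snoc {n k : ℕ} {α : Type} (c : Fin n → Fin n → α) (y : Fin (k + 1) → Fin n)
    (u : Fin n) :
    walkColours c (Fin.snoc (α := fun _ => Fin n) y u : Fin (k + 1 + 1) → Fin n) =
      Fin.snoc (α := fun _ => α) (walkColours c y) (c (y (Fin.last k)) u) := by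
  funext i
  refine Fin.lastCases ?_ (fun j => ?_) i
  · simp [walkColours]
  · simp only [walkColours, Fin.snoc_castSucc, Fin.succ_castSucc]

lemma walk_snoc {n k : ℕ} {r : Fin n → Fin n → Prop} {y : Fin (k + 1) → Fin n} {u : Fin n}
    (hy : IsWalk r y) (h : r (y (Fin.last k)) u) :
    IsWalk r (Fin.snoc (α := fun _ => Fin n) y u : Fin (k + 1 + 1) → Fin n) := by
  intro i
  refine Fin.lastCases ?_ (fun j => ?_) i
  · simpa using h
  · simp only [Fin.snoc_castSucc, Fin.succ_castSucc]
    exact hy j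

lemma colours_cons {n k : ℕ} {α : Type} (c : Fin n → Fin n → α) (y : Fin (k + 1) → Fin n)
    (u : Fin n) :
    walkColours c (Fin.cons (α := fun _ => Fin n) u y : Fin (k + 1 + 1) → Fin n) =
      Fin.cons (α := fun _ => α) (c u (y 0)) (walkColours c y) := by
  funext i
  refine Fin.cases ?_ (fun j => ?_) i
  · simp [walkColours]
  · simp only [walkColours, Fin.cons_succ, ← Fin.succ_castSucc]

lemma walk_cons {n k : ℕ} {r : Fin n → Fin n → Prop} {y : Fin (k + 1) → Fin n} {u : Fin n}
    (hy : IsWalk r y) (h : r u (y 0)) :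
    IsWalk r (Fin.cons (α := fun _ => Fin n) u y : Fin (k + 1 + 1) → Fin n) := by
  intro i
  refine Fin.cases ?_ (fun j => ?_) i
  · simpa using h
  · simp only [Fin.cons_succ, ← Fin.succ_castSucc]
    exact hy j

/-- There is a walk of length `j` in colour `a` ending at `v`. -/
def EndsAt {n : ℕ} {α : Type} (r : Fin n → Fin n → Prop) (c : Fin n → Fin n → α) (a : α) :
    ℕ → Fin n → Prop
  | 0, _ => True
  | j + 1, v => ∃ u, r u v ∧ c u v = a ∧ EndsAt r c a j u

lemma EndsAt.walk {n : ℕ} {α : Type} {r : Fin n → Fin n → Prop} {c : Fin n → Fin n → α}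
    {a : α} : ∀ (j : ℕ) (v : Fin n), EndsAt r c a j v →
      ∃ x : Fin (j + 1) → Fin n, IsWalk r x ∧ (∀ i, walkColours c x i = a) ∧
        x (Fin.last j) = v
  | 0, v, _ => ⟨fun _ => v, fun i => i.elim0, fun i => i.elim0, rfl⟩
  | j + 1, v, ⟨u, h1, h2, h3⟩ => by
    obtain ⟨x, hx, hc, hl⟩ := EndsAt.walk j u h3
    refine ⟨Fin.snoc (α := fun _ => Fin n) x v, walk_snoc hx (by rwa [hl]), fun i => ?_, by simp⟩
    rw [colours_snoc]
    refine Fin.lastCases ?_ (fun i => ?_) i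
    · simpa [hl] using h2
    · simpa using hc i

open Classical in
/-- The height of `v` in colour `a`. -/
noncomputable def height {n : ℕ} {α : Type} (l : ℕ) (hl : 0 < l) (r : Fin n → Fin n → Prop)
    (c : Fin n → Fin n → α) (a : α) (v : Fin n) : Fin l :=
  ⟨Nat.findGreatest (fun j => EndsAt r c a j v) (l - 1), by
    have := Nat.findGreatest_le (P := fun j => EndsAt r c a j v) (l - 1)
    omega⟩

lemma height_lt {n : ℕ} {α : Type} {l : ℕ} (hl : 0 < l) {r : Fin n → Fin n → Prop}
    {c : Fin n → Fin n → α} (hf : ¬ HasFlash l r c) {u v : Fin n} (h : r u v) :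
    height l hl r c (c u v) u < height l hl r c (c u v) v := by
  classical
  have h0 : EndsAt r c (c u v) (height l hl r c (c u v) u).val u := by
    have := Nat.findGreatest_spec (P := fun j => EndsAt r c (c u v) j u) (m := 0) (n := l - 1)
      (Nat.zero_le _) trivial
    unfold height
    convert this
  have h1 : EndsAt r c (c u v) ((height l hl r c (c u v) u).val + 1) v := ⟨u, h, rfl, h0⟩
  have h2 : (height l hl r c (c u v) u).val + 1 ≤ l - 1 := by
    by_contra hlt
    have := (height l hl r c (c u v) u).isLt
    have e : (height l hl r c (c u v) u).val + 1 = l := by omega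
    rw [e] at h1
    obtain ⟨x, hx, hc, -⟩ := h1.walk
    exact hf ⟨x, hx, fun i j => by rw [hc, hc]⟩
  have h3 := Nat.le_findGreatest (P := fun j => EndsAt r c (c u v) j v) h2 h1
  rw [Fin.lt_def]
  have : (height l hl r c (c u v) v).val =
    Nat.findGreatest (fun j => EndsAt r c (c u v) j v) (l - 1) := by
    unfold height; rfl
  omega

lemma card_window (l m : ℕ) [NeZero l] (hml : m ≤ l) :
    (Finset.univ.filter (fun s : Fin l => s.val < m)).card = m := by
  rw [Fin.card_filter_val_lt]; omega

lemma card_window_left (l m : ℕ) [NeZero l] (hml : m ≤ l) (j : Fin l) :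
    (Finset.univ.filter (fun s : Fin l => (j - s).val < m)).card = m := by
  refine Eq.trans ?_ (card_window l m hml)
  apply Finset.card_bij (fun s _ => j - s)
  · intro s hs; simpa using hs
  · intro a _ b _ h; simpa using h
  · intro b hb; exact ⟨j - b, by simpa using hb, by simp⟩

lemma card_window_right (l m : ℕ) [NeZero l] (hml : m ≤ l) (s : Fin l) :
    (Finset.univ.filter (fun j : Fin l => (j - s).val < m)).card = m := by
  refine Eq.trans ?_ (card_window l m hml)
  apply Finset.card_bij (fun j _ => j - s)
  · intro j hj; simpa using hj
  · intro a _ b _ h; simpa using h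
  · intro b hb; exact ⟨b + s, by simpa using hb, by simp⟩

open Classical in
lemma core_fintype {V A : Type} [Fintype A] (l m cc N : ℕ) [NeZero l] (hml : m ≤ l)
    (W : Finset V) (h : A → V → Fin l) (B : V → Finset A)
    (hB : ∀ v ∈ W, (B v).card ≤ cc)
    (hN : ∀ σ : A → Fin l,
      (W.filter (fun v => ∀ a ∈ B v, (h a v - σ a).val < m)).card ≤ N) :
    W.card * m ^ cc ≤ N * l ^ cc := by
  have key : ∀ v ∈ W, m ^ cc * l ^ Fintype.card A ≤
      (Finset.univ.filter (fun σ : A → Fin l => ∀ a ∈ B v, (h a v - σ a).val < m)).card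
        * l ^ cc := by
    intro v hv
    have e : (Finset.univ.filter (fun σ : A → Fin l => ∀ a ∈ B v, (h a v - σ a).val < m)) =
        Fintype.piFinset (fun a => if a ∈ B v then
          Finset.univ.filter (fun s : Fin l => (h a v - s).val < m) else Finset.univ) := by
      ext σ
      simp only [Finset.mem_filter, Finset.mem_univ, true_and, Fintype.mem_piFinset]
      refine forall_congr' fun a => ?_
      by_cases ha : a ∈ B v <;> simp [ha]
    rw [e, Fintype.card_piFinset]
    have e2 : ∀ a, (if a ∈ B v then
          Finset.univ.filter (fun s : Fin l => (h a v - s).val < m) else Finset.univ).card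
          = if a ∈ B v then m else l := by
      intro a
      split_ifs
      · exact card_window_left l m hml _
      · simp
    simp only [e2]
    rw [Finset.prod_ite]
    simp only [Finset.prod_const]
    have e3 : Finset.univ.filter (fun a => a ∈ B v) = B v := by ext; simp
    have e4 : (Finset.univ.filter (fun a => a ∉ B v)).card = Fintype.card A - (B v).card := by
      rw [← Finset.card_compl]; congr 1; ext; simp
    rw [e3, e4]
    obtain ⟨d, hd⟩ := Nat.exists_eq_add_of_le (hB v hv)
    obtain ⟨q, hq⟩ := Nat.exists_eq_add_of_le (Finset.card_le_univ (B v))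
    rw [hq, hd, Nat.add_sub_cancel_left]
    calc m ^ ((B v).card + d) * l ^ ((B v).card + q)
        = m ^ (B v).card * l ^ q * l ^ (B v).card * m ^ d := by ring
      _ ≤ m ^ (B v).card * l ^ q * l ^ (B v).card * l ^ d := by gcongr
      _ = _ := by ring
  have dc : ∑ v ∈ W, (Finset.univ.filter
        (fun σ : A → Fin l => ∀ a ∈ B v, (h a v - σ a).val < m)).card
      = ∑ σ : A → Fin l, (W.filter (fun v => ∀ a ∈ B v, (h a v - σ a).val < m)).card := by
    simp only [Finset.card_filter]
    exact Finset.sum_comm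
  have h1 : ∑ σ : A → Fin l, (W.filter (fun v => ∀ a ∈ B v, (h a v - σ a).val < m)).card
      ≤ l ^ Fintype.card A * N := by
    refine (Finset.sum_le_sum fun σ _ => hN σ).trans ?_
    simp
  have h2 := Finset.sum_le_sum key
  rw [Finset.sum_const, smul_eq_mul, ← Finset.sum_mul, dc] at h2
  have h3 := h2.trans (Nat.mul_le_mul_right (l ^ cc) h1)
  have hp : 0 < l ^ Fintype.card A := Nat.pow_pos (Nat.pos_of_ne_zero (NeZero.ne l))
  refine Nat.le_of_mul_le_mul_left ?_ hp
  calc _ = W.card * (m ^ cc * l ^ Fintype.card A) := by ring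
    _ ≤ _ := h3
    _ = _ := by ring

open Classical in
lemma core {V α : Type} (l m cc N : ℕ) [NeZero l] (hml : m ≤ l)
    (W : Finset V) (h : α → V → Fin l) (B : V → Finset α)
    (hB : ∀ v ∈ W, (B v).card ≤ cc)
    (hN : ∀ σ : α → Fin l,
      (W.filter (fun v => ∀ a ∈ B v, (h a v - σ a).val < m)).card ≤ N) :
    W.card * m ^ cc ≤ N * l ^ cc := by
  let A : Finset α := W.biUnion B
  refine core_fintype (A := {a // a ∈ A}) l m cc N hml W (fun a v => h a.1 v)
    (fun v => (B v).subtype (· ∈ A)) ?_ ?_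
  · intro v hv
    rw [Finset.card_subtype]
    exact (Finset.card_filter_le _ _).trans (hB v hv)
  · intro σ
    refine le_trans (Finset.card_le_card ?_)
      (hN (fun a => if ha : a ∈ A then σ ⟨a, ha⟩ else 0))
    intro v hv
    simp only [Finset.mem_filter, Finset.mem_subtype] at hv ⊢
    refine ⟨hv.1, fun a ha => ?_⟩
    have hA : a ∈ A := Finset.mem_biUnion.2 ⟨v, hv.1, ha⟩
    simpa [hA] using hv.2 ⟨a, hA⟩ ha

lemma mem_tSet_subset {l k N n : ℕ} (hN : N ∈ tSet l k) {r : Fin n → Fin n → Prop}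
    (hT : IsTournament r) {α : Type} (c : Fin n → Fin n → α) (S : Finset (Fin n))
    (hS : N < S.card) :
    (∃ x : Fin (l + 1) → Fin n, IsWalk r x ∧
      (∀ i j : Fin l, walkColours c x i = walkColours c x j) ∧ ∀ i, x i ∈ S) ∨
    (∃ y : Fin (k + 1) → Fin n, IsWalk r y ∧ Function.Injective (walkColours c y) ∧
      ∀ i, y i ∈ S) := by
  let e := S.equivFin.symm
  have hT' : IsTournament (fun i j : Fin S.card => r (e i) (e j)) := by
    refine ⟨fun v => hT.1 _, fun u v huv => hT.2 _ _ ?_⟩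
    intro h
    exact huv (e.injective (Subtype.ext h))
  rcases hN S.card hS _ hT' α (fun i j => c (e i) (e j)) with ⟨x, hx, hc⟩ | ⟨y, hy, hc⟩
  · exact Or.inl ⟨fun i => e (x i), hx, hc, fun i => (e (x i)).2⟩
  · exact Or.inr ⟨fun i => e (y i), hy, hc, fun i => (e (y i)).2⟩

lemma adj_of_ne {n : ℕ} {r : Fin n → Fin n → Prop} (hT : IsTournament r) {u v : Fin n}
    (h : u ≠ v) : r u v ∨ r v u := by
  by_cases hr : r v u
  · exact Or.inr hr
  · exact Or.inl ((hT.2 u v h).2 hr)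

open Classical in
lemma tSet_step {l k N : ℕ} (hl : 0 < l) (hN : N ∈ tSet l k) :
    2 * N + l ^ (2 * k) ∈ tSet l (k + 1) := by
  intro n hn r hT α c
  by_contra hcon
  push Not at hcon
  obtain ⟨hf, hrb⟩ := hcon
  haveI : NeZero l := ⟨hl.ne'⟩
  let P1 : Fin n → Prop := fun v => ∃ y : Fin (k + 1) → Fin n, IsWalk r y ∧
    Function.Injective (walkColours c y) ∧ y (Fin.last k) = v
  let P2 : Fin n → Prop := fun v => ∃ y : Fin (k + 1) → Fin n, IsWalk r y ∧
    Function.Injective (walkColours c y) ∧ y 0 = v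
  have b1 : (Finset.univ.filter (fun v => ¬ P1 v)).card ≤ N := by
    by_contra hlt
    rcases mem_tSet_subset hN hT c _ (not_le.1 hlt) with ⟨x, hx, hc, -⟩ | ⟨y, hy, hc, hm⟩
    · exact hf ⟨x, hx, hc⟩
    · exact (Finset.mem_filter.1 (hm (Fin.last k))).2 ⟨y, hy, hc, rfl⟩
  have b2 : (Finset.univ.filter (fun v => ¬ P2 v)).card ≤ N := by
    by_contra hlt
    rcases mem_tSet_subset hN hT c _ (not_le.1 hlt) with ⟨x, hx, hc, -⟩ | ⟨y, hy, hc, hm⟩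
    · exact hf ⟨x, hx, hc⟩
    · exact (Finset.mem_filter.1 (hm 0)).2 ⟨y, hy, hc, rfl⟩
  let W : Finset (Fin n) := Finset.univ.filter (fun v => P1 v ∧ P2 v)
  have hcover : n ≤ W.card + (N + N) := by
    have hsub : (Finset.univ : Finset (Fin n)) ⊆ W ∪ (Finset.univ.filter (fun v => ¬ P1 v) ∪
        Finset.univ.filter (fun v => ¬ P2 v)) := by
      intro v _
      simp only [W, Finset.mem_union, Finset.mem_filter, Finset.mem_univ, true_and]
      by_cases h1 : P1 v
      · by_cases h2 : P2 v
        · exact Or.inl ⟨h1, h2⟩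
        · exact Or.inr (Or.inr h2)
      · exact Or.inr (Or.inl h1)
    have h1 := Finset.card_le_card hsub
    rw [Finset.card_univ, Fintype.card_fin] at h1
    refine h1.trans ((Finset.card_union_le _ _).trans ?_)
    have := Finset.card_union_le (Finset.univ.filter (fun v => ¬ P1 v))
      (Finset.univ.filter (fun v => ¬ P2 v))
    omega
  let O : Fin n → Finset α := fun v => (Finset.univ.filter (fun u => r v u)).image (fun u => c v u)
  let I : Fin n → Finset α := fun v => (Finset.univ.filter (fun u => r u v)).image (fun u => c u v)
  have hcardim : ∀ y : Fin (k + 1) → Fin n,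
      (Finset.univ.image (walkColours c y)).card ≤ k := fun y =>
    Finset.card_image_le.trans (by simp)
  have hO : ∀ v ∈ W, (O v).card ≤ k := by
    intro v hv
    obtain ⟨y, hy, hc, hlast⟩ := (Finset.mem_filter.1 hv).2.1
    refine (Finset.card_le_card ?_).trans (hcardim y)
    intro a ha
    simp only [O, Finset.mem_image, Finset.mem_filter, Finset.mem_univ, true_and] at ha ⊢
    obtain ⟨u, hu, rfl⟩ := ha
    by_contra hno
    refine hrb ⟨Fin.snoc (α := fun _ => Fin n) y u, walk_snoc hy (by rwa [hlast]), ?_⟩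
    rw [colours_snoc, hlast]
    exact Fin.snoc_injective_iff.2 ⟨hc, by simpa using hno⟩
  have hI : ∀ v ∈ W, (I v).card ≤ k := by
    intro v hv
    obtain ⟨y, hy, hc, hlast⟩ := (Finset.mem_filter.1 hv).2.2
    refine (Finset.card_le_card ?_).trans (hcardim y)
    intro a ha
    simp only [I, Finset.mem_image, Finset.mem_filter, Finset.mem_univ, true_and] at ha ⊢
    obtain ⟨u, hu, rfl⟩ := ha
    by_contra hno
    refine hrb ⟨Fin.cons (α := fun _ => Fin n) u y, walk_cons hy (by rwa [hlast]), ?_⟩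
    rw [colours_cons, hlast]
    exact Fin.cons_injective_iff.2 ⟨by simpa using hno, hc⟩
  have hW := core l 1 (2 * k) 1 hl W (height l hl r c) (fun v => O v ∪ I v)
    (fun v hv => by
      have := Finset.card_union_le (O v) (I v)
      have := hO v hv
      have := hI v hv
      omega)
    (fun σ => by
      rw [Finset.card_le_one]
      have hno : ∀ u v : Fin n, r u v →
          (∀ a ∈ O u ∪ I u, (height l hl r c a u - σ a).val < 1) →
          (∀ a ∈ O v ∪ I v, (height l hl r c a v - σ a).val < 1) → False := by
        intro u v huv h1 h2
        have h1' := h1 (c u v) (Finset.mem_union_left _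
          (Finset.mem_image.2 ⟨v, by simpa using huv, rfl⟩))
        have h2' := h2 (c u v) (Finset.mem_union_right _
          (Finset.mem_image.2 ⟨u, by simpa using huv, rfl⟩))
        have h3 : height l hl r c (c u v) u - σ (c u v) =
            height l hl r c (c u v) v - σ (c u v) := Fin.ext (by omega)
        have h4 := height_lt hl hf huv
        rw [sub_left_injective h3] at h4
        exact lt_irrefl _ h4
      intro u hu v hv
      rw [Finset.mem_filter] at hu hv
      by_contra hne
      rcases adj_of_ne hT hne with h | h
      · exact hno u v h hu.2 hv.2
      · exact hno v u h hv.2 hu.2)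
  simp only [one_pow, mul_one, one_mul] at hW
  omega

lemma tSet_nonempty (l k : ℕ) (hl : 0 < l) : (tSet l k).Nonempty := by
  induction k with
  | zero =>
    refine ⟨0, fun n hn r hT α c => Or.inr ⟨fun _ => ⟨0, hn⟩, fun i => i.elim0, fun i => i.elim0⟩⟩
  | succ k ih =>
    obtain ⟨N, hN⟩ := ih
    exact ⟨_, tSet_step hl hN⟩

/-- If an edge-coloured tournament contains no l-flash and no k-rainbow, and for
every vertex v the number of colours a such that some m-flash of colour a contains v
is at most cc, then the tournament has at most t(m,k) · (l/m)^cc vertices. -/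
theorem card_le_of_few_flash_colours (l k m cc n : ℕ) (hl : 0 < l) (hk : 0 < k)
    (hm1 : 1 ≤ m) (hml : m ≤ l)
    (r : Fin n → Fin n → Prop) (α : Type) (c : Fin n → Fin n → α)
    (hT : IsTournament r) (hf : ¬ HasFlash l r c) (hrb : ¬ HasRainbow k r c)
    (hcol : ∀ v : Fin n,
      {a : α | ∃ x : Fin (m + 1) → Fin n, IsWalk r x ∧
        (∀ i, walkColours c x i = a) ∧ ∃ i, x i = v}.ncard ≤ cc) :
    (n : ℝ) ≤ (t m k : ℝ) * ((l : ℝ) / (m : ℝ)) ^ cc := by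
  classical
  haveI : NeZero l := ⟨hl.ne'⟩
  have ht : t m k ∈ tSet m k := Nat.sInf_mem (tSet_nonempty m k hm1)
  have hfin : ∀ v : Fin n, {a : α | ∃ x : Fin (m + 1) → Fin n, IsWalk r x ∧
        (∀ i, walkColours c x i = a) ∧ ∃ i, x i = v}.Finite := by
    intro v
    refine (Set.finite_range (fun p : Fin n × Fin n => c p.1 p.2)).subset ?_
    rintro a ⟨x, -, hc, -⟩
    exact ⟨(_, _), hc ⟨0, hm1⟩⟩
  have key := core l m cc (t m k) hml Finset.univ (height l hl r c)
    (fun v => (hfin v).toFinset)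
    (fun v _ => by
      rw [← Set.ncard_eq_toFinset_card _ (hfin v)]
      exact hcol v)
    (fun σ => by
      by_contra hlt
      rcases mem_tSet_subset ht hT c _ (not_le.1 hlt) with ⟨x, hx, hc, hS⟩ | ⟨y, hy, hc, -⟩
      · have hca : ∀ i, walkColours c x i = walkColours c x ⟨0, hm1⟩ := fun i => hc _ _
        generalize walkColours c x ⟨0, hm1⟩ = a at hca
        have hmono : StrictMono (fun i => height l hl r c a (x i)) := by
          rw [Fin.strictMono_iff_lt_succ]
          intro i
          have := height_lt hl hf (hx i)
          rw [show c (x i.castSucc) (x i.succ) = a from hca i] at this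
          exact this
        have hcard := Finset.card_le_card_of_injOn (s := Finset.univ)
          (t := Finset.univ.filter (fun j : Fin l => (j - σ a).val < m))
          (fun i => height l hl r c a (x i))
          (fun i _ => by
            have h1 := (Finset.mem_filter.1 (hS i)).2 a
              ((hfin (x i)).mem_toFinset.2 ⟨x, hx, hca, i, rfl⟩)
            simpa using h1)
          (hmono.injective.injOn)
        rw [card_window_right l m hml] at hcard
        simp at hcard
      · exact hrb ⟨y, hy, hc⟩)
  rw [Finset.card_univ, Fintype.card_fin] at key
  have key' : (n : ℝ) * (m : ℝ) ^ cc ≤ (t m k : ℝ) * (l : ℝ) ^ cc := by exact_mod_cast key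
  have hmp : (0 : ℝ) < (m : ℝ) ^ cc := by
    have : (0 : ℝ) < m := by exact_mod_cast hm1
    positivity
  rw [div_pow, ← mul_div_assoc, le_div_iff₀ hmp]
  exact key'
end

section
/- Let k ≥ 2 and let T = (V, E) be an edge-coloured tournament containing no k-rainbow. If T contains a strongly (k-2)-robust vertex, then the set of colours a for which some 2-flash of colour a exists in T has size at most k − 1. -/
/-- Appending a vertex at the end of a rainbow walk. -/
theorem rainbow_snoc {n m : ℕ} {α : Type} {r : Fin n → Fin n → Prop} {c : Fin n → Fin n → α}
    {y : Fin (m + 1) → Fin n} {u w : Fin n} (hy : IsWalk r y)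
    (hi : Function.Injective (walkColours c y)) (hu : y (Fin.last m) = u) (hr : r u w)
    (hc : c u w ∉ Set.range (walkColours c y)) :
    ∃ z : Fin (m + 1 + 1) → Fin n, IsWalk r z ∧ Function.Injective (walkColours c z) ∧
      Set.range (walkColours c z) = insert (c u w) (Set.range (walkColours c y)) ∧
      z (Fin.last (m + 1)) = w := by
  subst hu
  have key : walkColours c (Fin.snoc y w : Fin (m + 1 + 1) → Fin n) =
      Fin.snoc (walkColours c y) (c (y (Fin.last m)) w) := by
    funext i
    refine Fin.lastCases ?_ (fun j => ?_) i
    · simp [walkColours]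
    · simp only [walkColours, Fin.snoc_castSucc, Fin.succ_castSucc]
  refine ⟨Fin.snoc y w, ?_, ?_, ?_, by simp⟩
  · intro i
    refine Fin.lastCases ?_ (fun j => ?_) i
    · simpa using hr
    · simpa only [Fin.snoc_castSucc, Fin.succ_castSucc] using hy j
  · rw [key]; exact Fin.snoc_injective_iff.2 ⟨hi, hc⟩
  · rw [key, Fin.range_snoc]

/-- Adding a vertex at the start of a rainbow walk. -/
theorem rainbow_cons {n m : ℕ} {α : Type} {r : Fin n → Fin n → Prop} {c : Fin n → Fin n → α}
    {y : Fin (m + 1) → Fin n} {u w : Fin n} (hy : IsWalk r y)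
    (hi : Function.Injective (walkColours c y)) (hu : y 0 = u) (hr : r w u)
    (hc : c w u ∉ Set.range (walkColours c y)) :
    ∃ z : Fin (m + 1 + 1) → Fin n, IsWalk r z ∧ Function.Injective (walkColours c z) ∧
      Set.range (walkColours c z) = insert (c w u) (Set.range (walkColours c y)) ∧
      z 0 = w := by
  subst hu
  have key : walkColours c (Fin.cons w y : Fin (m + 1 + 1) → Fin n) =
      Fin.cons (c w (y 0)) (walkColours c y) := by
    funext i
    refine Fin.cases ?_ (fun j => ?_) i
    · simp [walkColours]
    · simp only [walkColours, Fin.cons_succ, Fin.castSucc_succ]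
  refine ⟨Fin.cons w y, ?_, ?_, ?_, by simp⟩
  · intro i
    refine Fin.cases ?_ (fun j => ?_) i
    · simpa using hr
    · simpa only [Fin.cons_succ, Fin.castSucc_succ] using hy j
  · rw [key]; exact Fin.cons_injective_iff.2 ⟨hc, hi⟩
  · rw [key, Fin.range_cons]

/-- If k ≥ 2 and an edge-coloured tournament contains no k-rainbow but contains a
strongly (k-2)-robust vertex, then at most k − 1 colours occur in 2-flashes. -/
theorem few_flash_colours_of_strongly_robust (k n : ℕ) (hk : 2 ≤ k)
    (r : Fin n → Fin n → Prop) (α : Type) (c : Fin n → Fin n → α)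
    (hT : IsTournament r) (hrb : ¬ HasRainbow k r c)
    (v : Fin n) (hv : IsStronglyRobust k r c v) :
    {a : α | ∃ x : Fin (2 + 1) → Fin n, IsWalk r x ∧
      ∀ i : Fin 2, walkColours c x i = a}.ncard ≤ k - 1 := by
  obtain ⟨m, rfl⟩ : ∃ m, k = m + 2 := ⟨k - 2, by omega⟩
  obtain ⟨C, hC, hinc, hrob⟩ := hv
  rw [← hC, ← Set.ncard_coe_finset]
  refine Set.ncard_le_ncard ?_ C.finite_toSet
  rintro a ⟨x, hx, hxa⟩
  by_contra haC
  have haC' : a ∉ C := haC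
  have e0 : r (x 0) (x 1) := hx 0
  have e1 : r (x 1) (x 2) := hx 1
  have c0 : c (x 0) (x 1) = a := hxa 0
  have c1 : c (x 1) (x 2) = a := hxa 1
  have hne : x 1 ≠ v := by
    intro h
    apply haC'
    rw [← c0, h]
    exact (hinc (x 0)).1 (h ▸ e0)
  apply hrb
  by_cases hd : r v (x 1)
  · have hb := (hinc (x 1)).2 hd
    obtain ⟨y, hy, hyi, hyr, hyl⟩ := (hrob _ hb).1
    obtain ⟨z, hz, hzi, hzr, hzl⟩ := rainbow_snoc (c := c) hy hyi hyl hd (by rw [hyr]; simp)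
    obtain ⟨w, hw, hwi, -, -⟩ := rainbow_snoc (c := c) hz hzi hzl e1 (by
      rw [hzr, hyr, c1]
      rintro (h | h)
      · exact haC' (h ▸ hb)
      · exact haC' h.1)
    exact ⟨w, hw, hwi⟩
  · have hd' : r (x 1) v := (hT.2 _ _ hne).2 hd
    have hb := (hinc (x 1)).1 hd'
    obtain ⟨y, hy, hyi, hyr, hyl⟩ := (hrob _ hb).2
    obtain ⟨z, hz, hzi, hzr, hzl⟩ := rainbow_cons (c := c) hy hyi hyl hd' (by rw [hyr]; simp)
    obtain ⟨w, hw, hwi, -, -⟩ := rainbow_cons (c := c) hz hzi hzl e0 (by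
      rw [hzr, hyr, c0]
      rintro (h | h)
      · exact haC' (h ▸ hb)
      · exact haC' h.1)
    exact ⟨w, hw, hwi⟩
end

section
/- For every ε > 0 there exists a constant C_ε > 0 such that for all positive integers l and all k ≥ 2, t(l,k) ≤ max{ C_ε · k^3 · (log k)^{1+ε} · l^{k-2}, t(2,k) · (l/2)^{k-1} }. -/
section Main
set_option linter.unusedVariables false
open scoped Classical

/-- A directed walk inside `S` from a vertex to another with given colour list. -/
def WK {V α : Type} (r : V → V → Prop) (c : V → V → α) (S : Finset V) : V → List α → V → Prop
  | u, [], v => u = v ∧ u ∈ S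
  | u, a :: L, v => u ∈ S ∧ ∃ x, r u x ∧ c u x = a ∧ WK r c S x L v

/-- Totality of the relation and a bounded potential function for each colour. -/
structure Pot {V α : Type} (r : V → V → Prop) (c : V → V → α) (l : ℕ) : Prop where
  tot : ∀ u v, u ≠ v → r u v ∨ r v u
  pot : ∃ h : α → V → ℕ, (∀ d v, h d v < l) ∧ ∀ u v, r u v → h (c u v) u < h (c u v) v

/-- No rainbow of length `i` inside `S`. -/
def NoRb {V α : Type} (r : V → V → Prop) (c : V → V → α) (S : Finset V) (i : ℕ) : Prop :=
  ∀ u L v, WK r c S u L v → L.Nodup → L.length = i → False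

/-- In-robustness relative to an ambient set. -/
def Rob {V α : Type} (r : V → V → Prop) (c : V → V → α) (S : Finset V) (q : ℕ) (v : V) : Prop :=
  ∀ a, ∃ u L, WK r c S u L v ∧ L.Nodup ∧ L.length = q ∧ a ∉ L

/-- Colours out of `v` in `S`. -/
noncomputable def OutC {V α : Type} (r : V → V → Prop) (c : V → V → α) (S : Finset V) (v : V) :
    Finset α := (S.filter (fun w => r v w)).image (c v)

variable {V α : Type} {r : V → V → Prop} {c : V → V → α}

lemma mem_OutC {S : Finset V} {v w : V} (hw : w ∈ S) (h : r v w) : c v w ∈ OutC r c S v := by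
  unfold OutC
  exact Finset.mem_image.2 ⟨w, by simp [hw, h], rfl⟩

lemma exists_of_OutC {S : Finset V} {v : V} {a : α} (h : a ∈ OutC r c S v) :
    ∃ w ∈ S, r v w ∧ c v w = a := by
  unfold OutC at h
  obtain ⟨w, hw, rfl⟩ := Finset.mem_image.1 h
  simp only [Finset.mem_filter] at hw
  exact ⟨w, hw.1, hw.2, rfl⟩

lemma WK.right {S : Finset V} : ∀ {L : List α} {u v : V}, WK r c S u L v → v ∈ S
  | [], u, v, h => by obtain ⟨rfl, h⟩ := h; exact h
  | a :: L, u, v, h => by obtain ⟨_, x, _, _, h⟩ := h; exact WK.right h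

lemma WK.left {S : Finset V} : ∀ {L : List α} {u v : V}, WK r c S u L v → u ∈ S
  | [], u, v, h => h.2
  | a :: L, u, v, h => h.1

lemma WK.mono {S S' : Finset V} (hS : S ⊆ S') :
    ∀ {L : List α} {u v : V}, WK r c S u L v → WK r c S' u L v
  | [], u, v, h => ⟨h.1, hS h.2⟩
  | a :: L, u, v, h => by
    obtain ⟨h1, x, h2, h3, h⟩ := h
    exact ⟨hS h1, x, h2, h3, WK.mono hS h⟩

lemma WK.append {S : Finset V} : ∀ {L M : List α} {u v w : V}, WK r c S u L v → WK r c S v M w →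
    WK r c S u (L ++ M) w
  | [], M, u, v, w, h, h' => by obtain ⟨rfl, _⟩ := h; exact h'
  | a :: L, M, u, v, w, h, h' => by
    obtain ⟨h1, x, h2, h3, h⟩ := h
    exact ⟨h1, x, h2, h3, WK.append h h'⟩

lemma WK.split {S : Finset V} : ∀ {L M : List α} {u w : V}, WK r c S u (L ++ M) w →
    ∃ v, WK r c S u L v ∧ WK r c S v M w
  | [], M, u, w, h => ⟨u, ⟨rfl, WK.left h⟩, h⟩
  | a :: L, M, u, w, h => by
    obtain ⟨h1, x, h2, h3, h⟩ := h
    obtain ⟨v, h4, h5⟩ := WK.split h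
    exact ⟨v, ⟨h1, x, h2, h3, h4⟩, h5⟩

lemma WK.single {S : Finset V} {u v : V} (hu : u ∈ S) (hv : v ∈ S) (h : r u v) :
    WK r c S u [c u v] v := ⟨hu, v, h, rfl, rfl, hv⟩

lemma WK.all {S : Finset V} {p : α → Prop} (hp : ∀ u ∈ S, ∀ v ∈ S, r u v → p (c u v)) :
    ∀ {L : List α} {u v : V}, WK r c S u L v → ∀ a ∈ L, p a
  | [], u, v, h => by simp
  | a :: L, u, v, h => by
    obtain ⟨h1, x, h2, h3, h⟩ := h
    intro b hb
    rcases List.mem_cons.1 hb with rfl | hb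
    · rw [← h3]; exact hp _ h1 _ h.left h2
    · exact WK.all hp h b hb

lemma WK.rev {S : Finset V} : ∀ {L : List α} {u v : V}, WK r c S u L v →
    WK (fun x y => r y x) (fun x y => c y x) S v L.reverse u
  | [], u, v, h => by obtain ⟨rfl, h⟩ := h; exact ⟨rfl, h⟩
  | a :: L, u, v, h => by
    obtain ⟨h1, x, h2, h3, h⟩ := h
    rw [List.reverse_cons]
    refine (WK.rev h).append ?_
    exact ⟨h.left, u, h2, h3, rfl, h1⟩

lemma NoRb.rev {S : Finset V} {i : ℕ} (h : NoRb r c S i) :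
    NoRb (fun x y => r y x) (fun x y => c y x) S i := by
  intro u L v hw hn hl
  exact h v L.reverse u hw.rev (by simpa using hn) (by simpa using hl)

lemma Pot.rev {l : ℕ} (h : Pot r c l) : Pot (fun x y => r y x) (fun x y => c y x) l := by
  refine ⟨fun u v huv => (h.tot u v huv).symm, ?_⟩
  obtain ⟨f, hf, hf'⟩ := h.pot
  refine ⟨fun d v => l - 1 - f d v, fun d v => ?_, fun u v huv => ?_⟩
  · have := hf d v
    show l - 1 - f d v < l
    omega
  · have := hf' v u huv
    have := hf (c v u) u
    have := hf (c v u) v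
    show l - 1 - f (c v u) u < l - 1 - f (c v u) v
    omega

lemma prune {l : ℕ} (hP : Pot r c l) (D : Finset α) (S : Finset V) (M : ℝ)
    (hM : ∀ S' ⊆ S, (∀ u ∈ S', ∀ v ∈ S', r u v → c u v ∉ D) → (S'.card : ℝ) ≤ M) :
    (S.card : ℝ) ≤ (l : ℝ) ^ D.card * M := by
  obtain ⟨h, hh, hinc⟩ := hP.pot
  let F : V → (D → Fin l) := fun v d => ⟨h d v, hh d v⟩
  have h1 : S.card = ∑ b ∈ (Finset.univ : Finset (D → Fin l)), (S.filter (fun a => F a = b)).card :=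
    Finset.card_eq_sum_card_fiberwise (fun a _ => Finset.mem_coe.2 (Finset.mem_univ _))
  rw [h1]
  push_cast
  calc _ ≤ ∑ b ∈ (Finset.univ : Finset (D → Fin l)), M := by
        refine Finset.sum_le_sum fun b _ => hM _ (Finset.filter_subset _ _) ?_
        intro u hu v hv huv hD
        simp only [Finset.mem_filter] at hu hv
        have h2 := hinc u v huv
        have h3 : F u ⟨_, hD⟩ = F v ⟨_, hD⟩ := by rw [hu.2, hv.2]
        have h4 := congrArg Fin.val h3
        simp only [F] at h4
        omega
    _ = _ := by simp

lemma card_le_one_of_noedge {l : ℕ} (hP : Pot r c l) (S : Finset V)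
    (h : ∀ u ∈ S, ∀ v ∈ S, ¬ r u v) : S.card ≤ 1 := by
  refine Finset.card_le_one.2 fun a ha b hb => ?_
  by_contra hab
  rcases hP.tot a b hab with h1 | h1
  · exact h _ ha _ hb h1
  · exact h _ hb _ ha h1

lemma few {l : ℕ} (hP : Pot r c l) (D : Finset α) (S : Finset V)
    (h : ∀ u ∈ S, ∀ v ∈ S, r u v → c u v ∈ D) : (S.card : ℝ) ≤ (l : ℝ) ^ D.card := by
  have := prune hP D S 1 (fun S' hS' h' => by
    have := card_le_one_of_noedge hP S' (fun u hu v hv huv => h' u hu v hv huv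
      (h u (hS' hu) v (hS' hv) huv))
    exact_mod_cast this)
  simpa using this

lemma maxdeg {l : ℕ} (hP : Pot r c l) (S : Finset V) (hS : S.Nonempty) :
    ∃ v ∈ S, S.card ≤ 1 + 2 * (S.filter (fun w => r v w)).card := by
  by_contra! hcon
  have h1 : ∀ v ∈ S, S.card ≤ 1 + (S.filter (fun w => r v w)).card +
      (S.filter (fun w => r w v)).card := by
    intro v hv
    have : S ⊆ {v} ∪ (S.filter (fun w => r v w)) ∪ (S.filter (fun w => r w v)) := by
      intro w hw
      simp only [Finset.mem_union, Finset.mem_singleton, Finset.mem_filter]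
      by_cases hwv : w = v
      · simp [hwv]
      · rcases hP.tot w v hwv with h | h <;> simp [hw, h]
    calc S.card ≤ _ := Finset.card_le_card this
      _ ≤ _ := Finset.card_union_le _ _
      _ ≤ _ := by
        gcongr
        refine (Finset.card_union_le _ _).trans ?_
        simp
  have h2 : ∑ v ∈ S, (S.filter (fun w => r v w)).card = ∑ v ∈ S, (S.filter (fun w => r w v)).card :=
    Finset.sum_card_bipartiteAbove_eq_sum_card_bipartiteBelow r
  have h3 := Finset.sum_le_sum h1
  have h4 := Finset.sum_lt_sum_of_nonempty hS hcon
  simp only [Finset.sum_add_distrib, ← Finset.mul_sum] at h3 h4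
  omega

lemma popular {l : ℕ} (hP : Pot r c l) (S N : Finset V) (hN : N ⊆ S) (hS : N.Nonempty) (m : ℕ)
    (hm : ∀ v ∈ N, (OutC r c S v).card ≤ m) :
    ∃ v ∈ N, ∃ a, (N.card : ℝ) ≤ 1 + 2 * m * (N.filter (fun w => r v w ∧ c v w = a)).card := by
  obtain ⟨v, hv, h⟩ := maxdeg hP N hS
  refine ⟨v, hv, ?_⟩
  by_contra! hcon
  have h1 : (N.filter (fun w => r v w)).card =
      ∑ a ∈ OutC r c S v, ((N.filter (fun w => r v w)).filter (fun w => c v w = a)).card := by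
    refine Finset.card_eq_sum_card_fiberwise ?_
    intro w hw
    simp only [Finset.coe_filter, Set.mem_ofPred_eq] at hw
    exact mem_OutC (hN hw.1) hw.2
  simp only [Finset.filter_filter] at h1
  by_cases hm0 : (OutC r c S v).card = 0
  · have h0 : (N.filter (fun w => r v w)).card = 0 := by
      rw [h1, Finset.card_eq_zero.1 hm0]; simp
    have := hcon (c v v)
    have h5 : N.card ≤ 1 := by omega
    have h6 : (N.card : ℝ) ≤ 1 := by exact_mod_cast h5
    have : (0:ℝ) ≤ 2 * m * (N.filter (fun w => r v w ∧ c v w = c v v)).card := by positivity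
    linarith
  · have hne : (OutC r c S v).Nonempty := Finset.card_pos.1 (by omega)
    obtain ⟨a, ha, hmax⟩ := Finset.exists_max_image (OutC r c S v)
      (fun a => (N.filter (fun w => r v w ∧ c v w = a)).card) hne
    have h2 : (N.filter (fun w => r v w)).card ≤
        m * (N.filter (fun w => r v w ∧ c v w = a)).card := by
      rw [h1]
      refine (Finset.sum_le_card_nsmul _ _ _ hmax).trans ?_
      rw [smul_eq_mul]
      exact Nat.mul_le_mul_right _ (hm v hv)
    have h3 := hcon a
    have h4 : N.card ≤ 1 + 2 * (m * (N.filter (fun w => r v w ∧ c v w = a)).card) := by omega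
    have h5 : (N.card : ℝ) ≤ 1 + 2 * (m * (N.filter (fun w => r v w ∧ c v w = a)).card) := by
      exact_mod_cast h4
    linarith

lemma Rob.mono {S : Finset V} {q : ℕ} {v : V} (h : Rob r c S (q + 1) v) : Rob r c S q v := by
  intro a
  obtain ⟨u, L, h1, h2, h3, h4⟩ := h a
  cases L with
  | nil => simp at h3
  | cons b L =>
    obtain ⟨_, x, _, _, h⟩ := h1
    refine ⟨x, L, h, (List.nodup_cons.1 h2).2, by simpa using h3, fun hh => h4 ?_⟩
    exact List.mem_cons_of_mem _ hh

lemma gbound {l : ℕ} (hl : 2 ≤ l) (hP : Pot r c l) (S : Finset V) (m q : ℕ) (κ : ℝ) (hκ : 0 ≤ κ)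
    (hB : ∀ i, 1 ≤ i → i ≤ q → ∀ S', NoRb r c S' i → (S'.card : ℝ) ≤ κ * (l : ℝ) ^ (i - 1)) :
    ∀ j, j ≤ q → ∀ N ⊆ S, (∀ v ∈ N, ¬ Rob r c S j v) → (∀ v ∈ N, (OutC r c S v).card ≤ m) →
      (N.card : ℝ) ≤ 2 * (1 + 2 * m * q * κ) * (l : ℝ) ^ j := by
  intro j
  induction j with
  | zero =>
    intro _ N hN hR _
    have : N = ∅ := by
      refine Finset.eq_empty_of_forall_notMem fun v hv => hR v hv ?_
      intro a
      exact ⟨v, [], ⟨rfl, hN hv⟩, by simp, rfl, by simp⟩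
    rw [this]
    simp only [Finset.card_empty, Nat.cast_zero]
    positivity
  | succ j ih =>
    intro hj N hN hR hm
    have hl' : (2:ℝ) ≤ l := by exact_mod_cast hl
    set N1 := N.filter (fun v => Rob r c S j v) with hN1
    set N2 := N.filter (fun v => ¬ Rob r c S j v) with hN2
    have hcard : N1.card + N2.card = N.card := Finset.card_filter_add_card_filter_not _
    have h2 : (N2.card : ℝ) ≤ 2 * (1 + 2 * m * q * κ) * (l : ℝ) ^ j := by
      refine ih (by omega) N2 ((Finset.filter_subset _ _).trans hN) ?_ ?_
      · intro v hv; exact (Finset.mem_filter.1 hv).2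
      · intro v hv; exact hm v (Finset.mem_filter.1 hv).1
    have h1 : (N1.card : ℝ) ≤ (1 + 2 * m * q * κ) * (l : ℝ) ^ (j + 1) := by
      rcases N1.eq_empty_or_nonempty with h0 | hne
      · rw [h0]; simp only [Finset.card_empty, Nat.cast_zero]; positivity
      have hN1S : N1 ⊆ S := (Finset.filter_subset _ _).trans hN
      obtain ⟨v, hv, a, hpop⟩ := popular hP S N1 hN1S hne m
        (fun v hv => hm v (Finset.mem_filter.1 hv).1)
      set P := N1.filter (fun w => r v w ∧ c v w = a) with hPdef
      obtain ⟨u, L, hL1, hL2, hL3, hL4⟩ := (Finset.mem_filter.1 hv).2 a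
      set C := L ++ [a] with hC
      have hClen : C.length = j + 1 := by simp [hC, hL3]
      have hCnd : C.Nodup := by
        rw [hC, List.nodup_append]
        simp only [List.nodup_cons, List.mem_singleton, hL2, true_and]
        simp
        intro b hb hba; exact hL4 (hba ▸ hb)
      have hCw : ∀ w ∈ P, WK r c S u C w := by
        intro w hw
        obtain ⟨hw1, hw2, hw3⟩ := Finset.mem_filter.1 hw
        refine hL1.append ?_
        rw [← hw3]
        exact WK.single hL1.right (hN1S hw1) hw2
      have hex : ∀ w ∈ P, ∃ b, ∀ u L, WK r c S u L w → L.Nodup → L.length = j + 1 → b ∈ L := by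
        intro w hw
        have := hR w (Finset.mem_filter.1 (Finset.mem_filter.1 hw).1).1
        unfold Rob at this
        push Not at this
        exact this
      have hcov : P ⊆ (Finset.univ : Finset (Fin (j + 1))).biUnion (fun i =>
          P.filter (fun w => ∀ u L, WK r c S u L w → L.Nodup → L.length = j + 1 →
            C[i.1]'(by omega) ∈ L)) := by
        intro w hw
        obtain ⟨b, hb⟩ := hex w hw
        have hbC := hb u C (hCw w hw) hCnd hClen
        obtain ⟨i, hi, rfl⟩ := List.getElem_of_mem hbC
        simp only [Finset.mem_biUnion, Finset.mem_univ, true_and, Finset.mem_filter]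
        exact ⟨⟨i, by omega⟩, hw, hb⟩
      have hpiece : ∀ i : Fin (j + 1), ((P.filter (fun w => ∀ u L, WK r c S u L w → L.Nodup →
          L.length = j + 1 → C[i.1]'(by omega) ∈ L)).card : ℝ) ≤ κ * (l : ℝ) ^ (j + 1) := by
        rintro ⟨i, hi⟩
        have hD : ((C.drop i).toFinset).card ≤ j + 1 - i := by
          refine (List.toFinset_card_le _).trans ?_
          simp [hClen]
        have := prune hP (C.drop i).toFinset (P.filter (fun w => ∀ u L, WK r c S u L w → L.Nodup →
          L.length = j + 1 → C[i]'(by omega) ∈ L)) (κ * (l : ℝ) ^ i) (by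
            intro S' hS' hedge
            have := hB (i + 1) (by omega) (by omega) S' (by
              intro x M y hw hnd hlen
              have hx := Finset.mem_filter.1 (hS' hw.left)
              have hy := Finset.mem_filter.1 (hS' hw.right)
              have hMD : ∀ b ∈ M, b ∉ (C.drop i).toFinset := WK.all (p := fun b => b ∉ (C.drop i).toFinset) hedge hw
              have hCx := hCw x hx.1
              rw [← List.take_append_drop (i + 1) C] at hCx
              obtain ⟨z, _, hz⟩ := hCx.split
              have hS'S : S' ⊆ S := fun s hs =>
                hN1S (Finset.mem_filter.1 (Finset.mem_filter.1 (hS' hs)).1).1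
              have hwalk := hz.append (hw.mono hS'S)
              have hdrop : C.drop i = C[i]'(by omega) :: C.drop (i + 1) :=
                List.drop_eq_getElem_cons (by omega)
              have hnd2 : (C.drop i).Nodup := hCnd.sublist (List.drop_sublist _ _)
              have hnd3 := hnd2
              rw [hdrop, List.nodup_cons] at hnd3
              have hmem := hy.2 z _ hwalk (by
                rw [List.nodup_append]
                refine ⟨hnd3.2, hnd, ?_⟩
                intro b hb d hd hbd
                subst hbd
                refine hMD b hd ?_
                rw [List.mem_toFinset, hdrop]
                exact List.mem_cons_of_mem _ hb) (by simp [hClen, hlen]; omega)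
              rcases List.mem_append.1 hmem with hmem | hmem
              · exact hnd3.1 hmem
              · refine hMD _ hmem ?_
                rw [List.mem_toFinset, hdrop]
                exact List.mem_cons_self)
            simpa using this)
        refine this.trans ?_
        have e : (l:ℝ) ^ (j + 1) = (l:ℝ) ^ (j + 1 - i) * (l:ℝ) ^ i := by
          rw [← pow_add]; congr 1; omega
        have : (l:ℝ) ^ ((C.drop i).toFinset).card ≤ (l:ℝ) ^ (j + 1 - i) :=
          pow_le_pow_right₀ (by linarith) hD
        calc _ ≤ (l:ℝ) ^ (j + 1 - i) * (κ * (l:ℝ) ^ i) := by gcongr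
          _ = _ := by rw [e]; ring
      have hPc : (P.card : ℝ) ≤ (j + 1) * (κ * (l : ℝ) ^ (j + 1)) := by
        have h5 := (Finset.card_le_card hcov).trans Finset.card_biUnion_le
        have h6 : (P.card : ℝ) ≤ ∑ i : Fin (j + 1), ((P.filter (fun w => ∀ u L, WK r c S u L w →
          L.Nodup → L.length = j + 1 → C[i.1]'(by omega) ∈ L)).card : ℝ) := by exact_mod_cast h5
        refine h6.trans ((Finset.sum_le_sum fun i _ => hpiece i).trans ?_)
        simp
      have hjq : ((j:ℝ) + 1) ≤ q := by exact_mod_cast hj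
      have hone : (1:ℝ) ≤ (l:ℝ) ^ (j + 1) := one_le_pow₀ (by linarith)
      calc (N1.card : ℝ) ≤ 1 + 2 * m * P.card := hpop
        _ ≤ 1 + 2 * m * (q * (κ * (l : ℝ) ^ (j + 1))) := by
          gcongr
          exact hPc.trans (by gcongr)
        _ ≤ (l:ℝ) ^ (j + 1) + 2 * m * (q * (κ * (l : ℝ) ^ (j + 1))) := by gcongr
        _ = _ := by ring
    have h3 : (N.card : ℝ) = N1.card + N2.card := by exact_mod_cast hcard.symm
    have h4 : 2 * (l:ℝ) ^ j ≤ (l:ℝ) ^ (j + 1) := by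
      rw [pow_succ]; nlinarith [pow_pos (show (0:ℝ) < l by linarith) j]
    have hX : 0 ≤ (1 + 2 * m * q * κ) := by positivity
    nlinarith [mul_le_mul_of_nonneg_left h4 hX]

lemma v0bound {S : Finset V} {k : ℕ} (hk : 1 ≤ k) (hS : NoRb r c S k) :
    NoRb r c (S.filter (fun v => ¬ (OutC r c S v).card ≤ k - 1)) (k - 1) := by
  intro u L v hw hnd hlen
  have hv := Finset.mem_filter.1 hw.right
  have h1 : L.toFinset.card ≤ k - 1 := (List.toFinset_card_le _).trans hlen.le
  obtain ⟨a, ha, haL⟩ := Finset.exists_mem_notMem_of_card_lt_card (s := L.toFinset)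
    (t := OutC r c S v) (by omega)
  obtain ⟨w, hw1, hw2, rfl⟩ := exists_of_OutC ha
  refine hS u (L ++ [c v w]) w ((hw.mono (Finset.filter_subset _ _)).append
    (WK.single hv.1 hw1 hw2)) ?_ (by simp [hlen]; omega)
  rw [List.nodup_append]
  refine ⟨hnd, by simp, ?_⟩
  intro b hb d hd hbd
  simp only [List.mem_singleton] at hd
  subst hbd; subst hd
  exact haL (by simpa using hb)

lemma recur {l : ℕ} (hl : 2 ≤ l) (hP : Pot r c l) (S : Finset V) (k q s : ℕ) (hs : 1 ≤ s)
    (hqs : q + 1 + s = k) (κ κs : ℝ) (hκ : 0 ≤ κ)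
    (hB : ∀ i, 1 ≤ i → i ≤ k - 1 → ∀ S', NoRb r c S' i → (S'.card : ℝ) ≤ κ * (l : ℝ) ^ (i - 1))
    (hBs : ∀ S', NoRb r c S' s → (S'.card : ℝ) ≤ κs * (l : ℝ) ^ (s - 1)) (hκs : 0 ≤ κs)
    (hS : NoRb r c S k) :
    (S.card : ℝ) ≤ κ * (l : ℝ) ^ (k - 2) + 2 * (1 + 2 * (k - 1 : ℕ) * q * κ) * (l : ℝ) ^ q + 1
      + 2 * (k - 1 : ℕ) * κs * (l : ℝ) ^ (k - 1) := by
  have hl' : (2:ℝ) ≤ l := by exact_mod_cast hl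
  set V0 := S.filter (fun v => ¬ (OutC r c S v).card ≤ k - 1) with hV0
  set V1 := S.filter (fun v => (OutC r c S v).card ≤ k - 1) with hV1
  have hc1 : V1.card + V0.card = S.card := Finset.card_filter_add_card_filter_not _
  have h0 : (V0.card : ℝ) ≤ κ * (l : ℝ) ^ (k - 2) :=
    hB (k - 1) (by omega) (by omega) _ (v0bound (by omega) hS)
  set N := V1.filter (fun v => ¬ Rob r c S q v) with hN
  set Q := V1.filter (fun v => Rob r c S q v) with hQ
  have hc2 : Q.card + N.card = V1.card := Finset.card_filter_add_card_filter_not _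
  have h1 : (N.card : ℝ) ≤ 2 * (1 + 2 * (k - 1 : ℕ) * q * κ) * (l : ℝ) ^ q := by
    refine gbound hl hP S (k - 1) q κ hκ (fun i hi hi' => hB i hi (by omega)) q le_rfl N
      ((Finset.filter_subset _ _).trans (Finset.filter_subset _ _)) ?_ ?_
    · intro v hv; exact (Finset.mem_filter.1 hv).2
    · intro v hv; exact (Finset.mem_filter.1 (Finset.mem_filter.1 hv).1).2
  have h2 : (Q.card : ℝ) ≤ 1 + 2 * (k - 1 : ℕ) * κs * (l : ℝ) ^ (k - 1) := by
    rcases Q.eq_empty_or_nonempty with h0 | hne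
    · rw [h0]; simp only [Finset.card_empty, Nat.cast_zero]; positivity
    have hQS : Q ⊆ S := (Finset.filter_subset _ _).trans (Finset.filter_subset _ _)
    obtain ⟨v, hv, a, hpop⟩ := popular hP S Q hQS hne (k - 1)
      (fun v hv => (Finset.mem_filter.1 (Finset.mem_filter.1 hv).1).2)
    set P := Q.filter (fun w => r v w ∧ c v w = a) with hPdef
    obtain ⟨u, L, hL1, hL2, hL3, hL4⟩ := (Finset.mem_filter.1 hv).2 a
    set C := L ++ [a] with hC
    have hClen : C.length = q + 1 := by simp [hC, hL3]
    have hCnd : C.Nodup := by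
      rw [hC, List.nodup_append]
      simp only [List.nodup_cons, List.mem_singleton, hL2, true_and]
      simp
      intro b hb hba; exact hL4 (hba ▸ hb)
    have hCw : ∀ w ∈ P, WK r c S u C w := by
      intro w hw
      obtain ⟨hw1, hw2, hw3⟩ := Finset.mem_filter.1 hw
      refine hL1.append ?_
      rw [← hw3]
      exact WK.single hL1.right (hQS hw1) hw2
    have hPS : P ⊆ S := (Finset.filter_subset _ _).trans hQS
    have := prune hP C.toFinset P (κs * (l:ℝ) ^ (s - 1)) (by
      intro S' hS' hedge
      refine hBs S' ?_
      intro x M y hw hnd hlen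
      refine hS u (C ++ M) y ((hCw x (hS' hw.left)).append (hw.mono (hS'.trans hPS))) ?_ ?_
      · rw [List.nodup_append]
        refine ⟨hCnd, hnd, ?_⟩
        intro b hb d hd hbd
        subst hbd
        exact WK.all (p := fun b => b ∉ C.toFinset) hedge hw b hd (by simpa using hb)
      · rw [List.length_append, hClen, hlen]; omega)
    have hP2 : (P.card : ℝ) ≤ κs * (l:ℝ) ^ (k - 1) := by
      rw [List.toFinset_card_of_nodup hCnd, hClen] at this
      refine this.trans (le_of_eq ?_)
      have e : (l:ℝ) ^ (k - 1) = (l:ℝ) ^ (q + 1) * (l:ℝ) ^ (s - 1) := by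
        rw [← pow_add]; congr 1; omega
      rw [e]; ring
    calc (Q.card : ℝ) ≤ 1 + 2 * (k - 1 : ℕ) * P.card := hpop
      _ ≤ 1 + 2 * (k - 1 : ℕ) * (κs * (l:ℝ) ^ (k - 1)) := by gcongr
      _ = _ := by ring
  have h3 : (S.card : ℝ) = Q.card + N.card + V0.card := by
    exact_mod_cast (by omega : S.card = Q.card + N.card + V0.card)
  linarith

lemma card_le_of_noRb_one {l : ℕ} (hP : Pot r c l) (S : Finset V) (h : NoRb r c S 1) :
    S.card ≤ 1 := by
  refine card_le_one_of_noedge hP S fun u hu v hv huv => ?_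
  exact h u [c u v] v (WK.single hu hv huv) (by simp) rfl

/-- Crude constants. -/
noncomputable def crudeB (k : ℕ) : ℝ := 10 ^ k * (k.factorial : ℝ) ^ 2

lemma crudeB_mono {i k : ℕ} (h : i ≤ k) : crudeB i ≤ crudeB k := by
  unfold crudeB
  have : (i.factorial : ℝ) ≤ k.factorial := by exact_mod_cast Nat.factorial_le h
  have : (10:ℝ) ^ i ≤ 10 ^ k := pow_le_pow_right₀ (by norm_num) h
  gcongr

lemma one_le_crudeB (k : ℕ) : 1 ≤ crudeB k := by
  have := crudeB_mono (Nat.zero_le k)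
  simpa [crudeB] using this

lemma crudeB_succ (k : ℕ) : crudeB (k + 1) = crudeB k * (10 * ((k:ℝ) + 1) ^ 2) := by
  unfold crudeB
  rw [Nat.factorial_succ]
  push_cast
  ring

lemma crude {l : ℕ} (hl : 2 ≤ l) (hP : Pot r c l) : ∀ k, 1 ≤ k → ∀ S, NoRb r c S k →
    (S.card : ℝ) ≤ crudeB k * (l : ℝ) ^ (k - 1) := by
  have hl' : (2:ℝ) ≤ l := by exact_mod_cast hl
  intro k
  induction k using Nat.strong_induction_on with
  | _ k ih =>
    intro hk S hS
    rcases Nat.lt_or_ge k 2 with h2 | h2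
    · obtain rfl : k = 1 := by omega
      have h1 : (S.card : ℝ) ≤ 1 := by exact_mod_cast card_le_of_noRb_one hP S hS
      simpa using h1.trans (one_le_crudeB 1)
    obtain ⟨j, rfl⟩ : ∃ j, k = j + 2 := ⟨k - 2, by omega⟩
    have hκ := one_le_crudeB (j + 1)
    have := recur hl hP S (j + 2) j 1 le_rfl (by omega) (crudeB (j + 1)) 1 (by linarith)
      (by
        intro i hi hi' S' hS'
        refine (ih i (by omega) hi S' hS').trans ?_
        have := crudeB_mono (show i ≤ j + 1 by omega)
        gcongr)
      (by
        intro S' hS'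
        have h1 : (S'.card : ℝ) ≤ 1 := by exact_mod_cast card_le_of_noRb_one hP S' hS'
        simpa using h1) zero_le_one hS
    refine this.trans ?_
    rw [crudeB_succ (j + 1)]
    generalize crudeB (j + 1) = κ at hκ
    simp only [show j + 2 - 2 = j by omega, show j + 2 - 1 = j + 1 by omega]
    have e : (l:ℝ) ^ j ≤ (l:ℝ) ^ (j + 1) := pow_le_pow_right₀ (by linarith) (by omega)
    have e1 : 1 ≤ (l:ℝ) ^ (j + 1) := one_le_pow₀ (by linarith)
    push_cast
    calc κ * (l:ℝ) ^ j + 2 * (1 + 2 * ((j:ℝ) + 1) * j * κ) * (l:ℝ) ^ j + 1 +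
          2 * ((j:ℝ) + 1) * 1 * (l:ℝ) ^ (j + 1)
        ≤ κ * (l:ℝ) ^ (j+1) + 2 * (1 + 2 * ((j:ℝ) + 1) * j * κ) * (l:ℝ) ^ (j+1) + (l:ℝ) ^ (j+1) +
          2 * ((j:ℝ) + 1) * 1 * (l:ℝ) ^ (j + 1) := by gcongr
      _ = (κ + 2 * (1 + 2 * ((j:ℝ) + 1) * j * κ) + 1 + 2 * ((j:ℝ) + 1)) * (l:ℝ) ^ (j+1) := by ring
      _ ≤ _ := by
        gcongr
        have hj : (0:ℝ) ≤ j := by positivity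
        nlinarith [mul_nonneg hj (by linarith : 0 ≤ κ - 1), mul_nonneg hj (by linarith : 0 ≤ κ),
          mul_nonneg (mul_nonneg hj hj) (by linarith : 0 ≤ κ)]

open Filter in
lemma ev_num (ε : ℝ) (hε : 0 < ε) : ∃ k0 : ℕ, 8 ≤ k0 ∧ ∀ k : ℕ, k0 ≤ k →
    2 * Nat.log 2 k + 7 + 1 ≤ k ∧
    8 * ((2 * Nat.log 2 k + 7 : ℕ) : ℝ) * (1 + Real.log ((2 * Nat.log 2 k + 7 : ℕ) : ℝ)) ^ (1 + ε)
      ≤ (1 + Real.log k) ^ (1 + ε) := by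
  set η := ε / (2 * (1 + ε)) with hη
  have hη0 : 0 < η := by positivity
  have h1 : ∀ᶠ x : ℝ in atTop, Real.log x ≤ (1/2) * x ^ η := by
    have := (isLittleO_log_rpow_atTop hη0).bound (show (0:ℝ) < 1/2 by norm_num)
    filter_upwards [this, eventually_ge_atTop 1] with x hx hx1
    rw [Real.norm_of_nonneg (Real.log_nonneg hx1), Real.norm_of_nonneg (by positivity)] at hx
    exact hx
  have h2 : ∀ᶠ x : ℝ in atTop, 6 ≤ x ^ η := (tendsto_rpow_atTop hη0).eventually_ge_atTop 6
  have h3 : ∀ᶠ x : ℝ in atTop, 56 ≤ x ^ (ε/2) :=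
    (tendsto_rpow_atTop (by positivity)).eventually_ge_atTop 56
  have h4 : ∀ᶠ x : ℝ in atTop, 56 * x * (3 + Real.log x) ^ (1 + ε) ≤ x ^ (1 + ε) := by
    filter_upwards [h1, h2, h3, eventually_ge_atTop 1] with x h1 h2 h3 hx1
    have hx0 : 0 < x := by linarith
    have hlog := Real.log_nonneg hx1
    have h5 : 3 + Real.log x ≤ x ^ η := by linarith
    have h6 : (3 + Real.log x) ^ (1 + ε) ≤ x ^ (ε / 2) := by
      calc (3 + Real.log x) ^ (1 + ε) ≤ (x ^ η) ^ (1 + ε) :=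
            Real.rpow_le_rpow (by linarith) h5 (by linarith)
        _ = x ^ (ε / 2) := by
            rw [← Real.rpow_mul hx0.le]
            congr 1
            rw [hη]; field_simp
    calc 56 * x * (3 + Real.log x) ^ (1 + ε) ≤ x ^ (ε/2) * x * x ^ (ε/2) := by gcongr
      _ = x ^ (1 + ε) := by
        rw [show 1 + ε = ε/2 + 1 + ε/2 by ring, Real.rpow_add hx0, Real.rpow_add hx0,
          Real.rpow_one]
  have hlogt : Tendsto (fun k : ℕ => 1 + Real.log (k:ℝ)) atTop atTop :=
    tendsto_atTop_add_const_left _ _ (Real.tendsto_log_atTop.comp tendsto_natCast_atTop_atTop)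
  have h5 := hlogt.eventually h4
  have h6 : ∀ᶠ k : ℕ in atTop, 8 * (1 + Real.log (k:ℝ)) ≤ k := by
    have := Real.isLittleO_log_id_atTop.bound (show (0:ℝ) < 1/16 by norm_num)
    have h7 : ∀ᶠ x : ℝ in atTop, 8 * (1 + Real.log x) ≤ x := by
      filter_upwards [this, eventually_ge_atTop 16] with x hx hx1
      rw [Real.norm_of_nonneg (Real.log_nonneg (by linarith)), id,
        Real.norm_of_nonneg (by linarith)] at hx
      linarith
    exact tendsto_natCast_atTop_atTop.eventually h7
  obtain ⟨k0, hk0⟩ := eventually_atTop.1 (h5.and h6)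
  refine ⟨max k0 8, le_max_right _ _, fun k hk => ?_⟩
  obtain ⟨h5, h6⟩ := hk0 k ((le_max_left _ _).trans hk)
  have hk8 : 8 ≤ k := (le_max_right _ _).trans hk
  have hkR : (8:ℝ) ≤ k := by exact_mod_cast hk8
  have hlogk : 0 ≤ Real.log k := Real.log_nonneg (by linarith)
  have hl2 : (Nat.log 2 k : ℝ) ≤ 2 * Real.log k := by
    have h8 : ((2:ℝ)) ^ (Nat.log 2 k) ≤ k := by
      exact_mod_cast Nat.pow_log_le_self 2 (by omega)
    have h9 := Real.log_le_log (by positivity) h8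
    rw [Real.log_pow] at h9
    have := Real.log_two_gt_d9
    have h10 : (0:ℝ) ≤ (Nat.log 2 k : ℝ) := by positivity
    nlinarith
  set s := 2 * Nat.log 2 k + 7 with hs
  have hsR : (s:ℝ) ≤ 7 * (1 + Real.log k) := by
    rw [hs]; push_cast; linarith
  have hs7 : (7:ℝ) ≤ s := by rw [hs]; push_cast; have : (0:ℝ) ≤ (Nat.log 2 k : ℝ) := by positivity
                             linarith
  constructor
  · have : (s:ℝ) + 1 ≤ k := by linarith
    exact_mod_cast this
  · have hlogs : 1 + Real.log s ≤ 3 + Real.log (1 + Real.log k) := by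
      have h11 := Real.log_le_log (by linarith) hsR
      rw [Real.log_mul (by norm_num) (by linarith)] at h11
      have h12 : Real.log 7 ≤ 2 := by
        rw [Real.log_le_iff_le_exp (by norm_num)]
        have h13 := Real.exp_one_gt_d9
        have : Real.exp 2 = Real.exp 1 * Real.exp 1 := by rw [← Real.exp_add]; norm_num
        rw [this]; nlinarith
      linarith
    have hls : 0 ≤ Real.log s := Real.log_nonneg (by linarith)
    refine le_trans ?_ h5
    have h14 : (1 + Real.log s) ^ (1 + ε) ≤ (3 + Real.log (1 + Real.log k)) ^ (1 + ε) :=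
      Real.rpow_le_rpow (by linarith) hlogs (by linarith)
    have : 0 ≤ (1 + Real.log s) ^ (1 + ε) := by positivity
    calc 8 * (s:ℝ) * (1 + Real.log s) ^ (1 + ε)
        ≤ 8 * (7 * (1 + Real.log k)) * (3 + Real.log (1 + Real.log k)) ^ (1 + ε) := by gcongr
      _ = _ := by ring

/-- The growth function. -/
noncomputable def phi (ε : ℝ) (k : ℕ) : ℝ := k * (1 + Real.log k) ^ (1 + ε)

lemma phi_mono {ε : ℝ} (hε : 0 < ε) {i k : ℕ} (hi : 1 ≤ i) (h : i ≤ k) : phi ε i ≤ phi ε k := by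
  unfold phi
  have h1 : (1:ℝ) ≤ i := by exact_mod_cast hi
  have h2 : (i:ℝ) ≤ k := by exact_mod_cast h
  have h3 := Real.log_nonneg h1
  have h4 := Real.log_le_log (by linarith) h2
  have h5 : (1 + Real.log i) ^ (1 + ε) ≤ (1 + Real.log k) ^ (1 + ε) :=
    Real.rpow_le_rpow (by linarith) (by linarith) (by linarith)
  have : 0 ≤ (1 + Real.log i) ^ (1 + ε) := by positivity
  gcongr

lemma le_phi {ε : ℝ} (hε : 0 < ε) {k : ℕ} (hk : 1 ≤ k) : (k:ℝ) ≤ phi ε k := by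
  unfold phi
  have h1 : (1:ℝ) ≤ k := by exact_mod_cast hk
  have h3 := Real.log_nonneg h1
  have : 1 ≤ (1 + Real.log k) ^ (1 + ε) := Real.one_le_rpow (by linarith) (by linarith)
  nlinarith

lemma mainBound (ε : ℝ) (hε : 0 < ε) : ∃ κ : ℝ, 1 ≤ κ ∧ ∀ (V α : Type) (r : V → V → Prop)
    (c : V → V → α) (l : ℕ), 2 ≤ l → Pot r c l → ∀ k, 1 ≤ k → ∀ S, NoRb r c S k →
      (S.card : ℝ) ≤ κ * phi ε k * (l : ℝ) ^ (k - 1) := by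
  obtain ⟨k0, hk0, hev⟩ := ev_num ε hε
  refine ⟨crudeB k0, one_le_crudeB k0, ?_⟩
  intro V α r c l hl hP k
  have hκ := one_le_crudeB k0
  have hl' : (2:ℝ) ≤ l := by exact_mod_cast hl
  induction k using Nat.strong_induction_on with
  | _ k ih =>
    intro hk S hS
    have hphi1 : 1 ≤ phi ε k := le_trans (by exact_mod_cast hk) (le_phi hε hk)
    rcases Nat.lt_or_ge k k0 with hlt | hge
    · refine (crude hl hP k hk S hS).trans ?_
      have h1 := crudeB_mono hlt.le
      have h2 : crudeB k ≤ crudeB k0 * phi ε k := by nlinarith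
      gcongr
    obtain ⟨hs1, hs2⟩ := hev k hge
    have hpow : 32 * (k:ℝ) ^ 2 ≤ 2 ^ (2 * Nat.log 2 k + 7) := by
      have h1 : k < 2 ^ (Nat.log 2 k + 1) := Nat.lt_pow_succ_log_self (by norm_num) k
      have h2 : (k:ℝ) ≤ 2 ^ (Nat.log 2 k + 1) := by exact_mod_cast h1.le
      calc 32 * (k:ℝ) ^ 2 ≤ 32 * (2 ^ (Nat.log 2 k + 1)) ^ 2 := by gcongr
        _ = _ := by rw [← pow_mul, show 2 * Nat.log 2 k + 7 = (Nat.log 2 k + 1) * 2 + 5 by ring,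
                      pow_add (2:ℝ) _ 5]; ring
    set s := 2 * Nat.log 2 k + 7 with hs
    set q := k - 1 - s with hq
    have hrec := recur hl hP S k q s (by omega) (by omega) (crudeB k0 * phi ε k)
      (crudeB k0 * phi ε s) (by positivity)
      (by
        intro i hi hi' S' hS'
        refine (ih i (by omega) hi S' hS').trans ?_
        have := phi_mono hε hi (show i ≤ k by omega)
        gcongr)
      (fun S' hS' => ih s (by omega) (by omega) S' hS')
      (by
        have : (s:ℝ) ≤ phi ε s := le_phi hε (by omega)
        have : 0 ≤ phi ε s := le_trans (by positivity) this
        positivity) hS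
    have hY8 : 8 ≤ crudeB k0 * phi ε k := by
      have h1 : (8:ℝ) ≤ k := by exact_mod_cast hk0.trans hge
      have h2 := le_phi hε hk
      nlinarith
    have hks : 8 * (k:ℝ) * (crudeB k0 * phi ε s) ≤ crudeB k0 * phi ε k := by
      have : 8 * (k:ℝ) * phi ε s ≤ phi ε k := by
        unfold phi
        calc 8 * (k:ℝ) * (s * (1 + Real.log s) ^ (1 + ε))
            = k * (8 * s * (1 + Real.log s) ^ (1 + ε)) := by ring
          _ ≤ _ := by gcongr
      calc 8 * (k:ℝ) * (crudeB k0 * phi ε s) = crudeB k0 * (8 * (k:ℝ) * phi ε s) := by ring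
        _ ≤ _ := by gcongr
    have hphis : 0 ≤ crudeB k0 * phi ε s := by
      have : (s:ℝ) ≤ phi ε s := le_phi hε (by omega)
      have : 0 ≤ phi ε s := le_trans (by positivity) this
      positivity
    generalize crudeB k0 * phi ε k = Y at *
    generalize crudeB k0 * phi ε s = Z at *
    set A := (l:ℝ) ^ (k - 1) with hA
    have hA1 : 1 ≤ A := one_le_pow₀ (by linarith)
    have e1 : 2 * (l:ℝ) ^ (k - 2) ≤ A := by
      rw [hA, show k - 1 = (k - 2) + 1 by omega, pow_succ]
      nlinarith [pow_pos (show (0:ℝ) < l by linarith) (k - 2)]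
    have e2 : 32 * (k:ℝ) ^ 2 * (l:ℝ) ^ q ≤ A := by
      calc 32 * (k:ℝ) ^ 2 * (l:ℝ) ^ q ≤ (2:ℝ) ^ s * (l:ℝ) ^ q := by gcongr
        _ ≤ (l:ℝ) ^ s * (l:ℝ) ^ q := by gcongr
        _ = A := by rw [hA, ← pow_add]; congr 1; omega
    have hk1 : ((k - 1 : ℕ) : ℝ) = k - 1 := by rw [Nat.cast_sub hk, Nat.cast_one]
    have hk1' : (1:ℝ) ≤ k := by exact_mod_cast hk
    have hqk : (q:ℝ) ≤ k - 1 := by rw [← hk1]; exact_mod_cast (by omega : q ≤ k - 1)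
    have hq0 : (0:ℝ) ≤ q := by positivity
    have hX : 1 + 2 * ((k - 1 : ℕ) : ℝ) * q * Y ≤ 2 * k ^ 2 * Y := by
      rw [hk1]
      have : ((k:ℝ) - 1) * q ≤ (k - 1) * (k - 1) := by gcongr
      nlinarith [mul_le_mul_of_nonneg_right this (by linarith : 0 ≤ Y)]
    have t1 : Y * (l:ℝ) ^ (k - 2) ≤ Y * A / 2 := by nlinarith
    have t2 : 2 * (1 + 2 * ((k - 1 : ℕ) : ℝ) * q * Y) * (l:ℝ) ^ q ≤ Y * A / 8 := by
      calc _ ≤ 2 * (2 * (k:ℝ) ^ 2 * Y) * (l:ℝ) ^ q := by gcongr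
        _ = Y * (32 * (k:ℝ) ^ 2 * (l:ℝ) ^ q) / 8 := by ring
        _ ≤ _ := by gcongr
    have t3 : 1 ≤ Y * A / 8 := by nlinarith
    have t4 : 2 * ((k - 1 : ℕ) : ℝ) * Z * A ≤ Y * A / 4 := by
      have : 2 * ((k - 1 : ℕ) : ℝ) * Z ≤ Y / 4 := by rw [hk1]; nlinarith
      calc _ ≤ Y / 4 * A := by gcongr
        _ = _ := by ring
    linarith

lemma nodup_snoc {L : List α} {a : α} (h : L.Nodup) (ha : a ∉ L) : (L ++ [a]).Nodup := by
  rw [List.nodup_append]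
  refine ⟨h, by simp, ?_⟩
  intro b hb d hd hbd
  simp only [List.mem_singleton] at hd
  subst hbd; subst hd
  exact ha hb

/-- A strongly robust vertex. -/
def SR [Fintype V] (r : V → V → Prop) (c : V → V → α) (k : ℕ) (w : V) (C : Finset α) : Prop :=
  C.card = k - 1 ∧ (∀ u, r u w → c u w ∈ C) ∧ (∀ u, r w u → c w u ∈ C) ∧
  ∀ a ∈ C, (∃ u L, WK r c Finset.univ u L w ∧ L.Nodup ∧ L.toFinset = C.erase a) ∧
    (∃ u L, WK r c Finset.univ w L u ∧ L.Nodup ∧ L.toFinset = C.erase a)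

lemma out_sub {S : Finset V} {k : ℕ} (hS : NoRb r c S k) {u w : V} {L : List α}
    (hw : WK r c S u L w) (hn : L.Nodup) (hl : L.length + 1 = k) : OutC r c S w ⊆ L.toFinset := by
  intro a ha
  obtain ⟨x, hx, hr, rfl⟩ := exists_of_OutC ha
  by_contra hcon
  exact hS u (L ++ [c w x]) x (hw.append (WK.single hw.right hx hr))
    (nodup_snoc hn (by simpa using hcon)) (by simpa using hl)

lemma goodP [Fintype V] {l k : ℕ} (hP : Pot r c l) (hk : 2 ≤ k) (hS : NoRb r c Finset.univ k)
    (P : Finset V) (C : Finset α) (hC : C.card = k - 1)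
    (hO : ∀ w ∈ P, OutC r c Finset.univ w ⊆ C)
    (hI : ∀ w ∈ P, (OutC (fun x y => r y x) (fun x y => c y x) Finset.univ w).card ≤ k - 1)
    (hR : ∀ w ∈ P, Rob r c Finset.univ (k - 2) w)
    (hR' : ∀ w ∈ P, Rob (fun x y => r y x) (fun x y => c y x) Finset.univ (k - 2) w)
    (hno : ∀ w C, ¬ SR r c k w C) :
    (P.card : ℝ) ≤ (k - 1 : ℕ) * (4 * (l:ℝ) ^ (k - 2)) := by
  set I : V → Finset α := OutC (fun x y => r y x) (fun x y => c y x) Finset.univ with hIdef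
  set O : V → Finset α := OutC r c Finset.univ with hOdef
  have memO : ∀ u v, r u v → c u v ∈ O u := fun u v h => mem_OutC (Finset.mem_univ _) h
  have memI : ∀ u v, r u v → c u v ∈ I v := fun u v h =>
    mem_OutC (r := fun x y => r y x) (c := fun x y => c y x) (Finset.mem_univ u) h
  let P1 : α → Finset V := fun m => P.filter (fun w => m ∉ O w)
  let P2 : α → Finset V := fun m => P.filter (fun w => m ∉ I w)
  let P3 : α → Finset V := fun m => P.filter (fun w => O w = C ∧ ∃ u L,
    WK r c Finset.univ u L w ∧ L.Nodup ∧ L.length = k - 2 ∧ ¬ L.toFinset ⊆ C ∧ m ∉ L)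
  let P4 : α → Finset V := fun m => P.filter (fun w => I w = C ∧ ∃ u L,
    WK (fun x y => r y x) (fun x y => c y x) Finset.univ u L w ∧ L.Nodup ∧ L.length = k - 2 ∧
      ¬ L.toFinset ⊆ C ∧ m ∉ L)
  have hcov : P ⊆ C.biUnion (fun m => P1 m ∪ P2 m ∪ (P3 m ∪ P4 m)) := by
    intro w hw
    by_contra hcon
    have hcon' : ∀ m ∈ C, w ∉ P1 m ∧ w ∉ P2 m ∧ w ∉ P3 m ∧ w ∉ P4 m := by
      intro m hm
      simp only [Finset.mem_biUnion, not_exists, not_and, Finset.mem_union, not_or] at hcon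
      have := hcon m hm
      exact ⟨this.1.1, this.1.2, this.2.1, this.2.2⟩
    have hOC : O w = C := by
      refine Finset.Subset.antisymm (hO w hw) fun m hm => ?_
      have := (hcon' m hm).1
      by_contra h
      exact this (Finset.mem_filter.2 ⟨hw, h⟩)
    have hIC : I w = C := by
      refine (Finset.eq_of_subset_of_card_le (fun m hm => ?_) (by rw [hC]; exact hI w hw)).symm
      have := (hcon' m hm).2.1
      by_contra h
      exact this (Finset.mem_filter.2 ⟨hw, h⟩)
    have hcard : ∀ L : List α, L.length = k - 2 → ∃ m ∈ C, m ∉ L := by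
      intro L hL
      have h1 : L.toFinset.card ≤ k - 2 := (List.toFinset_card_le _).trans hL.le
      obtain ⟨m, hm, hmL⟩ := Finset.exists_mem_notMem_of_card_lt_card (s := L.toFinset) (t := C)
        (by omega)
      exact ⟨m, hm, by simpa using hmL⟩
    have h3 : ∀ u L, WK r c Finset.univ u L w → L.Nodup → L.length = k - 2 → L.toFinset ⊆ C := by
      intro u L h1 h2 h3
      obtain ⟨m, hm, hmL⟩ := hcard L h3
      by_contra h
      exact (hcon' m hm).2.2.1 (Finset.mem_filter.2 ⟨hw, hOC, u, L, h1, h2, h3, h, hmL⟩)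
    have h4 : ∀ u L, WK (fun x y => r y x) (fun x y => c y x) Finset.univ u L w → L.Nodup →
        L.length = k - 2 → L.toFinset ⊆ C := by
      intro u L h1 h2 h3
      obtain ⟨m, hm, hmL⟩ := hcard L h3
      by_contra h
      exact (hcon' m hm).2.2.2 (Finset.mem_filter.2 ⟨hw, hIC, u, L, h1, h2, h3, h, hmL⟩)
    have heq : ∀ a ∈ C, ∀ L : List α, L.Nodup → L.length = k - 2 → a ∉ L → L.toFinset ⊆ C →
        L.toFinset = C.erase a := by
      intro a ha L hn hl haL hsub
      refine Finset.eq_of_subset_of_card_le (fun b hb => ?_) ?_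
      · refine Finset.mem_erase.2 ⟨?_, hsub hb⟩
        rintro rfl
        exact haL (by simpa using hb)
      · rw [Finset.card_erase_of_mem ha, List.toFinset_card_of_nodup hn, hC]
        omega
    refine hno w C ⟨hC, fun u hu => hIC ▸ memI u w hu, fun u hu => hOC ▸ memO w u hu, ?_⟩
    intro a ha
    constructor
    · obtain ⟨u, L, q1, q2, q3, q4⟩ := hR w hw a
      exact ⟨u, L, q1, q2, heq a ha L q2 q3 q4 (h3 u L q1 q2 q3)⟩
    · obtain ⟨u, L, q1, q2, q3, q4⟩ := hR' w hw a
      refine ⟨u, L.reverse, q1.rev, by simpa using q2, ?_⟩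
      rw [List.toFinset_reverse]
      exact heq a ha L q2 q3 q4 (h4 u L q1 q2 q3)
  have hPC : ∀ u ∈ P, ∀ v, r u v → c u v ∈ C := fun u hu v h => hO u hu (memO u v h)
  have hcl : ∀ m ∈ C, ∀ Q : Finset V, Q ⊆ P → (∀ u ∈ Q, ∀ v ∈ Q, r u v → c u v ≠ m) →
      (Q.card : ℝ) ≤ (l:ℝ) ^ (k - 2) := by
    intro m hm Q hQ hne
    have := few hP (C.erase m) Q (fun u hu v hv huv =>
      Finset.mem_erase.2 ⟨hne u hu v hv huv, hPC u (hQ hu) v huv⟩)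
    rw [Finset.card_erase_of_mem hm, hC] at this
    exact this
  have hb1 : ∀ m ∈ C, ((P1 m).card : ℝ) ≤ (l:ℝ) ^ (k - 2) := by
    intro m hm
    refine hcl m hm _ (Finset.filter_subset _ _) fun u hu v hv huv h => ?_
    exact (Finset.mem_filter.1 hu).2 (h ▸ memO u v huv)
  have hb2 : ∀ m ∈ C, ((P2 m).card : ℝ) ≤ (l:ℝ) ^ (k - 2) := by
    intro m hm
    refine hcl m hm _ (Finset.filter_subset _ _) fun u hu v hv huv h => ?_
    exact (Finset.mem_filter.1 hv).2 (h ▸ memI u v huv)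
  have hkey : ∀ (L : List α) (m : α), L.length = k - 2 → C ⊆ (L ++ [m]).toFinset →
      L.toFinset ⊆ C := by
    intro L m hl hsub
    have h1 : ((L ++ [m]).toFinset).card ≤ k - 1 :=
      (List.toFinset_card_le _).trans (by simp [hl]; omega)
    have h2 := Finset.eq_of_subset_of_card_le hsub (by rw [hC]; exact h1)
    rw [h2]
    intro b hb
    simp only [List.mem_toFinset] at hb ⊢
    exact List.mem_append_left _ hb
  have hb3 : ∀ m ∈ C, ((P3 m).card : ℝ) ≤ (l:ℝ) ^ (k - 2) := by
    intro m hm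
    refine hcl m hm _ (Finset.filter_subset _ _) fun u hu v hv huv h => ?_
    obtain ⟨_, _, x, L, q1, q2, q3, q4, q5⟩ := Finset.mem_filter.1 hu
    obtain ⟨_, hv2, _⟩ := Finset.mem_filter.1 hv
    refine q4 (hkey L m q3 ?_)
    rw [← hv2]
    refine out_sub hS (u := x) (q1.append ?_) (nodup_snoc q2 q5) (by simp [q3]; omega)
    rw [← h]
    exact WK.single (Finset.mem_univ _) (Finset.mem_univ _) huv
  have hb4 : ∀ m ∈ C, ((P4 m).card : ℝ) ≤ (l:ℝ) ^ (k - 2) := by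
    intro m hm
    refine hcl m hm _ (Finset.filter_subset _ _) fun u hu v hv huv h => ?_
    obtain ⟨_, _, x, L, q1, q2, q3, q4, q5⟩ := Finset.mem_filter.1 hv
    obtain ⟨_, hv2, _⟩ := Finset.mem_filter.1 hu
    refine q4 (hkey L m q3 ?_)
    rw [← hv2]
    refine out_sub hS.rev (u := x) (q1.append ?_) (nodup_snoc q2 q5) (by simp [q3]; omega)
    rw [← h]
    exact WK.single (r := fun x y => r y x) (c := fun x y => c y x)
      (Finset.mem_univ v) (Finset.mem_univ u) huv
  have h5 := (Finset.card_le_card hcov).trans Finset.card_biUnion_le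
  have h6 : (P.card : ℝ) ≤ ∑ m ∈ C, ((P1 m ∪ P2 m ∪ (P3 m ∪ P4 m)).card : ℝ) := by
    exact_mod_cast h5
  refine h6.trans ((Finset.sum_le_sum (g := fun _ => 4 * (l:ℝ) ^ (k - 2)) fun m hm => ?_).trans ?_)
  · have a1 := Finset.card_union_le (P1 m ∪ P2 m) (P3 m ∪ P4 m)
    have a2 := Finset.card_union_le (P1 m) (P2 m)
    have a3 := Finset.card_union_le (P3 m) (P4 m)
    have a4 : ((P1 m ∪ P2 m ∪ (P3 m ∪ P4 m)).card : ℝ) ≤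
        (P1 m).card + (P2 m).card + ((P3 m).card + (P4 m).card) := by
      exact_mod_cast (by omega)
    linarith [hb1 m hm, hb2 m hm, hb3 m hm, hb4 m hm]
  · simp [hC]

lemma exists_SR [Fintype V] {l k : ℕ} (hl : 2 ≤ l) (hP : Pot r c l) (hk : 2 ≤ k)
    (hS : NoRb r c Finset.univ k) (κ : ℝ) (hκ : 0 ≤ κ)
    (hB : ∀ i, 1 ≤ i → i ≤ k - 1 → ∀ S', NoRb r c S' i → (S'.card : ℝ) ≤ κ * (l : ℝ) ^ (i - 1))
    (hB' : ∀ i, 1 ≤ i → i ≤ k - 1 → ∀ S', NoRb (fun x y => r y x) (fun x y => c y x) S' i →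
      (S'.card : ℝ) ≤ κ * (l : ℝ) ^ (i - 1))
    (hno : ∀ w C, ¬ SR r c k w C) :
    (Fintype.card V : ℝ) ≤ 2 * (κ * (l : ℝ) ^ (k - 2)) +
      2 * (2 * (1 + 2 * (k - 1 : ℕ) * (k - 2 : ℕ) * κ) * (l : ℝ) ^ (k - 2)) + 1
      + 2 * (k - 1 : ℕ) * ((k - 1 : ℕ) * (4 * (l:ℝ) ^ (k - 2))) := by
  set r' : V → V → Prop := fun x y => r y x with hr'
  set c' : V → V → α := fun x y => c y x with hc'
  set U : Finset V := Finset.univ with hU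
  set V0 := U.filter (fun v => ¬ (OutC r c U v).card ≤ k - 1) with hV0
  set V0' := U.filter (fun v => ¬ (OutC r' c' U v).card ≤ k - 1) with hV0'
  have h0 : (V0.card : ℝ) ≤ κ * (l : ℝ) ^ (k - 2) :=
    hB (k - 1) (by omega) (by omega) _ (v0bound (by omega) hS)
  have h0' : (V0'.card : ℝ) ≤ κ * (l : ℝ) ^ (k - 2) :=
    hB' (k - 1) (by omega) (by omega) _ (v0bound (by omega) hS.rev)
  set N := U.filter (fun v => (OutC r c U v).card ≤ k - 1 ∧ ¬ Rob r c U (k - 2) v) with hN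
  set N' := U.filter (fun v => (OutC r' c' U v).card ≤ k - 1 ∧ ¬ Rob r' c' U (k - 2) v) with hN'
  have h1 : (N.card : ℝ) ≤ 2 * (1 + 2 * (k - 1 : ℕ) * (k - 2 : ℕ) * κ) * (l : ℝ) ^ (k - 2) := by
    refine gbound hl hP U (k - 1) (k - 2) κ hκ (fun i hi hi' => hB i hi (by omega)) _ le_rfl N
      (Finset.filter_subset _ _) ?_ ?_
    · intro v hv; exact (Finset.mem_filter.1 hv).2.2
    · intro v hv; exact (Finset.mem_filter.1 hv).2.1
  have h1' : (N'.card : ℝ) ≤ 2 * (1 + 2 * (k - 1 : ℕ) * (k - 2 : ℕ) * κ) * (l : ℝ) ^ (k - 2) := by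
    refine gbound hl hP.rev U (k - 1) (k - 2) κ hκ (fun i hi hi' => hB' i hi (by omega)) _ le_rfl N'
      (Finset.filter_subset _ _) ?_ ?_
    · intro v hv; exact (Finset.mem_filter.1 hv).2.2
    · intro v hv; exact (Finset.mem_filter.1 hv).2.1
  set Q := U.filter (fun v => ((OutC r c U v).card ≤ k - 1 ∧ Rob r c U (k - 2) v) ∧
    ((OutC r' c' U v).card ≤ k - 1 ∧ Rob r' c' U (k - 2) v)) with hQ
  have h2 : (Q.card : ℝ) ≤ 1 + 2 * (k - 1 : ℕ) * ((k - 1 : ℕ) * (4 * (l:ℝ) ^ (k - 2))) := by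
    rcases Q.eq_empty_or_nonempty with h0 | hne
    · rw [h0]; simp only [Finset.card_empty, Nat.cast_zero]; positivity
    obtain ⟨v, hv, a, hpop⟩ := popular hP U Q (Finset.filter_subset _ _) hne (k - 1)
      (fun v hv => (Finset.mem_filter.1 hv).2.1.1)
    set P := Q.filter (fun w => r v w ∧ c v w = a) with hPdef
    obtain ⟨u, L, hL1, hL2, hL3, hL4⟩ := (Finset.mem_filter.1 hv).2.1.2 a
    have hClen : (L ++ [a]).length = k - 1 := by simp [hL3]; omega
    have hCnd := nodup_snoc hL2 hL4
    refine hpop.trans ?_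
    have := goodP hP hk hS P (L ++ [a]).toFinset
      (by rw [List.toFinset_card_of_nodup hCnd, hClen])
      (by
        intro w hw
        obtain ⟨hw1, hw2, hw3⟩ := Finset.mem_filter.1 hw
        refine out_sub hS (u := u) (hL1.append ?_) hCnd (by omega)
        rw [← hw3]
        exact WK.single (Finset.mem_univ _) (Finset.mem_univ _) hw2)
      (fun w hw => (Finset.mem_filter.1 (Finset.mem_filter.1 hw).1).2.2.1)
      (fun w hw => (Finset.mem_filter.1 (Finset.mem_filter.1 hw).1).2.1.2)
      (fun w hw => (Finset.mem_filter.1 (Finset.mem_filter.1 hw).1).2.2.2) hno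
    gcongr
  have hcov : U ⊆ (V0 ∪ V0') ∪ (N ∪ N') ∪ Q := by
    intro v hv
    simp only [Finset.mem_union, hV0, hV0', hN, hN', hQ, Finset.mem_filter, hv, true_and]
    tauto
  have a0 := Finset.card_le_card hcov
  have a1 := Finset.card_union_le ((V0 ∪ V0') ∪ (N ∪ N')) Q
  have a2 := Finset.card_union_le (V0 ∪ V0') (N ∪ N')
  have a3 := Finset.card_union_le V0 V0'
  have a4 := Finset.card_union_le N N'
  have a5 : U.card = Fintype.card V := Finset.card_univ
  have a6 : (Fintype.card V : ℝ) ≤ V0.card + V0'.card + (N.card + N'.card) + Q.card := by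
    exact_mod_cast (by omega)
  linarith

lemma SR_bound [Fintype V] {l k M : ℕ} (hl : 2 ≤ l) (hP : Pot r c l) (hk : 2 ≤ k)
    (hS : NoRb r c Finset.univ k) (w : V) (C : Finset α) (hSR : SR r c k w C)
    (hM : ∀ S : Finset V, (∀ d u v, ¬ WK r c S u [d, d] v) → NoRb r c S k → S.card ≤ M) :
    Fintype.card V * 2 ^ (k - 1) ≤ l ^ (k - 1) * M := by
  obtain ⟨hC, hin, hout, hrb⟩ := hSR
  obtain ⟨h, hh, hinc⟩ := hP.pot
  let Sx : (C → Fin l) → Finset V := fun x => Finset.univ.filter (fun u =>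
    ∀ d : C, h d u = (x d).1 ∨ h d u = ((x d).1 + 1) % l)
  have hlenC : ∀ a ∈ C, ∀ L : List α, L.Nodup → L.toFinset = C.erase a → L.length = k - 2 := by
    intro a ha L hn hL
    have := List.toFinset_card_of_nodup hn
    rw [hL, Finset.card_erase_of_mem ha, hC] at this
    omega
  have hup : ∀ x, (Sx x).card ≤ M := by
    intro x
    refine hM _ ?_ (fun u L v hw => hS u L v (hw.mono (Finset.subset_univ _)))
    rintro d u v ⟨hu, y, huy, hcuy, hy, z, hyz, hcyz, rfl, hz⟩
    by_cases hd : d ∈ C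
    · have i1 := hinc u y huy
      have i2 := hinc y z hyz
      rw [hcuy] at i1
      rw [hcyz] at i2
      have j1 := (Finset.mem_filter.1 hu).2 ⟨d, hd⟩
      have j2 := (Finset.mem_filter.1 hy).2 ⟨d, hd⟩
      have j3 := (Finset.mem_filter.1 hz).2 ⟨d, hd⟩
      simp only at j1 j2 j3
      generalize ((x ⟨d, hd⟩).1 + 1) % l = e at *
      omega
    · have hyw : y ≠ w := by
        rintro rfl
        exact hd (hcuy ▸ hin u huy)
      have wu : WK r c Finset.univ u [d] y := ⟨Finset.mem_univ _, y, huy, hcuy, rfl, Finset.mem_univ _⟩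
      have wz : WK r c Finset.univ y [d] z := ⟨Finset.mem_univ _, z, hyz, hcyz, rfl, Finset.mem_univ _⟩
      rcases hP.tot y w hyw with hr | hr
      · obtain ⟨s, L, q1, q2, q3⟩ := (hrb _ (hin y hr)).2
        have q4 := hlenC _ (hin y hr) L q2 q3
        have qm : ∀ b, b ∈ L ↔ b ≠ c y w ∧ b ∈ C := fun b => by
          rw [← List.mem_toFinset, q3, Finset.mem_erase]
        refine hS u ([d] ++ ([c y w] ++ L)) s (wu.append ((WK.single (Finset.mem_univ _)
          (Finset.mem_univ _) hr).append q1)) ?_ (by simp [q4]; omega)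
        simp only [List.singleton_append, List.nodup_cons, List.mem_cons, qm, q2]
        refine ⟨?_, by simp, trivial⟩
        rintro (e | e)
        · exact hd (e ▸ hin y hr)
        · exact hd e.2
      · obtain ⟨s, L, q1, q2, q3⟩ := (hrb _ (hout y hr)).1
        have q4 := hlenC _ (hout y hr) L q2 q3
        have qm : ∀ b, b ∈ L ↔ b ≠ c w y ∧ b ∈ C := fun b => by
          rw [← List.mem_toFinset, q3, Finset.mem_erase]
        refine hS s ((L ++ [c w y]) ++ [d]) z ((q1.append (WK.single (Finset.mem_univ _)
          (Finset.mem_univ _) hr)).append wz) ?_ (by simp [q4]; omega)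
        refine nodup_snoc (nodup_snoc q2 (by simp [qm])) ?_
        simp only [List.mem_append, List.mem_singleton, qm]
        rintro (e | e)
        · exact hd e.2
        · exact hd (e ▸ hout y hr)
  have hlow : ∀ u : V, 2 ^ (k - 1) ≤ ((Finset.univ : Finset (C → Fin l)).filter
      (fun x => u ∈ Sx x)).card := by
    intro u
    have hsub : Fintype.piFinset (fun d : C => (Finset.univ : Finset (Fin l)).filter
        (fun y => h d u = y.1 ∨ h d u = (y.1 + 1) % l)) ⊆ (Finset.univ : Finset (C → Fin l)).filter
      (fun x => u ∈ Sx x) := by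
      intro x hx
      rw [Fintype.mem_piFinset] at hx
      refine Finset.mem_filter.2 ⟨Finset.mem_univ _, Finset.mem_filter.2 ⟨Finset.mem_univ _, ?_⟩⟩
      intro d
      exact (Finset.mem_filter.1 (hx d)).2
    refine le_trans ?_ (Finset.card_le_card hsub)
    rw [Fintype.card_piFinset]
    calc 2 ^ (k - 1) = ∏ _d : C, 2 := by simp [hC]
      _ ≤ _ := by
        refine Finset.prod_le_prod' fun d _ => ?_
        have hd := hh d u
        refine Finset.one_lt_card.2 ⟨⟨h d u, hd⟩, by simp,
          ⟨if h d u = 0 then l - 1 else h d u - 1, by split_ifs <;> omega⟩, ?_, ?_⟩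
        · refine Finset.mem_filter.2 ⟨Finset.mem_univ _, Or.inr ?_⟩
          show h d u = ((if h d u = 0 then l - 1 else h d u - 1) + 1) % l
          split_ifs with h0
          · rw [h0, Nat.sub_add_cancel (by omega), Nat.mod_self]
          · rw [Nat.sub_add_cancel (by omega), Nat.mod_eq_of_lt hd]
        · intro e
          have := congrArg Fin.val e
          simp only at this
          split_ifs at this <;> omega
  have hdc : ∑ x : C → Fin l, (Sx x).card = ∑ u : V, ((Finset.univ : Finset (C → Fin l)).filter
      (fun x => u ∈ Sx x)).card := by
    have := Finset.sum_card_bipartiteAbove_eq_sum_card_bipartiteBelow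
      (s := (Finset.univ : Finset (C → Fin l))) (t := (Finset.univ : Finset V))
      (fun x u => u ∈ Sx x)
    simp only [Finset.bipartiteAbove, Finset.bipartiteBelow] at this
    rw [← this]
    refine Finset.sum_congr rfl fun x _ => ?_
    congr 1
    ext u
    simp
  calc Fintype.card V * 2 ^ (k - 1) = ∑ _u : V, 2 ^ (k - 1) := by simp
    _ ≤ _ := Finset.sum_le_sum fun u _ => hlow u
    _ = _ := hdc.symm
    _ ≤ ∑ _x : C → Fin l, M := Finset.sum_le_sum fun x _ => hup x
    _ = l ^ (k - 1) * M := by simp [hC]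

/-! ### Conversions between walks as functions and walks as colour lists -/

lemma WK.toFun {n : ℕ} {α : Type} {r : Fin n → Fin n → Prop} {c : Fin n → Fin n → α} :
    ∀ {L : List α} {u v : Fin n}, WK r c Finset.univ u L v →
    ∃ x : Fin (L.length + 1) → Fin n, IsWalk r x ∧ walkColours c x = L.get ∧ x 0 = u
  | [], u, v, h => ⟨fun _ => u, fun i => i.elim0, funext fun i => i.elim0, rfl⟩
  | a :: L, u, v, h => by
    obtain ⟨_, y, h2, h3, h⟩ := h
    obtain ⟨x, hx1, hx2, hx3⟩ := WK.toFun h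
    refine ⟨Fin.cons u x, ?_, ?_, rfl⟩
    · intro i
      induction i using Fin.cases with
      | zero =>
        show r u (x 0)
        rw [hx3]; exact h2
      | succ i => exact hx1 i
    · funext i
      induction i using Fin.cases with
      | zero =>
        show c u (x 0) = a
        rw [hx3]; exact h3
      | succ i => exact congrFun hx2 i

lemma WK.ofFun {V α : Type} {r : V → V → Prop} {c : V → V → α} {S : Finset V} :
    ∀ {m : ℕ} (x : Fin (m + 1) → V), (∀ i, x i ∈ S) →
    (∀ i : Fin m, r (x i.castSucc) (x i.succ)) →
    WK r c S (x 0) (List.ofFn fun i : Fin m => c (x i.castSucc) (x i.succ)) (x (Fin.last m))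
  | 0, x, h, _ => by
    simp only [List.ofFn_zero]
    exact ⟨rfl, h 0⟩
  | m + 1, x, h, hr => by
    rw [List.ofFn_succ]
    exact ⟨h 0, x (Fin.succ 0), hr 0, rfl,
      WK.ofFun (fun i => x i.succ) (fun i => h _) (fun i => hr i.succ)⟩

lemma noRb_of {n k : ℕ} {α : Type} {r : Fin n → Fin n → Prop} {c : Fin n → Fin n → α}
    (h : ¬ HasRainbow k r c) : NoRb r c Finset.univ k := by
  intro u L v hw hnd hlen
  subst hlen
  obtain ⟨x, h1, h2, _⟩ := hw.toFun
  exact h ⟨x, h1, by rw [h2]; exact List.nodup_iff_injective_get.1 hnd⟩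

lemma flash_of {n l : ℕ} {α : Type} {r : Fin n → Fin n → Prop} {c : Fin n → Fin n → α}
    (h : ¬ HasFlash l r c) (d : α) (u v : Fin n)
    (hw : WK r c Finset.univ u (List.replicate l d) v) : False := by
  have key : ∀ L : List α, (∀ a ∈ L, a = d) → L.length = l → WK r c Finset.univ u L v → False := by
    clear hw
    intro L hL hlen hw
    subst hlen
    obtain ⟨x, h1, h2, _⟩ := hw.toFun
    refine h ⟨x, h1, fun i j => ?_⟩
    rw [h2, hL _ (List.get_mem L i), hL _ (List.get_mem L j)]
  exact key _ (fun a ha => List.eq_of_mem_replicate ha) (by simp) hw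

lemma pot_of {n l : ℕ} {α : Type} {r : Fin n → Fin n → Prop} {c : Fin n → Fin n → α}
    (hl : 1 ≤ l) (hT : IsTournament r) (h : ¬ HasFlash l r c) : Pot r c l := by
  refine ⟨fun u v huv => ?_, ?_⟩
  · by_cases hr : r v u
    · exact Or.inr hr
    · exact Or.inl ((hT.2 u v huv).2 hr)
  · refine ⟨fun d v => Nat.findGreatest
      (fun m => ∃ u, WK r c Finset.univ u (List.replicate m d) v) (l - 1), fun d v => ?_, ?_⟩
    · have := Nat.findGreatest_le
        (P := fun m => ∃ u, WK r c Finset.univ u (List.replicate m d) v) (l - 1)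
      exact lt_of_le_of_lt this (by omega)
    · intro u v huv
      beta_reduce
      set d := c u v with hd
      have hsp : ∃ w, WK r c Finset.univ w (List.replicate (Nat.findGreatest
          (fun m => ∃ w, WK r c Finset.univ w (List.replicate m d) u) (l - 1)) d) u :=
        Nat.findGreatest_spec (P := fun m => ∃ w, WK r c Finset.univ w (List.replicate m d) u)
          (Nat.zero_le (l - 1)) ⟨u, rfl, Finset.mem_univ u⟩
      have hle := Nat.findGreatest_le
        (P := fun m => ∃ w, WK r c Finset.univ w (List.replicate m d) u) (l - 1)
      generalize Nat.findGreatest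
        (fun m => ∃ w, WK r c Finset.univ w (List.replicate m d) u) (l - 1) = m at hsp hle ⊢
      obtain ⟨w, hw⟩ := hsp
      have hw' : WK r c Finset.univ w (List.replicate (m + 1) d) v := by
        rw [List.replicate_succ']
        exact hw.append ⟨Finset.mem_univ u, v, huv, rfl, rfl, Finset.mem_univ v⟩
      have hm : m + 1 ≤ l - 1 := by
        by_contra hcon
        have : m + 1 = l := by omega
        rw [this] at hw'
        exact flash_of h d w v hw'
      exact Nat.lt_of_succ_le (Nat.le_findGreatest
        (P := fun m => ∃ w, WK r c Finset.univ w (List.replicate m d) v) hm ⟨w, hw'⟩)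

lemma t2_mem {k : ℕ} (hk : 2 ≤ k) : t 2 k ∈ tSet 2 k := by
  apply Nat.sInf_mem
  obtain ⟨κ, _, hκ⟩ := mainBound 1 one_pos
  refine ⟨⌊κ * phi 1 k * ((2 : ℕ) : ℝ) ^ (k - 1)⌋₊, ?_⟩
  intro n hn r hT α c
  by_contra hcon
  push Not at hcon
  have := hκ (Fin n) α r c 2 le_rfl (pot_of (by norm_num) hT hcon.1) k (by omega) Finset.univ
    (noRb_of hcon.2)
  rw [Finset.card_univ, Fintype.card_fin] at this
  exact absurd (Nat.le_floor this) (by omega)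

lemma card_le_t2 {n k : ℕ} (hk : 2 ≤ k) {α : Type} {r : Fin n → Fin n → Prop}
    {c : Fin n → Fin n → α} (hT : IsTournament r) (S : Finset (Fin n))
    (hS : ∀ d u v, ¬ WK r c S u [d, d] v) (hN : NoRb r c S k) : S.card ≤ t 2 k := by
  by_contra hcon
  push Not at hcon
  let e : Fin S.card → Fin n := fun i => (S.equivFin.symm i : Fin n)
  have he : Function.Injective e := fun i j hij =>
    S.equivFin.symm.injective (Subtype.ext hij)
  have heS : ∀ i, e i ∈ S := fun i => (S.equivFin.symm i).2
  rcases t2_mem hk S.card hcon (fun i j => r (e i) (e j))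
    ⟨fun v => hT.1 _, fun u v huv => hT.2 _ _ (fun h => huv (he h))⟩ α
    (fun i j => c (e i) (e j)) with ⟨x, h1, h2⟩ | ⟨x, h1, h2⟩
  · have := WK.ofFun (r := r) (c := c) (S := S) (fun i => e (x i)) (fun i => heS _) h1
    have h01 := h2 0 1
    simp only [walkColours] at h01
    simp only [List.ofFn_succ, List.ofFn_zero] at this
    apply hS (c (e (x (Fin.castSucc 1))) (e (x (Fin.succ 1)))) (e (x 0)) (e (x (Fin.last 2)))
    rw [h01] at this
    exact this
  · exact hN _ _ _ (WK.ofFun (r := r) (c := c) (S := S) (fun i => e (x i)) (fun i => heS _) h1)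
      (List.nodup_ofFn.2 h2) (by simp)

lemma final_arith {ε κ : ℝ} (hε : 0 < ε) (hκ : 1 ≤ κ) {k : ℕ} (hk : 2 ≤ k) :
    phi ε k ≤ k * ((3 : ℝ) ^ (1 + ε) * Real.log k ^ (1 + ε)) := by
  have hk' : (2 : ℝ) ≤ k := by exact_mod_cast hk
  have hlog : Real.log 2 ≤ Real.log k := Real.log_le_log (by norm_num) hk'
  have h2 := Real.log_two_gt_d9
  unfold phi
  rw [← Real.mul_rpow (by norm_num) (by linarith)]
  gcongr
  linarith

lemma t_bound_aux (ε : ℝ) (hε : 0 < ε) :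
    ∃ C : ℝ, 0 < C ∧ ∀ l k : ℕ, 0 < l → 2 ≤ k →
      (t l k : ℝ) ≤ max (C * (k : ℝ) ^ 3 * Real.log k ^ ((1 : ℝ) + ε) * (l : ℝ) ^ (k - 2))
        ((t 2 k : ℝ) * ((l : ℝ) / 2) ^ (k - 1)) := by
  obtain ⟨κ, hκ, hB⟩ := mainBound ε hε
  refine ⟨100 * κ * (3 : ℝ) ^ (1 + ε), by positivity, ?_⟩
  intro l k hl hk
  have hk' : (2 : ℝ) ≤ k := by exact_mod_cast hk
  have hl' : (1 : ℝ) ≤ l := by exact_mod_cast hl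
  set P : ℝ := (l : ℝ) ^ (k - 2) with hP
  have hP1 : 1 ≤ P := one_le_pow₀ hl'
  have hphi := final_arith hε hκ hk
  have hkphi := le_phi hε (k := k) (by omega)
  -- the first term dominates
  have hfirst : 100 * κ * (k : ℝ) ^ 2 * phi ε k * P ≤
      100 * κ * (3 : ℝ) ^ (1 + ε) * (k : ℝ) ^ 3 * Real.log k ^ ((1 : ℝ) + ε) * P := by
    have : 100 * κ * (k : ℝ) ^ 2 * phi ε k ≤ 100 * κ * (k : ℝ) ^ 2 *
      (k * ((3 : ℝ) ^ (1 + ε) * Real.log k ^ (1 + ε))) := by gcongr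
    calc _ ≤ 100 * κ * (k : ℝ) ^ 2 *
      (k * ((3 : ℝ) ^ (1 + ε) * Real.log k ^ (1 + ε))) * P := by gcongr
      _ = _ := by ring
  set X := max (100 * κ * (3 : ℝ) ^ (1 + ε) * (k : ℝ) ^ 3 * Real.log k ^ ((1 : ℝ) + ε) * P)
        ((t 2 k : ℝ) * ((l : ℝ) / 2) ^ (k - 1)) with hX
  have hXfirst : 100 * κ * (k : ℝ) ^ 2 * phi ε k * P ≤ X := hfirst.trans (le_max_left _ _)
  have hbig : 1 ≤ 100 * κ * (k : ℝ) ^ 2 * phi ε k * P := by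
    have a1 : (1 : ℝ) ≤ 100 * κ := by linarith
    have a2 : (1 : ℝ) ≤ (k : ℝ) ^ 2 := one_le_pow₀ (by linarith)
    have a3 : (1 : ℝ) ≤ phi ε k := by linarith
    exact one_le_mul_of_one_le_of_one_le (one_le_mul_of_one_le_of_one_le
      (one_le_mul_of_one_le_of_one_le a1 a2) a3) hP1
  have hX0 : 0 ≤ X := by linarith
  suffices hmem : ⌊X⌋₊ ∈ tSet l k by
    have h1 : t l k ≤ ⌊X⌋₊ := Nat.sInf_le hmem
    calc (t l k : ℝ) ≤ (⌊X⌋₊ : ℝ) := by exact_mod_cast h1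
      _ ≤ X := Nat.floor_le hX0
  intro n hn r hT α c
  by_contra hcon
  push Not at hcon
  obtain ⟨hF, hR⟩ := hcon
  suffices hnX : (n : ℝ) ≤ X by exact absurd (Nat.le_floor hnX) (by omega)
  have hPot := pot_of hl hT hF
  have hNo := noRb_of hR
  rcases Nat.lt_or_ge l 2 with hl2 | hl2
  · -- `l = 1`
    have hl1 : l = 1 := by omega
    subst hl1
    have hn1 : n ≤ 1 := by
      by_contra hn2
      push Not at hn2
      obtain ⟨h, h1, h2⟩ := hPot.pot
      have hne : (⟨0, by omega⟩ : Fin n) ≠ ⟨1, hn2⟩ := by simp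
      rcases hPot.tot _ _ hne with hr | hr
      · have := h2 _ _ hr
        have := h1 (c ⟨0, by omega⟩ ⟨1, hn2⟩) ⟨1, hn2⟩
        omega
      · have := h2 _ _ hr
        have := h1 (c ⟨1, hn2⟩ ⟨0, by omega⟩) ⟨0, by omega⟩
        omega
    have : (n : ℝ) ≤ 1 := by exact_mod_cast hn1
    linarith
  · by_cases hSR : ∃ w C, SR r c k w C
    · obtain ⟨w, C, hSR⟩ := hSR
      have hb := SR_bound (M := t 2 k) hl2 hPot hk hNo w C hSR
        (fun S h1 h2 => card_le_t2 hk hT S h1 h2)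
      rw [Fintype.card_fin] at hb
      have hb' : (n : ℝ) * 2 ^ (k - 1) ≤ (l : ℝ) ^ (k - 1) * t 2 k := by exact_mod_cast hb
      refine le_trans ?_ (le_max_right _ _)
      rw [div_pow, ← mul_div_assoc, le_div_iff₀ (by positivity)]
      linarith
    · push Not at hSR
      have hphi0 : (1 : ℝ) ≤ phi ε k := by linarith
      have hbd : ∀ (r' : Fin n → Fin n → Prop) (c' : Fin n → Fin n → α), Pot r' c' l →
          ∀ i, 1 ≤ i → i ≤ k - 1 → ∀ S', NoRb r' c' S' i →
          (S'.card : ℝ) ≤ κ * phi ε k * (l : ℝ) ^ (i - 1) := by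
        intro r' c' hp i hi hik S' hS'
        refine (hB _ _ r' c' l hl2 hp i hi S' hS').trans ?_
        have := phi_mono hε hi (show i ≤ k by omega)
        gcongr
      have hfin := exists_SR hl2 hPot hk hNo (κ * phi ε k) (by positivity)
        (hbd r c hPot) (hbd _ _ hPot.rev) hSR
      rw [Fintype.card_fin, ← hP] at hfin
      refine le_trans (hfin.trans ?_) hXfirst
      have c1 : ((k - 1 : ℕ) : ℝ) ≤ k := by exact_mod_cast Nat.sub_le k 1
      have c2 : ((k - 2 : ℕ) : ℝ) ≤ k := by exact_mod_cast Nat.sub_le k 2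
      set a : ℝ := ((k - 1 : ℕ) : ℝ)
      set b : ℝ := ((k - 2 : ℕ) : ℝ)
      have ha : 0 ≤ a := Nat.cast_nonneg _
      have hb : 0 ≤ b := Nat.cast_nonneg _
      set F := κ * phi ε k with hFdef
      have hF1 : 1 ≤ F := one_le_mul_of_one_le_of_one_le hκ hphi0
      have hab : a * b ≤ (k : ℝ) ^ 2 := by rw [sq]; gcongr
      have haa : a * a ≤ (k : ℝ) ^ 2 := by rw [sq]; gcongr
      have hk2 : (1 : ℝ) ≤ (k : ℝ) ^ 2 := one_le_pow₀ (by linarith)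
      set K : ℝ := (k : ℝ) ^ 2
      have hKF : 1 ≤ K * F := one_le_mul_of_one_le_of_one_le hk2 hF1
      have s1 : F ≤ K * F := le_mul_of_one_le_left (by linarith) hk2
      have s2 : K ≤ K * F := le_mul_of_one_le_right (by linarith) hF1
      have s3 : a * b * F ≤ K * F := by gcongr
      have hPP : 1 ≤ K * F * P := one_le_mul_of_one_le_of_one_le hKF hP1
      have hsum : 2 * F + 4 * (1 + 2 * (a * b * F)) + 8 * (a * a) ≤ 22 * (K * F) := by linarith
      have hm := mul_le_mul_of_nonneg_right hsum (show 0 ≤ P by linarith)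
      calc 2 * (F * P) + 2 * (2 * (1 + 2 * a * b * F) * P) + 1 + 2 * a * (a * (4 * P))
          = (2 * F + 4 * (1 + 2 * (a * b * F)) + 8 * (a * a)) * P + 1 := by ring
        _ ≤ 100 * (K * F * P) := by linarith
        _ = 100 * κ * K * phi ε k * P := by rw [hFdef]; ring

end Main



/-- For every ε > 0 there is a constant C_ε > 0 such that for all positive l and all
k ≥ 2, t(l,k) ≤ max{ C_ε · k³ · (log k)^{1+ε} · l^{k-2}, t(2,k) · (l/2)^{k-1} }. -/
theorem t_bound_with_t2 (ε : ℝ) (hε : 0 < ε) :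
    ∃ C : ℝ, 0 < C ∧ ∀ l k : ℕ, 0 < l → 2 ≤ k →
      (t l k : ℝ) ≤ max (C * (k : ℝ) ^ 3 * Real.log k ^ ((1 : ℝ) + ε) * (l : ℝ) ^ (k - 2))
        ((t 2 k : ℝ) * ((l : ℝ) / 2) ^ (k - 1)) := by
  exact t_bound_aux ε hε
end
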